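/- arXiv:2207.04450 — 5 statements merged into one kernel-verified Lean document; each statement's English description precedes it below -/
import Mathlib

section
/- Let p be a prime and let f : A → B be a flat homomorphism of commutative rings of characteristic p. Let C denote the ring A ⊗_A B in which the left tensor factor A is regarded as an A-algebra via the Frobenius endomorphism a ↦ a^p, and regard B as a C-algebra via the relative Frobenius homomorphism Φ : C → B, Φ(a ⊗ b) = f(a)·b^p. Assume that B has finite flat dimension as a C-module, i.e. there exists d such that Tor_n^C(B, M) = 0 for every C-module M and every n ≥ d. Then f is discretely regular. -/
open TensorProduct CategoryTheory CategoryTheory.Limits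

universe u v

/-- A (flat) ring homomorphism `A → B` is *discretely regular* if it is flat and, for every
prime ideal `q` of `B`, the localization `B_q` is formally smooth over `A` for the ideal
`q B_q` with the discrete topology: every `A`-algebra map `B_q → C/M` with `M` square-zero,
such that the preimage in `C` of the ideal generated by the image of `q B_q` kills `M`,
lifts to an `A`-algebra map `B_q → C`. -/
def DiscretelyRegular (A : Type u) (B : Type v) [CommRing A] [CommRing B] [Algebra A B] : Prop :=
  Module.Flat A B ∧
  ∀ (q : Ideal B) [q.IsPrime],
    letI : Algebra A (Localization.AtPrime q) :=
      ((algebraMap B (Localization.AtPrime q)).comp (algebraMap A B)).toAlgebra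
    ∀ (C : Type (max u v)) [CommRing C] [Algebra A C] (M : Ideal C), M ^ 2 = ⊥ →
      ∀ u : Localization.AtPrime q →ₐ[A] C ⧸ M,
        (Ideal.comap (Ideal.Quotient.mk M)
            (Ideal.map u (Ideal.map (algebraMap B (Localization.AtPrime q)) q))) * M = ⊥ →
        ∃ g : Localization.AtPrime q →ₐ[A] C, (Ideal.Quotient.mkₐ A M).comp g = u

/-- `Frob p A` is the ring `A`, regarded as an `A`-algebra via the Frobenius `a ↦ a ^ p`. -/
def Frob (p : ℕ) (A : Type u) : Type u := A

instance Frob.instCommRing (p : ℕ) (A : Type u) [CommRing A] : CommRing (Frob p A) :=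
  ‹CommRing A›

noncomputable instance Frob.instAlgebra (p : ℕ) (A : Type u) [CommRing A] [Fact p.Prime]
    [CharP A p] : Algebra A (Frob p A) :=
  RingHom.toAlgebra (frobenius A p)

/-- The identity map of `A`, viewed as landing in `Frob p A`. -/
def toFrob (p : ℕ) {A : Type u} (a : A) : Frob p A := a

/-- The module `M` has flat dimension at most `n`, expressed by iterated kernels of surjections
from flat modules. -/
def FlatDimLE (R : Type u) [CommRing R] :
    ℕ → ∀ (M : Type u) [AddCommGroup M] [Module R M], Prop
  | 0, M, _, _ => Module.Flat R M
  | n + 1, M, _, _ => ∀ (F : Type u) [AddCommGroup F] [Module R F] [Module.Flat R F]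
      (g : F →ₗ[R] M), Function.Surjective g → FlatDimLE R n (LinearMap.ker g)

/-- Vanishing of `Tor_{m+1}(M, R/I)` for all ideals `I` and all `m ≥ n`, in terms of a projective
resolution of `R/I`. -/
def TorVanishes (R : Type u) [CommRing R] (n : ℕ) (M : Type u) [AddCommGroup M] [Module R M] :
    Prop :=
  ∀ I : Ideal R, ∃ (Q : ℕ → ModuleCat.{u} R) (d : ∀ i, Q (i + 1) →ₗ[R] Q i) (e : Q 0 →ₗ[R] R ⧸ I),
    (∀ i, Module.Projective R (Q i)) ∧ Function.Surjective e ∧ Function.Exact (d 0) e ∧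
    (∀ i, Function.Exact (d (i + 1)) (d i)) ∧
    ∀ m, n ≤ m → Function.Exact ((d (m + 1)).lTensor M) ((d m).lTensor M)

section FlatDimension

variable {R : Type u} [CommRing R]

theorem exact_lTensor_ker_of_exact {F M Q₀ Q₁ Q₂ Q₃ : Type u}
    [AddCommGroup F] [Module R F] [AddCommGroup M] [Module R M]
    [AddCommGroup Q₀] [Module R Q₀] [AddCommGroup Q₁] [Module R Q₁]
    [AddCommGroup Q₂] [Module R Q₂] [AddCommGroup Q₃] [Module R Q₃]
    [Module.Flat R F] [Module.Flat R Q₁]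
    (g : F →ₗ[R] M) (hg : Function.Surjective g)
    (d₂ : Q₃ →ₗ[R] Q₂) (d₁ : Q₂ →ₗ[R] Q₁) (d₀ : Q₁ →ₗ[R] Q₀)
    (h₂ : Function.Exact d₂ d₁) (h₁ : Function.Exact d₁ d₀)
    (hM : Function.Exact (d₂.lTensor M) (d₁.lTensor M)) :
    Function.Exact (d₁.lTensor (LinearMap.ker g)) (d₀.lTensor (LinearMap.ker g)) := by
  set i := (LinearMap.ker g).subtype with hi
  have hex : ∀ (Q : Type u) [AddCommGroup Q] [Module R Q],
      Function.Exact (i.rTensor Q) (g.rTensor Q) := fun Q _ _ =>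
    rTensor_exact Q (LinearMap.exact_subtype_ker_map g) hg
  have hcomm : ∀ {X Y P P' : Type u} [AddCommGroup X] [Module R X] [AddCommGroup Y] [Module R Y]
      [AddCommGroup P] [Module R P] [AddCommGroup P'] [Module R P'] (a : X →ₗ[R] Y)
      (b : P →ₗ[R] P') (t : X ⊗[R] P),
      a.rTensor P' (b.lTensor X t) = b.lTensor Y (a.rTensor P t) := by
    intro X Y P P' _ _ _ _ _ _ _ _ a b t
    rw [← LinearMap.comp_apply, ← LinearMap.comp_apply, LinearMap.rTensor_comp_lTensor,
      LinearMap.lTensor_comp_rTensor]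
  have hcomp : d₀.comp d₁ = 0 := LinearMap.ext h₁.apply_apply_eq_zero
  intro x
  constructor
  · intro hx
    have h0 : d₀.lTensor F (i.rTensor Q₁ x) = 0 := by rw [← hcomm, hx, map_zero]
    obtain ⟨y, hy⟩ := (Module.Flat.lTensor_exact F h₁ _).1 h0
    have h3 : d₁.lTensor M (g.rTensor Q₂ y) = 0 := by
      rw [← hcomm, hy, (hex Q₁).apply_apply_eq_zero]
    obtain ⟨w, hw⟩ := (hM _).1 h3
    obtain ⟨w', rfl⟩ := LinearMap.rTensor_surjective Q₃ hg w
    have h4 : g.rTensor Q₂ (y - d₂.lTensor F w') = 0 := by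
      rw [map_sub, hcomm, hw, sub_self]
    obtain ⟨z, hz⟩ := (hex Q₂ _).1 h4
    refine ⟨z, ?_⟩
    have hinj : Function.Injective (i.rTensor Q₁) :=
      Module.Flat.rTensor_preserves_injective_linearMap i (Submodule.injective_subtype _)
    apply hinj
    rw [hcomm, hz, map_sub, hy, (Module.Flat.lTensor_exact F h₂).apply_apply_eq_zero, sub_zero]
  · rintro ⟨y, rfl⟩
    rw [← LinearMap.comp_apply, ← LinearMap.lTensor_comp, hcomp, LinearMap.lTensor_zero]
    rfl

theorem TorVanishes.ker {n : ℕ} {M : Type u} [AddCommGroup M] [Module R M]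
    (h : TorVanishes R (n + 1) M) {F : Type u} [AddCommGroup F] [Module R F] [Module.Flat R F]
    (g : F →ₗ[R] M) (hg : Function.Surjective g) : TorVanishes R n (LinearMap.ker g) := by
  intro I
  obtain ⟨Q, d, e, hQ, he, h0, hd, hT⟩ := h I
  refine ⟨Q, d, e, hQ, he, h0, hd, fun m hm => ?_⟩
  have := hQ (m + 1)
  exact exact_lTensor_ker_of_exact g hg (d (m + 2)) (d (m + 1)) (d m) (hd _) (hd _)
    (hT (m + 1) (by omega))

theorem TorVanishes.flat {M : Type u} [AddCommGroup M] [Module R M]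
    (h : TorVanishes R 0 M) : Module.Flat R M := by
  rw [Module.Flat.iff_lTensor_injective']
  intro I
  obtain ⟨Q, d, e, hQ, he, h0, hd, hT⟩ := h I
  have := hQ 0
  obtain ⟨a, ha⟩ := Module.projective_lifting_property e I.mkQ he
  obtain ⟨b, hb⟩ := Module.projective_lifting_property I.mkQ e I.mkQ_surjective
  have ha' : ∀ r, e (a r) = I.mkQ r := fun r => LinearMap.congr_fun ha r
  have hb' : ∀ r, I.mkQ (b r) = e r := fun r => LinearMap.congr_fun hb r
  have hmk : ∀ r : R, I.mkQ r = 0 ↔ r ∈ I := fun r =>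
    Ideal.Quotient.eq_zero_iff_mem
  let K := LinearMap.ker e
  let aI : I →ₗ[R] K := (a.comp (Submodule.subtype I)).codRestrict K (fun x => by
    change e (a x) = 0
    rw [ha', hmk]; exact x.2)
  let bI : K →ₗ[R] I := (b.comp K.subtype).codRestrict I (fun x => by
    rw [← hmk]
    change I.mkQ (b x) = 0
    rw [hb']; exact x.2)
  let c : R →ₗ[R] I := ((b.comp a) - LinearMap.id).codRestrict I (fun x => by
    rw [← hmk]; simp only [LinearMap.sub_apply, map_sub, LinearMap.comp_apply, hb', ha']
    simp)
  let dK : Q 1 →ₗ[R] K := (d 0).codRestrict K (fun x => h0.apply_apply_eq_zero x)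
  have hdK : Function.Surjective dK := fun x => by
    obtain ⟨y, hy⟩ := (h0 x.1).1 x.2
    exact ⟨y, Subtype.ext hy⟩
  have hK : Function.Injective (K.subtype.lTensor M) := by
    rw [injective_iff_map_eq_zero]
    intro x hx
    obtain ⟨y, rfl⟩ := LinearMap.lTensor_surjective M hdK x
    rw [← LinearMap.comp_apply, ← LinearMap.lTensor_comp] at hx
    obtain ⟨z, rfl⟩ := (hT 0 le_rfl y).1 hx
    rw [← LinearMap.comp_apply, ← LinearMap.lTensor_comp]
    have : dK.comp (d 1) = 0 := LinearMap.ext fun t =>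
      Subtype.ext ((hd 0).apply_apply_eq_zero t)
    rw [this, LinearMap.lTensor_zero]; rfl
  rw [injective_iff_map_eq_zero]
  intro x hx
  have h1 : aI.lTensor M x = 0 := by
    apply hK
    rw [map_zero, ← LinearMap.comp_apply, ← LinearMap.lTensor_comp]
    have : K.subtype.comp aI = a.comp (Submodule.subtype I) := rfl
    rw [this, LinearMap.lTensor_comp, LinearMap.comp_apply, hx, map_zero]
  have h2 : LinearMap.id = bI.comp aI - c.comp (Submodule.subtype I) :=
    LinearMap.ext fun t => Subtype.ext (by simp [aI, bI, c])
  have h3 := LinearMap.congr_fun (congrArg (LinearMap.lTensor M) h2) x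
  rw [LinearMap.lTensor_id, LinearMap.lTensor_sub, LinearMap.lTensor_comp,
    LinearMap.lTensor_comp] at h3
  simpa [h1, hx] using h3

theorem TorVanishes.flatDimLE {n : ℕ} : ∀ {M : Type u} [AddCommGroup M] [Module R M],
    TorVanishes R n M → FlatDimLE R n M := by
  induction n with
  | zero => intro M _ _ h; exact h.flat
  | succ n ih => intro M _ _ h F _ _ _ g hg; exact ih (h.ker g hg)

theorem torVanishes_of_isZero_tor {d : ℕ} {M : Type u} [AddCommGroup M] [Module R M]
    (h : ∀ n : ℕ, d ≤ n → ∀ (N : Type u) [AddCommGroup N] [Module R N],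
      IsZero (((Tor (ModuleCat.{u} R) n).obj (ModuleCat.of R M)).obj (ModuleCat.of R N))) :
    TorVanishes R d M := by
  intro I
  let P := projectiveResolution (ModuleCat.of R (R ⧸ I))
  refine ⟨fun i => P.complex.X i, fun i => (P.complex.d (i + 1) i).hom, (P.π.f 0).hom,
    fun i => ?_, ?_, ?_, fun i => ?_, fun m hm => ?_⟩
  · exact (IsProjective.iff_projective (P.complex.X i)).2 (P.projective i)
  · exact (ModuleCat.epi_iff_surjective _).1 inferInstance
  · exact (ShortComplex.ShortExact.moduleCat_exact_iff_function_exact _).1 P.exact₀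
  · exact (ShortComplex.ShortExact.moduleCat_exact_iff_function_exact _).1 (P.exact_succ i)
  · have h1 := h (m + 1) (by omega) (R ⧸ I)
    have h2 := (P.isoLeftDerivedObj (MonoidalCategory.tensoringLeft _ |>.obj
      (ModuleCat.of R M)) (m + 1)).symm
    have h3 := IsZero.of_iso h1 h2
    have h4 := (HomologicalComplex.exactAt_iff_isZero_homology _ _).2 h3
    rw [HomologicalComplex.exactAt_iff' _ (m + 2) (m + 1) m (by simp) (by simp)] at h4
    exact (ShortComplex.ShortExact.moduleCat_exact_iff_function_exact _).1 h4

theorem flat_of_exact_of_flat_middle {K E G : Type u} [AddCommGroup K] [Module R K]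
    [AddCommGroup E] [Module R E] [AddCommGroup G] [Module R G] [Module.Flat R E] [Module.Flat R G]
    (f : K →ₗ[R] E) (g : E →ₗ[R] G) (hf : Function.Injective f) (hg : Function.Surjective g)
    (h : Function.Exact f g) : Module.Flat R K := by
  rw [Module.Flat.iff_rTensor_injective']
  intro I
  have h1 := LinearMap.lTensor_injective_of_exact_of_flat g hg f hf h I
  have h2 : Function.Injective (LinearMap.rTensor E (Submodule.subtype I)) :=
    Module.Flat.rTensor_preserves_injective_linearMap _ (Submodule.injective_subtype _)
  have h3 := h2.comp h1
  rw [← LinearMap.coe_comp, LinearMap.rTensor_comp_lTensor, ← LinearMap.lTensor_comp_rTensor,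
    LinearMap.coe_comp] at h3
  exact h3.of_comp

theorem flat_of_exact_of_flat_ends {K E G : Type u} [AddCommGroup K] [Module R K]
    [AddCommGroup E] [Module R E] [AddCommGroup G] [Module R G] [Module.Flat R K] [Module.Flat R G]
    (f : K →ₗ[R] E) (g : E →ₗ[R] G) (hf : Function.Injective f) (hg : Function.Surjective g)
    (h : Function.Exact f g) : Module.Flat R E := by
  rw [Module.Flat.iff_rTensor_injective']
  intro I
  rw [injective_iff_map_eq_zero]
  intro x hx
  have hG : Function.Injective (LinearMap.rTensor G (Submodule.subtype I)) :=
    Module.Flat.rTensor_preserves_injective_linearMap _ (Submodule.injective_subtype _)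
  have hK : Function.Injective (LinearMap.rTensor K (Submodule.subtype I)) :=
    Module.Flat.rTensor_preserves_injective_linearMap _ (Submodule.injective_subtype _)
  have h0 : g.lTensor I x = 0 := by
    apply hG
    rw [map_zero, ← LinearMap.comp_apply, LinearMap.rTensor_comp_lTensor,
      ← LinearMap.lTensor_comp_rTensor, LinearMap.comp_apply, hx, map_zero]
  obtain ⟨k, rfl⟩ := (lTensor_exact I h hg x).1 h0
  have h1 := LinearMap.lTensor_injective_of_exact_of_flat g hg f hf h R
  rw [← LinearMap.comp_apply, LinearMap.rTensor_comp_lTensor, ← LinearMap.lTensor_comp_rTensor,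
    LinearMap.comp_apply] at hx
  rw [hK (h1 (hx.trans (map_zero _).symm) |>.trans (map_zero _).symm), map_zero]

theorem FlatDimLE.extendScalars {S : Type u} [CommRing S] [Algebra R S] [Module.Flat R S] {r : ℕ}
    (hS : ∀ (M : Type u) [AddCommGroup M] [Module R M] [Module S M] [IsScalarTower R S M],
      Module.Flat R M → FlatDimLE S r M) (n : ℕ) :
    ∀ (M : Type u) [AddCommGroup M] [Module R M] [Module S M] [IsScalarTower R S M],
      FlatDimLE R n M → FlatDimLE S (r + n) M := by
  induction n with
  | zero => intro M _ _ _ _ h; exact hS M h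
  | succ n ih =>
    intro M _ _ _ _ h F _ _ _ g hg
    let : Module R F := Module.compHom F (algebraMap R S)
    have : IsScalarTower R S F := IsScalarTower.of_compHom R S F
    have : Module.Flat R F := Module.Flat.trans R S F
    have h1 := h F (g.restrictScalars R) hg
    exact ih (LinearMap.ker g) h1

theorem flatDimLE_zero_of_bijective {S : Type u} [CommRing S] [Algebra R S]
    (hS : Function.Bijective (algebraMap R S))
    (M : Type u) [AddCommGroup M] [Module R M] [Module S M] [IsScalarTower R S M]
    (h : Module.Flat R M) : FlatDimLE S 0 M := by
  have : IsLocalization (⊥ : Submonoid R) S :=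
    IsLocalization.of_le_isUnit_of_bijective
      (by rintro _ ⟨x, hx, rfl⟩; rw [Submonoid.mem_bot.1 hx]; simp) hS
  exact (Module.flat_iff_of_isLocalization S (⊥ : Submonoid R) (M := M)).2 h

open Polynomial in
theorem flatDimLE_one_polynomial (M : Type u) [AddCommGroup M] [Module R M] [Module R[X] M]
    [IsScalarTower R R[X] M] (hM : Module.Flat R M) : FlatDimLE R[X] 1 M := by
  let mulX : M →ₗ[R] M := (LinearMap.lsmul R[X] M X).restrictScalars R
  have mulX_apply : ∀ m, mulX m = (X : R[X]) • m := fun m => rfl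
  let act : R[X] ⊗[R] M →ₗ[R[X]] M := LinearMap.liftBaseChange R[X] LinearMap.id
  have act_tmul : ∀ (q : R[X]) (m : M), act (q ⊗ₜ m) = q • m := fun q m => by simp [act]
  let θ : R[X] ⊗[R] M →ₗ[R[X]] R[X] ⊗[R] M :=
    LinearMap.lsmul R[X] _ X - LinearMap.baseChange R[X] mulX
  have θ_tmul : ∀ (q : R[X]) (m : M), θ (q ⊗ₜ m) = (X * q) ⊗ₜ m - q ⊗ₜ ((X : R[X]) • m) :=
    fun q m => by simp [θ, mulX_apply, smul_tmul']
  have act_surj : Function.Surjective act := fun m => ⟨1 ⊗ₜ m, by simp [act_tmul]⟩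
  let e := TensorProduct.equivFinsuppOfBasisLeft (N := M) (Polynomial.basisMonomials R)
  have e_tmul : ∀ (q : R[X]) (m : M) (i : ℕ), e (q ⊗ₜ m) i = q.coeff i • m := fun q m i => by
    simp [e]; rfl
  have e_θ : ∀ (t : R[X] ⊗[R] M) (i : ℕ), e (θ t) (i + 1) = e t i - (X : R[X]) • e t (i + 1) := by
    intro t i
    induction t with
    | zero => simp
    | add a b ha hb => simp only [map_add, Finsupp.add_apply, ha, hb, smul_add]; abel
    | tmul q m =>
      rw [θ_tmul, map_sub, Finsupp.sub_apply, e_tmul, e_tmul, e_tmul, e_tmul, coeff_X_mul,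
        ← mulX_apply, ← mulX_apply, map_smul]
  have θ_inj : Function.Injective θ := by
    rw [injective_iff_map_eq_zero]
    intro t ht
    have h1 : ∀ i, e t i = (X : R[X]) • e t (i + 1) := fun i => by
      have := e_θ t i
      rw [ht, map_zero, Finsupp.zero_apply] at this
      exact (sub_eq_zero.1 this.symm)
    have h2 : ∀ k i, e t i = (X : R[X]) ^ k • e t (i + k) := fun k => by
      induction k with
      | zero => simp
      | succ k ih => intro i; rw [ih i, h1 (i + k), smul_smul, pow_succ]; rfl
    apply e.injective
    rw [map_zero]
    ext i
    obtain ⟨N, hN⟩ := (e t).support.bddAbove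
    rw [h2 (N + 1) i, Finsupp.notMem_support_iff.1, smul_zero, Finsupp.zero_apply]
    intro hmem
    have : i + (N + 1) ≤ N := hN hmem
    omega
  have act_θ : ∀ t, act (θ t) = 0 := by
    intro t
    induction t with
    | zero => simp
    | add a b ha hb => simp only [map_add, ha, hb, add_zero]
    | tmul q m => rw [θ_tmul, map_sub, act_tmul, act_tmul, smul_smul, mul_comm, sub_self]
  have hrange : ∀ t, t - 1 ⊗ₜ act t ∈ LinearMap.range θ := by
    intro t
    induction t with
    | zero => simp
    | add a b ha hb =>
      have := add_mem ha hb
      rw [map_add, tmul_add]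
      convert this using 1
      abel
    | tmul q m =>
      induction q using Polynomial.induction_on' generalizing m with
      | add q q' hq hq' =>
        have := add_mem (hq m) (hq' m)
        rw [add_tmul, map_add, tmul_add]
        convert this using 1
        abel
      | monomial n a =>
        induction n generalizing m with
        | zero =>
          have h1 : (monomial 0 a : R[X]) = a • 1 := by
            rw [monomial_zero_left, smul_eq_C_mul, mul_one]
          rw [act_tmul, h1, smul_assoc, one_smul, smul_tmul, sub_self]
          exact zero_mem _
        | succ n ih =>
          have h1 : (monomial (n + 1) a : R[X]) = X * monomial n a := by
            rw [X_mul_monomial]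
          have h2 := add_mem (LinearMap.mem_range_self θ (monomial n a ⊗ₜ[R] m))
            (ih ((X : R[X]) • m))
          rw [θ_tmul, act_tmul, smul_smul, mul_comm _ X, ← h1, sub_add_sub_cancel] at h2
          rwa [act_tmul]
  intro F _ _ _ g hg
  let φ : F × (R[X] ⊗[R] M) →ₗ[R[X]] M := g.coprod (-act)
  have hφ : ∀ z : LinearMap.ker φ, g z.1.1 = act z.1.2 := fun z => by
    have h := z.2
    rw [LinearMap.mem_ker, LinearMap.coprod_apply, LinearMap.neg_apply, ← sub_eq_add_neg,
      sub_eq_zero] at h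
    exact h
  have hmem : ∀ x t, g x = act t → (x, t) ∈ LinearMap.ker φ := fun x t h => by
    rw [LinearMap.mem_ker, LinearMap.coprod_apply, LinearMap.neg_apply, ← sub_eq_add_neg,
      sub_eq_zero]
    exact h
  have hZ : Module.Flat R[X] (LinearMap.ker φ) := by
    refine flat_of_exact_of_flat_ends (K := R[X] ⊗[R] M) (E := LinearMap.ker φ) (G := F)
      (((LinearMap.inr R[X] F _).comp θ).codRestrict (LinearMap.ker φ) (fun t => ?_))
      ((LinearMap.fst R[X] F (R[X] ⊗[R] M)).comp (LinearMap.ker φ).subtype) ?_ ?_ ?_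
    · exact hmem 0 (θ t) (by rw [map_zero, act_θ])
    · intro a b h
      exact θ_inj (congrArg (fun z => z.1.2) h)
    · intro x
      obtain ⟨t, ht⟩ := act_surj (g x)
      exact ⟨⟨(x, t), hmem x t ht.symm⟩, rfl⟩
    · intro z
      constructor
      · intro hz
        have hz : z.1.1 = 0 := hz
        have h1 := hφ z
        rw [hz, map_zero] at h1
        have h2 := hrange z.1.2
        rw [← h1, tmul_zero, sub_zero] at h2
        obtain ⟨t, ht⟩ := h2
        exact ⟨t, Subtype.ext (Prod.ext hz.symm ht)⟩
      · rintro ⟨t, rfl⟩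
        rfl
  refine flat_of_exact_of_flat_middle (E := LinearMap.ker φ) (G := R[X] ⊗[R] M)
      (((LinearMap.inl R[X] F _).comp (LinearMap.ker g).subtype).codRestrict
        (LinearMap.ker φ) (fun t => ?_))
      ((LinearMap.snd R[X] F (R[X] ⊗[R] M)).comp (LinearMap.ker φ).subtype) ?_ ?_ ?_
  · exact hmem _ 0 (by rw [map_zero]; exact t.2)
  · intro a b h
    exact Subtype.ext (congrArg (fun z => z.1.1) h)
  · intro t
    obtain ⟨x, hx⟩ := hg (act t)
    exact ⟨⟨(x, t), hmem x t hx⟩, rfl⟩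
  · intro z
    constructor
    · intro hz
      have hz : z.1.2 = 0 := hz
      refine ⟨⟨z.1.1, ?_⟩, Subtype.ext (Prod.ext rfl hz.symm)⟩
      rw [LinearMap.mem_ker, hφ z, hz, map_zero]
    · rintro ⟨t, rfl⟩
      rfl

/-- Modules of finite flat dimension over `R` which carry a compatible `S`-module structure have
finite flat dimension over `S`. -/
def FiniteFlatDimLifts (R S : Type u) [CommRing R] [CommRing S] [Algebra R S] : Prop :=
  ∀ (M : Type u) [AddCommGroup M] [Module R M] [Module S M] [IsScalarTower R S M] (n : ℕ),
    FlatDimLE R n M → ∃ m, FlatDimLE S m M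

theorem FiniteFlatDimLifts.trans {S T : Type u} [CommRing S] [CommRing T] [Algebra R S]
    [Algebra R T] [Algebra S T] [IsScalarTower R S T] (h₁ : FiniteFlatDimLifts R S)
    (h₂ : FiniteFlatDimLifts S T) : FiniteFlatDimLifts R T := by
  intro M _ _ _ _ n h
  let : Module S M := Module.compHom M (algebraMap S T)
  have : IsScalarTower S T M := IsScalarTower.of_compHom S T M
  have : IsScalarTower R S M := IsScalarTower.of_algebraMap_smul fun r m => by
    rw [← algebraMap_smul T (algebraMap R S r) m, ← IsScalarTower.algebraMap_apply,
      algebraMap_smul]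
  obtain ⟨m, hm⟩ := h₁ M n h
  exact h₂ M m hm

theorem finiteFlatDimLifts_of_bijective {S : Type u} [CommRing S] [Algebra R S]
    (hS : Function.Bijective (algebraMap R S)) : FiniteFlatDimLifts R S := by
  have : Module.Flat R S := Module.Flat.of_linearEquiv
    (LinearEquiv.ofBijective (Algebra.linearMap R S) hS).symm
  intro M _ _ _ _ n h
  exact ⟨_, FlatDimLE.extendScalars (flatDimLE_zero_of_bijective hS) n M h⟩

theorem FiniteFlatDimLifts.of_algEquiv {S T : Type u} [CommRing S] [CommRing T] [Algebra R S]
    [Algebra R T] (h : FiniteFlatDimLifts R S) (e : S ≃ₐ[R] T) : FiniteFlatDimLifts R T := by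
  let : Algebra S T := e.toAlgHom.toRingHom.toAlgebra
  have : IsScalarTower R S T := IsScalarTower.of_algebraMap_eq fun r => (e.commutes r).symm
  exact h.trans (finiteFlatDimLifts_of_bijective e.bijective)

theorem finiteFlatDimLifts_polynomial (R : Type u) [CommRing R] :
    FiniteFlatDimLifts R (Polynomial R) :=
  fun M _ _ _ _ n h => ⟨_, FlatDimLE.extendScalars flatDimLE_one_polynomial n M h⟩

theorem finiteFlatDimLifts_mvPolynomial_fin (R : Type u) [CommRing R] (n : ℕ) :
    FiniteFlatDimLifts R (MvPolynomial (Fin n) R) := by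
  induction n with
  | zero => exact finiteFlatDimLifts_of_bijective (MvPolynomial.isEmptyRingEquiv R _).symm.bijective
  | succ n ih =>
    exact (ih.trans (finiteFlatDimLifts_polynomial _)).of_algEquiv
      (MvPolynomial.finSuccEquiv R n).symm

theorem finiteFlatDimLifts_mvPolynomial (R : Type u) [CommRing R] (ι : Type u) [Finite ι] :
    FiniteFlatDimLifts R (MvPolynomial ι R) :=
  have ⟨n, ⟨e⟩⟩ := Finite.exists_equiv_fin ι
  (finiteFlatDimLifts_mvPolynomial_fin R n).of_algEquiv (MvPolynomial.renameEquiv R e.symm)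

end FlatDimension

section Koszul

variable {R : Type u} [CommRing R] {ι : Type} [Fintype ι]

/-- The operator `x ↦ y ⌋ x + v ∧ x` on the exterior algebra of a finite free module. -/
noncomputable def twistedKoszul (v y : ι → R) :
    ExteriorAlgebra R (ι → R) →ₗ[R] ExteriorAlgebra R (ι → R) :=
  CliffordAlgebra.contractLeft (Fintype.linearCombination R y) +
    LinearMap.mulLeft R (ExteriorAlgebra.ι R v)

theorem twistedKoszul_twistedKoszul (v y : ι → R) (h : ∑ j, v j * y j = 0)
    (x : ExteriorAlgebra R (ι → R)) : twistedKoszul v y (twistedKoszul v y x) = 0 := by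
  have h0 : Fintype.linearCombination R y v = 0 := by
    simpa [Fintype.linearCombination_apply] using h
  have h1 : ∀ x : ExteriorAlgebra R (ι → R),
      CliffordAlgebra.contractLeft (Fintype.linearCombination R y) (ExteriorAlgebra.ι R v * x) =
      - (ExteriorAlgebra.ι R v *
        CliffordAlgebra.contractLeft (Fintype.linearCombination R y) x) := fun x => by
    erw [CliffordAlgebra.contractLeft_ι_mul]
    rw [h0, zero_smul, zero_sub]
  simp only [twistedKoszul, LinearMap.add_apply, LinearMap.mulLeft_apply, map_add, h1,
    CliffordAlgebra.contractLeft_contractLeft, ← mul_assoc, ExteriorAlgebra.ι_sq_zero]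
  simp

variable [DecidableEq ι]

/-- The standard degree one generators of the exterior algebra of `ι → R`. -/
noncomputable def extGen (R : Type u) [CommRing R] {ι : Type} [DecidableEq ι] (j : ι) :
    ExteriorAlgebra R (ι → R) :=
  ExteriorAlgebra.ι R (Pi.single j 1)

theorem exteriorAlgebra_ι_eq_sum (v : ι → R) :
    ExteriorAlgebra.ι R v = ∑ j, v j • extGen R j := by
  conv_lhs => rw [pi_eq_sum_univ' v]
  simp only [map_sum, map_smul, extGen]

theorem twistedKoszul_one (v y : ι → R) : twistedKoszul v y 1 = ∑ j, v j • extGen R j := by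
  rw [← exteriorAlgebra_ι_eq_sum]
  simp [twistedKoszul]

theorem twistedKoszul_extGen (v y : ι → R) (j : ι) :
    twistedKoszul v y (extGen R j) = y j • 1 + ∑ k, v k • (extGen R k * extGen R j) := by
  simp only [twistedKoszul, extGen, LinearMap.add_apply, LinearMap.mulLeft_apply]
  congr 1
  · erw [CliffordAlgebra.contractLeft_ι]
    rw [Algebra.algebraMap_eq_smul_one]
    simp [Fintype.linearCombination_apply, Pi.single_apply]
  · rw [exteriorAlgebra_ι_eq_sum, Finset.sum_mul]
    simp [extGen]

end Koszul

theorem extGen_mul_self {R : Type u} [CommRing R] {ι : Type} [DecidableEq ι] (j : ι) :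
    extGen R j * extGen R j = 0 :=
  ExteriorAlgebra.ι_sq_zero _

theorem extGen_mul_add_swap {R : Type u} [CommRing R] {ι : Type} [DecidableEq ι]
    (j k : ι) : extGen R j * extGen R k + extGen R k * extGen R j = 0 :=
  ExteriorAlgebra.ι_add_mul_swap _ _

section KeyLemma

variable {R : Type u} [CommRing R]

theorem mem_ideal_smul_top_iff_tmul_eq_zero {M : Type u} [AddCommGroup M] [Module R M]
    (I : Ideal R) (x : M) :
    x ∈ I • (⊤ : Submodule R M) ↔ (1 : R ⧸ I) ⊗ₜ[R] x = 0 := by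
  rw [← (TensorProduct.quotTensorEquivQuotSMul M I).map_eq_zero_iff,
    TensorProduct.quotTensorEquivQuotSMul_mk_one_tmul, Submodule.Quotient.mk_eq_zero]

/-- The multiplication map `I ⊗ M → M`. -/
noncomputable def idealTensorMul (I : Ideal R) (M : Type u) [AddCommGroup M] [Module R M] :
    I ⊗[R] M →ₗ[R] M :=
  TensorProduct.lift ((LinearMap.lsmul R M).comp (Submodule.subtype I))

theorem exists_idealTensorMul_eq {M : Type u} [AddCommGroup M] [Module R M]
    {I : Ideal R} {x : M} (hx : x ∈ I • (⊤ : Submodule R M)) :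
    ∃ w, idealTensorMul I M w = x := by
  refine Submodule.smul_induction_on hx (fun r hr m _ => ?_) ?_
  · exact ⟨⟨r, hr⟩ ⊗ₜ m, by simp [idealTensorMul]⟩
  · rintro _ _ ⟨a, rfl⟩ ⟨b, rfl⟩
    exact ⟨a + b, map_add _ _ _⟩

theorem idealTensorMul_injective (I : Ideal R) (F : Type u) [AddCommGroup F] [Module R F]
    [Module.Flat R F] : Function.Injective (idealTensorMul I F) := by
  have h1 : Function.Injective ((Submodule.subtype I).rTensor F) :=
    Module.Flat.rTensor_preserves_injective_linearMap _ (Submodule.injective_subtype _)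
  have h2 : idealTensorMul I F =
      (TensorProduct.lid R F).toLinearMap.comp ((Submodule.subtype I).rTensor F) := by
    ext; simp [idealTensorMul]
  rw [h2]
  exact (TensorProduct.lid R F).injective.comp h1

theorem idealTensorMul_lTensor (I : Ideal R) {M N : Type u} [AddCommGroup M] [Module R M]
    [AddCommGroup N] [Module R N] (f : M →ₗ[R] N) (w : I ⊗[R] M) :
    idealTensorMul I N (f.lTensor I w) = f (idealTensorMul I M w) := by
  induction w with
  | zero => simp
  | add a b ha hb => simp only [map_add, ha, hb]
  | tmul r m => simp [idealTensorMul]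

theorem smul_mem_of_flatDimLE {N : Type u} [AddCommGroup N] [Module R N] (𝔪 : Ideal R)
    (S : Submonoid R) (ν : N →ₗ[R] R) (hν : LinearMap.range ν = 𝔪) (ω : N) (hω : ν ω = 0)
    (hωs : ∀ r : R, r • ω = 0 ↔ r ∈ 𝔪)
    (hker : ∀ x, ν x = 0 → ∃ σ ∈ S, ∃ r : R, σ • x = r • ω)
    (hsymm : ∀ x x', ν x • x' = ν x' • x)
    {k : ℕ} (n : Fin k → N) (y : Fin k → R) (hny : ∑ j, y j • n j = ω)
    {d : ℕ} {M : Type u} [AddCommGroup M] [Module R M] (hM : FlatDimLE R d M)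
    (s : M) (hs : ∀ j, y j • s = 0) : ∃ σ ∈ S, σ • s ∈ 𝔪 • (⊤ : Submodule R M) := by
  have hmem : ∀ x, ν x ∈ 𝔪 := fun x => hν ▸ LinearMap.mem_range_self ν x
  let ν' : N →ₗ[R] 𝔪 := ν.codRestrict 𝔪 hmem
  have hν' : Function.Surjective ν' := fun r => by
    obtain ⟨x, hx⟩ := (hν.symm ▸ r.2 : r.1 ∈ LinearMap.range ν)
    exact ⟨x, Subtype.ext hx⟩
  have hker' : LinearMap.ker ν' = LinearMap.ker ν := LinearMap.ker_codRestrict _ _ _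
  let D := twistedKoszul (fun j => ν (n j)) y
  let K := ExteriorAlgebra R (Fin k → R)
  have hD2 : ∀ x : K, D (D x) = 0 := twistedKoszul_twistedKoszul _ _ (by
    rw [← hω, ← hny, map_sum]
    simp [mul_comm])
  have hK : Module.Projective R K :=
    Module.Projective.of_basis (Module.Basis.ExteriorAlgebra (Pi.basisFun R (Fin k)))
  let E : ∀ {X : Type u} [AddCommGroup X] [Module R X], (K →ₗ[R] X) → N ⊗[R] X :=
    fun h => ∑ j, n j ⊗ₜ h (extGen R j)
  have hE : ∀ {X Y : Type u} [AddCommGroup X] [Module R X] [AddCommGroup Y] [Module R Y]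
      (f : X →ₗ[R] Y) (h : K →ₗ[R] X), f.lTensor N (E h) = E (f.comp h) := by
    intro X Y _ _ _ _ f h
    simp [E]
  have hED : ∀ {X : Type u} [AddCommGroup X] [Module R X] (h : K →ₗ[R] X),
      E (h.comp D) = ω ⊗ₜ h 1 := by
    intro X _ _ h
    have h1 : ∑ j, n j ⊗ₜ[R] h (∑ k, ν (n k) • (extGen R k * extGen R j)) = 0 := by
      simp only [map_sum, map_smul, tmul_sum, tmul_smul]
      rw [← Finset.sum_product']
      refine Finset.sum_involution (fun a _ => (a.2, a.1)) ?_ ?_ (by simp) (by simp)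
      · rintro ⟨j, k⟩ _
        simp only
        rw [smul_tmul', smul_tmul', hsymm (n k) (n j), ← tmul_add, ← map_add,
          extGen_mul_add_swap, map_zero, tmul_zero]
      · rintro ⟨j, k⟩ _ hne heq
        simp only [Prod.mk.injEq] at heq
        obtain ⟨rfl, -⟩ := heq
        simp [extGen_mul_self] at hne
    calc E (h.comp D) = ∑ j, n j ⊗ₜ h (D (extGen R j)) := rfl
      _ = ∑ j, (y j • n j) ⊗ₜ[R] h 1 := by
        simp only [D, twistedKoszul_extGen, map_add, tmul_add, Finset.sum_add_distrib, h1,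
          add_zero, map_smul, tmul_smul, smul_tmul']
      _ = ω ⊗ₜ h 1 := by rw [← hny, sum_tmul]
  have hE1 : ∀ {X : Type u} [AddCommGroup X] [Module R X] (h : K →ₗ[R] X),
      idealTensorMul 𝔪 X (ν'.rTensor X (E h)) = h (D 1) := by
    intro X _ _ h
    simp [E, D, twistedKoszul_one, idealTensorMul, ν']
  have hkert : ∀ {X : Type u} [AddCommGroup X] [Module R X] (t : LinearMap.ker ν ⊗[R] X),
      ∃ σ ∈ S, ∃ x : X, σ • ((LinearMap.ker ν).subtype.rTensor X t) = ω ⊗ₜ x := by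
    intro X _ _ t
    induction t with
    | zero => exact ⟨1, S.one_mem, 0, by simp⟩
    | tmul a m =>
      obtain ⟨σ, hσ, r, hr⟩ := hker a.1 a.2
      refine ⟨σ, hσ, r • m, ?_⟩
      rw [LinearMap.rTensor_tmul, smul_tmul', Submodule.subtype_apply, hr, smul_tmul]
    | add a b ha hb =>
      obtain ⟨σ, hσ, x, hx⟩ := ha
      obtain ⟨τ, hτ, x', hx'⟩ := hb
      refine ⟨σ * τ, S.mul_mem hσ hτ, τ • x + σ • x', ?_⟩
      rw [map_add, smul_add, tmul_add, tmul_smul, tmul_smul, ← hx, ← hx', smul_smul, smul_smul,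
        mul_comm τ σ]
  let ρ : R ⧸ 𝔪 →ₗ[R] N := Submodule.liftQ 𝔪 (LinearMap.toSpanSingleton R N ω)
    fun r hr => (hωs r).2 hr
  have hρ : Function.Injective ρ := by
    refine LinearMap.ker_eq_bot.1 (Submodule.ker_liftQ_eq_bot _ _ _ ?_)
    exact fun r hr => (hωs r).1 hr
  have hωF : ∀ {F : Type u} [AddCommGroup F] [Module R F] [Module.Flat R F] (x : F),
      ω ⊗ₜ[R] x = 0 → x ∈ 𝔪 • (⊤ : Submodule R F) := by
    intro F _ _ _ x hx
    rw [mem_ideal_smul_top_iff_tmul_eq_zero]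
    apply Module.Flat.rTensor_preserves_injective_linearMap (M := F) ρ hρ
    rw [map_zero, LinearMap.rTensor_tmul, ← hx]
    congr 1
    exact one_smul R ω
  let P : ∀ (X : Type u) [AddCommGroup X] [Module R X], Prop := fun X _ _ =>
    ∀ h : K →ₗ[R] X, h.comp D = 0 →
      (∃ σ ∈ S, σ • h 1 ∈ 𝔪 • (⊤ : Submodule R X)) ∧ (∃ σ ∈ S, σ • ν'.rTensor X (E h) = 0)
  have step : ∀ {F X : Type u} [AddCommGroup F] [Module R F] [AddCommGroup X] [Module R X]
      [Module.Flat R F] (g : F →ₗ[R] X), Function.Surjective g → P (LinearMap.ker g) → P X := by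
    intro F X _ _ _ _ _ g hg hP h hh
    obtain ⟨l, hl⟩ := Module.projective_lifting_property g h hg
    have hl' : ∀ x, g (l x) = h x := fun x => LinearMap.congr_fun hl x
    let i := (LinearMap.ker g).subtype
    let h' : K →ₗ[R] LinearMap.ker g := (l.comp D).codRestrict _ fun x => by
      rw [LinearMap.mem_ker, LinearMap.comp_apply, hl']
      exact LinearMap.congr_fun hh x
    have hh' : i.comp h' = l.comp D := rfl
    obtain ⟨⟨σ, hσ, hev⟩, ⟨τ, hτ, hodd⟩⟩ := hP h' (LinearMap.ext fun x => Subtype.ext (by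
      change l (D (D x)) = 0
      rw [hD2, map_zero]))
    constructor
    · rw [← map_smul] at hodd
      have hex : Function.Exact ((LinearMap.ker ν).subtype.rTensor (LinearMap.ker g))
          (ν'.rTensor (LinearMap.ker g)) := by
        rw [← hker']
        exact rTensor_exact _ (LinearMap.exact_subtype_ker_map ν') hν'
      obtain ⟨t, ht⟩ := (hex _).1 hodd
      obtain ⟨τ', hτ', x, hx⟩ := hkert t
      refine ⟨τ' * τ, S.mul_mem hτ' hτ, ?_⟩
      rw [ht] at hx
      have h1 := congrArg (i.lTensor N) hx
      rw [map_smul, map_smul, hE, hh', hED, LinearMap.lTensor_tmul, ← tmul_smul, ← tmul_smul,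
        ← sub_eq_zero, ← tmul_sub] at h1
      have h2 := Submodule.mem_map_of_mem (f := g) (hωF _ h1)
      rw [Submodule.map_smul'', map_sub, map_smul, map_smul, hl', show g (i x) = 0 from x.2,
        sub_zero, smul_smul] at h2
      exact Submodule.smul_mono le_rfl le_top h2
    · refine ⟨σ, hσ, ?_⟩
      obtain ⟨w, hw⟩ := exists_idealTensorMul_eq hev
      have h1 : i.lTensor 𝔪 w = σ • ν'.rTensor F (E l) := by
        apply idealTensorMul_injective 𝔪 F
        rw [idealTensorMul_lTensor, hw, map_smul, map_smul, hE1]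
        rfl
      have h2 := congrArg (g.lTensor 𝔪) h1
      rw [← LinearMap.comp_apply, ← LinearMap.lTensor_comp,
        show g.comp i = 0 from LinearMap.ext fun x => x.2, LinearMap.lTensor_zero,
        LinearMap.zero_apply, map_smul, ← LinearMap.comp_apply (g.lTensor 𝔪),
        LinearMap.lTensor_comp_rTensor, ← LinearMap.rTensor_comp_lTensor,
        LinearMap.comp_apply, hE, hl] at h2
      exact h2.symm
  have main : ∀ (d : ℕ) (X : Type u) [AddCommGroup X] [Module R X], FlatDimLE R d X → P X := by
    intro d
    induction d with
    | zero =>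
      intro X _ _ hX
      have : Module.Flat R X := hX
      refine step LinearMap.id Function.surjective_id ?_
      have : Subsingleton (LinearMap.ker (LinearMap.id : X →ₗ[R] X)) := by
        rw [LinearMap.ker_id]; infer_instance
      intro h _
      refine ⟨⟨1, S.one_mem, ?_⟩, ⟨1, S.one_mem, ?_⟩⟩
      · rw [Subsingleton.elim ((1 : R) • h 1) 0]; exact zero_mem _
      · have hE0 : E h = 0 := Finset.sum_eq_zero fun j _ => by
          rw [Subsingleton.elim (h _) 0, tmul_zero]
        rw [hE0, map_zero, smul_zero]
    | succ d ih =>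
      intro X _ _ hX
      have h1 := hX _ _ (Finsupp.linearCombination_id_surjective R X)
      exact step (F := X →₀ R) _ (Finsupp.linearCombination_id_surjective R X) (ih _ h1)
  let h₀ : K →ₗ[R] M :=
    (LinearMap.toSpanSingleton R M s).comp
      (ExteriorAlgebra.algebraMapInv (R := R) (M := Fin k → R)).toLinearMap
  have h₀1 : h₀ 1 = s := by simp [h₀, K]
  have hys : ∀ m : Fin k → R, Fintype.linearCombination R y m • s = 0 := fun m => by
    simp [Fintype.linearCombination_apply, Finset.sum_smul, mul_smul, hs]
  have hι : ∀ (m : Fin k → R) (x : K), h₀ (ExteriorAlgebra.ι R m * x) = 0 := fun m x => by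
    change (ExteriorAlgebra.algebraMapInv (R := R) (M := Fin k → R)
      (ExteriorAlgebra.ι R m * x)) • s = 0
    rw [map_mul, ExteriorAlgebra.algebraMapInv, ExteriorAlgebra.lift_ι_apply]
    simp
  have hcontr : ∀ x : K,
      h₀ (CliffordAlgebra.contractLeft (Fintype.linearCombination R y) x) = 0 := by
    intro x
    induction x using CliffordAlgebra.left_induction with
    | algebraMap r => rw [CliffordAlgebra.contractLeft_algebraMap, map_zero]
    | add a b ha hb => rw [map_add, map_add, ha, hb, add_zero]
    | ι_mul x m hx =>
      rw [CliffordAlgebra.contractLeft_ι_mul, map_sub, map_smul]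
      erw [hι, sub_zero]
      have h₀x : h₀ x = ExteriorAlgebra.algebraMapInv (R := R) (M := Fin k → R) x • s := rfl
      rw [h₀x, smul_comm, hys, smul_zero]
  have h₀D : h₀.comp D = 0 := by
    refine LinearMap.ext fun x => ?_
    change h₀ (CliffordAlgebra.contractLeft _ x + ExteriorAlgebra.ι R _ * x) = 0
    rw [map_add, hcontr, hι, add_zero]
  have := (main d M hM h₀ h₀D).1
  rwa [h₀1] at this

end KeyLemma

section Taylor

open MvPolynomial

variable {V K T : Type*} [Fintype V] [CommRing K] [CommRing T]

theorem taylor_mem_sq (α β : MvPolynomial V K →+* T) (hC : ∀ c, α (C c) = β (C c)) (J : Ideal T)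
    (hJ : ∀ v, α (X v) - β (X v) ∈ J) (g : MvPolynomial V K) :
    α g - β g ∈ J ∧
      α g - β g - ∑ v, β (pderiv v g) * (α (X v) - β (X v)) ∈ J ^ 2 := by
  classical
  induction g using MvPolynomial.induction_on with
  | C c => simp [hC]
  | add f g hf hg =>
    refine ⟨?_, ?_⟩
    · convert J.add_mem hf.1 hg.1 using 1; simp only [map_add]; ring
    · convert (J ^ 2).add_mem hf.2 hg.2 using 1
      simp only [map_add, add_mul, Finset.sum_add_distrib]; ring
  | mul_X g w hg =>
    refine ⟨?_, ?_⟩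
    · rw [show α (g * X w) - β (g * X w) = (α g - β g) * α (X w) + β g * (α (X w) - β (X w)) by
        simp only [map_mul]; ring]
      exact J.add_mem (J.mul_mem_right _ hg.1) (J.mul_mem_left _ (hJ w))
    · have hs : ∑ v, β (pderiv v (g * X w)) * (α (X v) - β (X v)) =
          β g * (α (X w) - β (X w)) +
            β (X w) * ∑ v, β (pderiv v g) * (α (X v) - β (X v)) := by
        rw [Finset.mul_sum]
        simp only [Derivation.leibniz, pderiv_X, smul_eq_mul, map_add, map_mul, add_mul,
          Finset.sum_add_distrib]
        congr 1
        · rw [Finset.sum_eq_single w] <;> simp +contextual [eq_comm]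
        · simp only [mul_assoc]
      rw [hs, show α (g * X w) - β (g * X w) - (β g * (α (X w) - β (X w)) +
          β (X w) * ∑ v, β (pderiv v g) * (α (X v) - β (X v))) =
          β (X w) * (α g - β g - ∑ v, β (pderiv v g) * (α (X v) - β (X v))) +
            (α g - β g) * (α (X w) - β (X w)) by simp only [map_mul]; ring]
      refine (J ^ 2).add_mem ((J ^ 2).mul_mem_left _ hg.2) ?_
      rw [pow_two]
      exact Ideal.mul_mem_mul hg.1 (hJ w)

theorem mem_mul_of_pderiv_mem (α β : MvPolynomial V K →+* T) (hC : ∀ c, α (C c) = β (C c))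
    (𝔫 J : Ideal T) (hJn : J ≤ 𝔫) (hJ : ∀ v, α (X v) - β (X v) ∈ J) (g : MvPolynomial V K)
    (hg : β g ∈ J ^ 2) (hd : ∀ v, β (pderiv v g) ∈ 𝔫) : α g ∈ 𝔫 * J := by
  have h2 : J ^ 2 ≤ 𝔫 * J := by rw [pow_two]; exact Ideal.mul_mono_left hJn
  have h := h2 (taylor_mem_sq α β hC J hJ g).2
  have h3 : ∑ v, β (pderiv v g) * (α (X v) - β (X v)) ∈ 𝔫 * J :=
    Ideal.sum_mem _ fun v _ => Ideal.mul_mem_mul (hd v) (hJ v)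
  convert (𝔫 * J).add_mem ((𝔫 * J).add_mem h h3) (h2 hg) using 1
  ring

end Taylor

section SquareZeroExtension

theorem exists_fin_sum_mul_eq {T : Type*} [CommRing T] {I J : Ideal T} {x : T}
    (hx : x ∈ I * J) :
    ∃ (k : ℕ) (n y : Fin k → T), (∀ j, n j ∈ I) ∧ (∀ j, y j ∈ J) ∧ ∑ j, y j * n j = x := by
  refine Submodule.mul_induction_on hx (fun a ha b hb => ?_) ?_
  · exact ⟨1, fun _ => a, fun _ => b, fun _ => ha, fun _ => hb, by simp [mul_comm]⟩
  · rintro _ _ ⟨k, n, y, hn, hy, rfl⟩ ⟨l, n', y', hn', hy', rfl⟩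
    refine ⟨k + l, Fin.append n n', Fin.append y y', ?_, ?_, by simp [Fin.sum_univ_add]⟩
    · intro j; refine Fin.addCases (fun i => ?_) (fun i => ?_) j <;> simp [hn, hn']
    · intro j; refine Fin.addCases (fun i => ?_) (fun i => ?_) j <;> simp [hy, hy']

variable {T k : Type u} [CommRing T] [Field k]

/-- The elements of `I` on which the additive map `Λ` vanishes, as a submodule of the
kernel of `ε`. -/
def kernelSubmodule (I : Ideal T) (ε : T →+* k) (Λ : T →+ k)
    (hΛ : ∀ t, ∀ x ∈ I, Λ (t * x) = ε t * Λ x) : Submodule T (RingHom.ker ε) where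
  carrier := {x | (x : T) ∈ I ∧ Λ x = 0}
  add_mem' ha hb := ⟨I.add_mem ha.1 hb.1, by simp [ha.2, hb.2]⟩
  zero_mem' := ⟨I.zero_mem, by simp⟩
  smul_mem' t x hx := ⟨I.mul_mem_left t hx.1, by
    have := hΛ t x hx.1
    rw [hx.2, mul_zero] at this
    simpa using this⟩

theorem exists_smul_mem_of_extension (I J : Ideal T) (ε : T →+* k) (hI : I ≤ RingHom.ker ε)
    (Λ : T →+ k)
    (hΛ : ∀ t, ∀ x ∈ I, Λ (t * x) = ε t * Λ x)
    (hΛ' : ∀ x ∈ I, ∃ b c, ε c ≠ 0 ∧ ε c * Λ x = ε b)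
    (ω : T) (hωI : ω ∈ I) (hω1 : Λ ω = 1) (hω : ω ∈ RingHom.ker ε * J)
    {M : Type u} [AddCommGroup M] [Module (T ⧸ I) M] {d : ℕ} (hM : FlatDimLE (T ⧸ I) d M)
    (s : M) (hs : ∀ y ∈ J, Ideal.Quotient.mk I y • s = 0) :
    ∃ σ : T, ε σ ≠ 0 ∧ Ideal.Quotient.mk I σ • s ∈
      (RingHom.ker ε).map (Ideal.Quotient.mk I) • (⊤ : Submodule (T ⧸ I) M) := by
  obtain ⟨k', n, y, hn, hy, hny⟩ := exists_fin_sum_mul_eq hω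
  let K := kernelSubmodule I ε Λ hΛ
  have htors : Module.IsTorsionBySet T (RingHom.ker ε ⧸ K) I := by
    rintro x ⟨a, ha⟩
    obtain ⟨x, rfl⟩ := K.mkQ_surjective x
    change a • K.mkQ x = 0
    rw [← map_smul, Submodule.mkQ_apply, Submodule.Quotient.mk_eq_zero]
    refine ⟨I.mul_mem_right _ ha, ?_⟩
    have := hΛ x a ha
    rw [show ε x = 0 from x.2, zero_mul] at this
    simpa [mul_comm] using this
  let _ := htors.module
  have : IsScalarTower T (T ⧸ I) (RingHom.ker ε ⧸ K) := htors.isScalarTower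
  have hmk : ∀ (t : T) (x : RingHom.ker ε ⧸ K), Ideal.Quotient.mk I t • x = t • x :=
    fun t x => (algebraMap_smul (T ⧸ I) t x)
  let ν₀ : (RingHom.ker ε ⧸ K) →ₗ[T] T ⧸ I :=
    K.liftQ ((Ideal.Quotient.mkₐ T I).toLinearMap ∘ₗ (RingHom.ker ε).subtype) (by
      rintro x hx
      simpa [Ideal.Quotient.eq_zero_iff_mem] using hx.1)
  let ν : (RingHom.ker ε ⧸ K) →ₗ[T ⧸ I] T ⧸ I :=
    { toFun := ν₀
      map_add' := ν₀.map_add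
      map_smul' := fun r x => by
        obtain ⟨r, rfl⟩ := Ideal.Quotient.mk_surjective r
        rw [hmk, map_smul]
        simp [Algebra.smul_def] }
  have hν : ∀ x : RingHom.ker ε, ν (K.mkQ x) = Ideal.Quotient.mk I x := fun x => rfl
  have hωmem : ω ∈ RingHom.ker ε := hI hωI
  suffices h : ∃ σ ∈ (nonZeroDivisors k).comap ε |>.map (Ideal.Quotient.mk I),
      σ • s ∈ (RingHom.ker ε).map (Ideal.Quotient.mk I) • (⊤ : Submodule (T ⧸ I) M) by
    obtain ⟨_, ⟨σ, hσ, rfl⟩, h⟩ := h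
    exact ⟨σ, nonZeroDivisors.ne_zero hσ, h⟩
  refine smul_mem_of_flatDimLE (R := T ⧸ I) (N := RingHom.ker ε ⧸ K) _ _
    ν ?_ (K.mkQ ⟨ω, hωmem⟩) ?_ ?_ ?_ ?_ (fun j => K.mkQ ⟨n j, hn j⟩)
    (fun j => Ideal.Quotient.mk I (y j)) ?_ hM s (fun j => hs _ (hy j))
  · ext x
    rw [Ideal.mem_map_iff_of_surjective _ Ideal.Quotient.mk_surjective]
    constructor
    · rintro ⟨x, rfl⟩
      obtain ⟨x, rfl⟩ := K.mkQ_surjective x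
      exact ⟨x, x.2, rfl⟩
    · rintro ⟨x, hx, rfl⟩
      exact ⟨K.mkQ ⟨x, hx⟩, rfl⟩
  · rw [hν, Ideal.Quotient.eq_zero_iff_mem]; exact hωI
  · intro r
    obtain ⟨r, rfl⟩ := Ideal.Quotient.mk_surjective r
    rw [hmk, ← map_smul, Submodule.mkQ_apply, Submodule.Quotient.mk_eq_zero,
      Ideal.mem_map_iff_of_surjective _ Ideal.Quotient.mk_surjective]
    have h1 : Λ (r * ω) = ε r := by rw [hΛ r ω hωI, hω1, mul_one]
    constructor
    · rintro ⟨-, h⟩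
      exact ⟨r, by rw [RingHom.mem_ker, ← h1]; exact h, rfl⟩
    · rintro ⟨r', hr', h⟩
      refine ⟨I.mul_mem_left r hωI, h1.trans ?_⟩
      have : ε (r' - r) = 0 := hI (Ideal.Quotient.eq.mp h)
      rw [map_sub, show ε r' = 0 from hr', zero_sub, neg_eq_zero] at this
      exact this
  · intro x hx
    obtain ⟨x, rfl⟩ := K.mkQ_surjective x
    rw [hν, Ideal.Quotient.eq_zero_iff_mem] at hx
    obtain ⟨b, c, hc, hbc⟩ := hΛ' x hx
    refine ⟨_, ⟨c, mem_nonZeroDivisors_of_ne_zero hc, rfl⟩,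
      Ideal.Quotient.mk I b, ?_⟩
    change Ideal.Quotient.mk I c • _ = _
    rw [hmk, hmk, ← map_smul, ← map_smul, ← sub_eq_zero, ← map_sub, Submodule.mkQ_apply,
      Submodule.Quotient.mk_eq_zero]
    refine ⟨I.sub_mem (I.mul_mem_left c hx) (I.mul_mem_left b hωI), ?_⟩
    change Λ (c * x - b * ω) = 0
    rw [map_sub, hΛ _ _ hx, hΛ _ _ hωI, hbc, hω1, mul_one, sub_self]
  · intro x x'
    obtain ⟨x, rfl⟩ := K.mkQ_surjective x
    obtain ⟨x', rfl⟩ := K.mkQ_surjective x'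
    rw [hν, hν, hmk, hmk, ← map_smul, ← map_smul]
    congr 1
    ext
    exact mul_comm _ _
  · simp only [hmk, ← map_smul, ← map_sum]
    congr 1
    ext
    simpa using hny

end SquareZeroExtension

section ScalarFrobenius

open MvPolynomial

theorem exists_addMonoidHom_extension (p : ℕ) [Fact p.Prime] {W X Z : Type*} [AddCommGroup W]
    [AddCommGroup X] [AddCommGroup Z] (hX : ∀ x : X, p • x = 0)
    (hZ : ∀ z : Z, p • z = 0) (j : W →+ X) (hj : Function.Injective j) (κ : W →+ Z) :
    ∃ l : X →+ Z, ∀ w, l (j w) = κ w := by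
  have hW : ∀ w : W, p • w = 0 := fun w => hj (by rw [map_nsmul, hX, map_zero])
  let _ := AddCommGroup.zmodModule hW
  let _ := AddCommGroup.zmodModule hX
  let _ := AddCommGroup.zmodModule hZ
  obtain ⟨g, hg⟩ := (j.toZModLinearMap p).exists_leftInverse_of_injective
    (LinearMap.ker_eq_bot.mpr hj)
  exact ⟨κ.comp g.toAddMonoidHom, fun w => congrArg κ (LinearMap.congr_fun hg w)⟩

variable (p : ℕ) [Fact p.Prime] (A B : Type u) [CommRing A] [CommRing B] [CharP A p]
  [Algebra A B]

/-- The tautological presentation of an `A`-algebra `B` by a polynomial ring on the set `B`. -/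
noncomputable def tautPresentation : MvPolynomial B A →ₐ[A] B := aeval id

theorem tautPresentation_surjective : Function.Surjective (tautPresentation A B) :=
  fun b => ⟨X b, by simp [tautPresentation]⟩

/-- The base change of the tautological presentation along Frobenius. -/
noncomputable def frobPresentation :
    Frob p A ⊗[A] MvPolynomial B A →ₐ[Frob p A] Frob p A ⊗[A] B :=
  Algebra.TensorProduct.map (AlgHom.id _ _) (tautPresentation A B)

variable {A B}

theorem frobPresentation_tmul (a : Frob p A) (P : MvPolynomial B A) :
    frobPresentation p A B (a ⊗ₜ P) = a ⊗ₜ tautPresentation A B P := rfl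

theorem frobPresentation_surjective : Function.Surjective (frobPresentation p A B) := by
  intro x
  induction x using TensorProduct.induction_on with
  | zero => exact ⟨0, map_zero _⟩
  | add x y hx hy =>
    obtain ⟨x, rfl⟩ := hx
    obtain ⟨y, rfl⟩ := hy
    exact ⟨x + y, map_add _ _ _⟩
  | tmul a b =>
    obtain ⟨P, rfl⟩ := tautPresentation_surjective A B b
    exact ⟨a ⊗ₜ P, frobPresentation_tmul p a P⟩

variable {p} {k : Type u} [Field k] [CharP k p] (φ : B →+* k)
  (Φ : (Frob p A ⊗[A] B) →+* B)
  (hΦ : ∀ (a : A) (b : B), Φ (toFrob p a ⊗ₜ[A] b) = algebraMap A B a * b ^ p)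
  (lam : RingHom.ker (tautPresentation A B) →+ k)
  (hlam : ∀ (P : MvPolynomial B A) (x : RingHom.ker (tautPresentation A B)),
      lam (P • x) = φ (tautPresentation A B P) * lam x)

/-- The additive map on the Frobenius base change of the relation ideal that is induced by
the `p`-th power of `lam`. -/
noncomputable def frobTwist :
    Frob p A ⊗[A] RingHom.ker (tautPresentation A B) →+ k :=
  let fA : Frob p A →+* k := (φ.comp (algebraMap A B) : A →+* k)
  TensorProduct.liftAddHom
    ((AddMonoidHom.mul.comp fA.toAddMonoidHom).compl₂
      ((frobenius k p).toAddMonoidHom.comp lam))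
    (by
      intro r a x
      have hr : lam (r • x) = φ (algebraMap A B r) * lam x := by
        have := hlam (C r) x
        simp only [tautPresentation, aeval_C] at this
        refine Eq.trans ?_ this
        exact congrArg lam (Subtype.ext (MvPolynomial.smul_eq_C_mul (x : MvPolynomial B A) r))
      have ha : ∀ a : A, φ (algebraMap A B (r ^ p * a)) * lam x ^ p =
          φ (algebraMap A B a) * lam (r • x) ^ p := fun a => by
        rw [hr]
        simp only [map_mul, map_pow]
        ring
      exact ha a)

theorem frobTwist_tmul (a : A) (x) : frobTwist φ lam hlam (toFrob p a ⊗ₜ x) =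
    φ (algebraMap A B a) * lam x ^ p := rfl

/-- The inclusion of the Frobenius base change of the relation ideal. -/
noncomputable def frobRelations (p : ℕ) [Fact p.Prime] (A B : Type u) [CommRing A] [CommRing B]
    [CharP A p] [Algebra A B] :
    Frob p A ⊗[A] RingHom.ker (tautPresentation A B) →ₗ[A] Frob p A ⊗[A] MvPolynomial B A :=
  (((RingHom.ker (tautPresentation A B)).subtype).restrictScalars A).lTensor (Frob p A)

theorem exact_subtype_tautPresentation : Function.Exact
    (((RingHom.ker (tautPresentation A B)).subtype).restrictScalars A)
    (tautPresentation A B).toLinearMap := by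
  intro x
  constructor
  · intro hx
    exact ⟨⟨x, hx⟩, rfl⟩
  · rintro ⟨x, rfl⟩
    exact x.2

theorem frobRelations_injective [Module.Flat A B] :
    Function.Injective (frobRelations p A B) :=
  LinearMap.lTensor_injective_of_exact_of_flat (tautPresentation A B).toLinearMap
    (tautPresentation_surjective A B) _ Subtype.val_injective
    exact_subtype_tautPresentation _

theorem exists_frobRelations_eq {x : Frob p A ⊗[A] MvPolynomial B A}
    (hx : frobPresentation p A B x = 0) : ∃ w, frobRelations p A B w = x :=
  (lTensor_exact (Frob p A) exact_subtype_tautPresentation (tautPresentation_surjective A B) x).mp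
    hx

include hΦ in
theorem mul_frobRelations (t : Frob p A ⊗[A] MvPolynomial B A)
    (w : Frob p A ⊗[A] RingHom.ker (tautPresentation A B)) :
    ∃ w', frobRelations p A B w' = t * frobRelations p A B w ∧
      frobTwist φ lam hlam w' = φ (Φ (frobPresentation p A B t)) * frobTwist φ lam hlam w := by
  induction t using TensorProduct.induction_on with
  | zero => exact ⟨0, by simp, by simp⟩
  | add t t' ht ht' =>
    obtain ⟨w₁, h₁, h₁'⟩ := ht
    obtain ⟨w₂, h₂, h₂'⟩ := ht'
    exact ⟨w₁ + w₂, by rw [map_add, h₁, h₂, add_mul],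
      by rw [AddMonoidHom.map_add, h₁', h₂', map_add, map_add, map_add, add_mul]⟩
  | tmul a P =>
    induction w using TensorProduct.induction_on with
    | zero => exact ⟨0, by simp, by simp⟩
    | add w w' hw hw' =>
      obtain ⟨w₁, h₁, h₁'⟩ := hw
      obtain ⟨w₂, h₂, h₂'⟩ := hw'
      exact ⟨w₁ + w₂, by rw [map_add, h₁, h₂, map_add, mul_add],
        by rw [AddMonoidHom.map_add, h₁', h₂', AddMonoidHom.map_add, mul_add]⟩
    | tmul a' x =>
      obtain ⟨a, rfl⟩ : ∃ a₀ : A, toFrob p a₀ = a := ⟨a, rfl⟩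
      obtain ⟨a', rfl⟩ : ∃ a₀ : A, toFrob p a₀ = a' := ⟨a', rfl⟩
      refine ⟨toFrob p (a * a') ⊗ₜ (P • x), ?_, ?_⟩
      · exact (Algebra.TensorProduct.tmul_mul_tmul _ _ P (x : MvPolynomial B A)).symm
      · rw [frobPresentation_tmul, hΦ, frobTwist_tmul, frobTwist_tmul, hlam]
        simp only [map_mul, map_pow]
        ring

include hΦ in
theorem frobTwist_mem_fractions (hfrac : ∀ x : k, ∃ b c, φ c ≠ 0 ∧ φ c * x = φ b)
    (w : Frob p A ⊗[A] RingHom.ker (tautPresentation A B)) :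
    ∃ b c, φ (Φ (frobPresentation p A B c)) ≠ 0 ∧
      φ (Φ (frobPresentation p A B c)) * frobTwist φ lam hlam w =
        φ (Φ (frobPresentation p A B b)) := by
  induction w using TensorProduct.induction_on with
  | zero => exact ⟨0, 1, by simp, by simp⟩
  | add w w' hw hw' =>
    obtain ⟨b, c, hc, h⟩ := hw
    obtain ⟨b', c', hc', h'⟩ := hw'
    refine ⟨b * c' + b' * c, c * c', by simpa using ⟨hc, hc'⟩, ?_⟩
    rw [AddMonoidHom.map_add]
    simp only [map_add, map_mul, ← h, ← h']
    ring
  | tmul a x =>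
    obtain ⟨a, rfl⟩ : ∃ a₀ : A, toFrob p a₀ = a := ⟨a, rfl⟩
    have h1 : ∀ (a : A) (b : B),
        Φ (frobPresentation p A B (toFrob p a ⊗ₜ X b)) = algebraMap A B a * b ^ p := fun a b => by
      rw [frobPresentation_tmul, hΦ]
      simp [tautPresentation]
    obtain ⟨b, c, hc, h⟩ := hfrac (lam x)
    refine ⟨toFrob p a ⊗ₜ X b, toFrob p 1 ⊗ₜ X c, ?_, ?_⟩
    · rw [h1]
      simpa using fun h => absurd h hc
    · rw [h1, h1, frobTwist_tmul]
      simp only [map_mul, map_pow, map_one, ← h]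
      ring

include hΦ hlam in
theorem exists_frobTwist_extension [Module.Flat A B]
    (hfrac : ∀ x : k, ∃ b c, φ c ≠ 0 ∧ φ c * x = φ b) :
    ∃ Λ : Frob p A ⊗[A] MvPolynomial B A →+ k,
      (∀ t x, frobPresentation p A B x = 0 →
        Λ (t * x) = φ (Φ (frobPresentation p A B t)) * Λ x) ∧
      (∀ x, frobPresentation p A B x = 0 → ∃ b c, φ (Φ (frobPresentation p A B c)) ≠ 0 ∧
        φ (Φ (frobPresentation p A B c)) * Λ x = φ (Φ (frobPresentation p A B b))) ∧
      ∀ x : RingHom.ker (tautPresentation A B),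
        Λ (1 ⊗ₜ (x : MvPolynomial B A)) = lam x ^ p := by
  have hp : ((p : Frob p A)) = 0 := CharP.cast_eq_zero A p
  obtain ⟨Λ, hΛ⟩ := exists_addMonoidHom_extension p
    (X := Frob p A ⊗[A] MvPolynomial B A) (Z := k)
    (fun x => by
      rw [nsmul_eq_mul, ← map_natCast (algebraMap (Frob p A) (Frob p A ⊗[A] MvPolynomial B A)),
        hp, map_zero, zero_mul])
    (fun x => by rw [nsmul_eq_mul, CharP.cast_eq_zero, zero_mul])
    (frobRelations p A B).toAddMonoidHom frobRelations_injective (frobTwist φ lam hlam)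
  refine ⟨Λ, fun t x hx => ?_, fun x hx => ?_, fun x => ?_⟩
  · obtain ⟨w, rfl⟩ := exists_frobRelations_eq hx
    obtain ⟨w', h, h'⟩ := mul_frobRelations φ Φ hΦ lam hlam t w
    rw [← h]
    exact (hΛ w').trans (h'.trans (congrArg _ (hΛ w).symm))
  · obtain ⟨w, rfl⟩ := exists_frobRelations_eq hx
    obtain ⟨b, c, hc, h⟩ := frobTwist_mem_fractions φ Φ hΦ lam hlam hfrac w
    exact ⟨b, c, hc, (congrArg _ (hΛ w)).trans h⟩
  · refine (hΛ (1 ⊗ₜ x)).trans ((frobTwist_tmul φ lam hlam 1 x).trans ?_)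
    simp

end ScalarFrobenius

section PolynomialExtension

open MvPolynomial

theorem exists_mvPolynomial_extension {V T S k : Type*} [CommRing T] [CommRing S] [Field k]
    (τ : T →+* S) (ε : T →+* k) (Λ : T →+ k) (hΛ : ∀ t x, τ x = 0 → Λ (t * x) = ε t * Λ x)
    (hΛ' : ∀ x, τ x = 0 → ∃ b c, ε c ≠ 0 ∧ ε c * Λ x = ε b) (y : V → k) :
    ∃ Λ' : MvPolynomial V T →+ k,
      (∀ t, ∀ x ∈ RingHom.ker (map τ : MvPolynomial V T →+* MvPolynomial V S),
        Λ' (t * x) = eval₂Hom ε y t * Λ' x) ∧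
      (∀ x ∈ RingHom.ker (map τ : MvPolynomial V T →+* MvPolynomial V S),
        ∃ b c, eval₂Hom ε y c ≠ 0 ∧ eval₂Hom ε y c * Λ' x = eval₂Hom ε y b) ∧
      ∀ a, Λ' (C a) = Λ a := by
  classical
  let Λ' : MvPolynomial V T →+ k :=
    (Finsupp.liftAddHom fun m : V →₀ ℕ =>
      (AddMonoidHom.mulRight (m.prod fun v n => y v ^ n)).comp Λ).comp
    (AddMonoidAlgebra.coeffAddEquiv.toAddMonoidHom : MvPolynomial V T →+ ((V →₀ ℕ) →₀ T))
  have hmon : ∀ m a, Λ' (monomial m a) = Λ a * m.prod fun v n => y v ^ n := fun m a =>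
    (Finsupp.liftAddHom_apply_single _ m a)
  have hε : ∀ m a, eval₂Hom ε y (monomial m a) = ε a * m.prod fun v n => y v ^ n :=
    fun m a => eval₂_monomial _ _
  have hind : ∀ (P : MvPolynomial V T → Prop) (x : MvPolynomial V T), map τ x = 0 → P 0 →
      (∀ f g, P f → P g → P (f + g)) → (∀ m a, τ a = 0 → P (monomial m a)) → P x := by
    intro P x hx h0 hadd hm
    rw [← support_sum_monomial_coeff x]
    refine Finset.sum_induction _ P hadd h0 fun m _ => hm _ _ ?_
    rw [← coeff_map, hx, coeff_zero]
  refine ⟨Λ', fun t x hx => ?_, fun x hx => ?_, fun a => ?_⟩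
  · refine hind (fun x => Λ' (t * x) = eval₂Hom ε y t * Λ' x) x hx (by simp) ?_ ?_
    · intro f g hf hg
      simp only [mul_add, map_add, hf, hg]
    · intro m a ha
      induction t using MvPolynomial.induction_on' with
      | monomial n b =>
        rw [monomial_mul, hmon, hmon, hε, hΛ _ _ ha, Finsupp.prod_add_index' (by simp)
          (by simp [pow_add])]
        ring
      | add f g hf hg => simp only [add_mul, map_add, hf, hg]
  · refine hind (fun x => ∃ b c, eval₂Hom ε y c ≠ 0 ∧ eval₂Hom ε y c * Λ' x = eval₂Hom ε y b)
      x hx ⟨0, 1, by simp, by simp⟩ ?_ ?_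
    · rintro f g ⟨b, c, hc, h⟩ ⟨b', c', hc', h'⟩
      refine ⟨b * c' + b' * c, c * c', by rw [map_mul]; exact mul_ne_zero hc hc', ?_⟩
      rw [Λ'.map_add, map_add, map_mul, map_mul, map_mul, ← h, ← h']
      ring
    · intro m a ha
      obtain ⟨b, c, hc, h⟩ := hΛ' a ha
      refine ⟨monomial m b, C c, by simpa using hc, ?_⟩
      rw [hmon, hε, ← h, coe_eval₂Hom, eval₂_C]
      ring
  · rw [← monomial_zero', hmon, Finsupp.prod_zero_index, mul_one]

end PolynomialExtension

section Vanishing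

open MvPolynomial

/-- The ring map `T ⧸ ker (map τ) → B` given by a ring map `S → B` and values for the variables
is compatible with finiteness of flat dimension. -/
theorem exists_flatDimLE_quotient {V T S B : Type u} [Finite V] [CommRing T] [CommRing S]
    [CommRing B] (τ : T →+* S) (hτ : Function.Surjective τ) (Φ : S →+* B) (y : V → B)
    (hfd : letI : Algebra S B := Φ.toAlgebra
      ∃ n, FlatDimLE S n B) :
    ∃ χ : (MvPolynomial V T ⧸ RingHom.ker (map τ : MvPolynomial V T →+* MvPolynomial V S)) →+* B,
      (∀ x, χ (Ideal.Quotient.mk _ x) = eval₂Hom (Φ.comp τ) y x) ∧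
      letI : Module (MvPolynomial V T ⧸
          RingHom.ker (map τ : MvPolynomial V T →+* MvPolynomial V S)) B := Module.compHom B χ
      ∃ n, FlatDimLE (MvPolynomial V T ⧸
          RingHom.ker (map τ : MvPolynomial V T →+* MvPolynomial V S)) n B := by
  obtain ⟨n, hn⟩ := hfd
  let _ : Algebra S B := Φ.toAlgebra
  let χ₁ : MvPolynomial V S →+* B := (aeval y : MvPolynomial V S →ₐ[S] B).toRingHom
  let _ : Module (MvPolynomial V S) B := Module.compHom B χ₁
  have : IsScalarTower S (MvPolynomial V S) B := ⟨fun r x b => by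
    change χ₁ (r • x) * b = r • (χ₁ x * b)
    rw [show χ₁ (r • x) = r • χ₁ x from map_smul (aeval y : MvPolynomial V S →ₐ[S] B) r x,
      smul_mul_assoc]⟩
  obtain ⟨m, hm⟩ := finiteFlatDimLifts_mvPolynomial S V B n hn
  let e := RingHom.quotientKerEquivOfSurjective (map_surjective (σ := V) τ hτ)
  let Q := MvPolynomial V T ⧸ RingHom.ker (map τ : MvPolynomial V T →+* MvPolynomial V S)
  let χ : Q →+* B := χ₁.comp e.toRingHom
  refine ⟨χ, fun x => ?_, ?_⟩
  · change aeval y (map τ x) = _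
    rw [aeval_def, eval₂_map]
    rfl
  · let _ : Algebra (MvPolynomial V S) Q := e.symm.toRingHom.toAlgebra
    let _ : Module Q B := Module.compHom B χ
    have : IsScalarTower (MvPolynomial V S) Q B := ⟨fun r x b => by
      change χ₁ (e (e.symm r * x)) * b = χ₁ r * (χ₁ (e x) * b)
      rw [map_mul, e.apply_symm_apply, map_mul, mul_assoc]⟩
    exact finiteFlatDimLifts_of_bijective (R := MvPolynomial V S) (S := Q) e.symm.bijective B m hm

theorem false_of_extension {p : ℕ} [Fact p.Prime] {A B V T S k : Type u} [CommRing A] [CommRing B]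
    [Algebra A B] [Fintype V] [CommRing T] [CommRing S] [Field k] [CharP T p] (φ : B →+* k)
    (Φ : S →+* B) (τ : T →+* S) (hτ : Function.Surjective τ)
    (hfd : letI : Algebra S B := Φ.toAlgebra
      ∃ n, FlatDimLE S n B)
    (Λ₀ : T →+ k) (hΛ₀ : ∀ t x, τ x = 0 → Λ₀ (t * x) = φ (Φ (τ t)) * Λ₀ x)
    (hΛ₀' : ∀ x, τ x = 0 → ∃ b c, φ (Φ (τ c)) ≠ 0 ∧ φ (Φ (τ c)) * Λ₀ x = φ (Φ (τ b)))
    (y : V → B) (iL : A →+* T) (iR : MvPolynomial V A →+* T)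
    (hLR : ∀ a, iR (C a) = iL a ^ p) (hL : ∀ a, Φ (τ (iL a)) = algebraMap A B a)
    (hR : ∀ v, Φ (τ (iR (X v))) = y v ^ p) (g : MvPolynomial V A) (hg : τ (iR g) = 0)
    (hΛg : Λ₀ (iR g) = 1) (hg0 : aeval y g = 0) (hd : ∀ v, φ (aeval y (pderiv v g)) = 0) :
    False := by
  let I : Ideal (MvPolynomial V T) :=
    RingHom.ker (map τ : MvPolynomial V T →+* MvPolynomial V S)
  let ψ : MvPolynomial V T →+* B := eval₂Hom (Φ.comp τ) y
  let ε : MvPolynomial V T →+* k := eval₂Hom (φ.comp (Φ.comp τ)) (fun v => φ (y v))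
  have hε : ∀ t, ε t = φ (ψ t) := fun t =>
    (RingHom.congr_fun (comp_eval₂Hom (Φ.comp τ) y φ) t).symm
  obtain ⟨Λ, hΛ, hΛ', hΛC⟩ :=
    exists_mvPolynomial_extension τ (φ.comp (Φ.comp τ)) Λ₀ hΛ₀ hΛ₀' (fun v : V => φ (y v))
  obtain ⟨χ, hχ, d, hd'⟩ := exists_flatDimLE_quotient τ hτ Φ y hfd
  let _ : Module (MvPolynomial V T ⧸ I) B := Module.compHom B χ
  have hIψ : ∀ x ∈ I, ψ x = 0 := fun x hx => by
    refine (hχ x).symm.trans ?_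
    rw [Ideal.Quotient.eq_zero_iff_mem.mpr hx, map_zero]
  let α : MvPolynomial V A →+* MvPolynomial V T := (C : T →+* MvPolynomial V T).comp iR
  let β : MvPolynomial V A →+* MvPolynomial V T := eval₂Hom (α.comp C) (fun v => X v ^ p)
  let γ : MvPolynomial V A →+* MvPolynomial V T :=
    eval₂Hom ((C : T →+* MvPolynomial V T).comp iL) X
  have hγ : ∀ h, ψ (γ h) = aeval y h := by
    intro h
    induction h using MvPolynomial.induction_on with
    | C a => simp [ψ, γ, hL]
    | add f g hf hg => simp only [map_add, hf, hg]
    | mul_X f v hf =>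
      simp only [map_mul, hf, aeval_X]
      simp [ψ, γ]
  have hβ : ∀ h, β h = γ h ^ p := by
    intro h
    induction h using MvPolynomial.induction_on with
    | C a => simp [β, γ, α, hLR]
    | add f g hf hg => rw [map_add, map_add, hf, hg, add_pow_char]
    | mul_X f v hf =>
      rw [map_mul, map_mul, hf, mul_pow]
      simp [β, γ]
  obtain ⟨σ, hσ, h⟩ := exists_smul_mem_of_extension I (RingHom.ker ψ) ε
    (fun x hx => by rw [RingHom.mem_ker, hε, hIψ x hx, map_zero]) Λ hΛ hΛ'
    (α g) (by simp [I, α, RingHom.mem_ker, hg]) ((hΛC _).trans hΛg)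
    (by
      refine mem_mul_of_pderiv_mem α β ?_ _ _ ?_ ?_ g ?_ ?_
      · intro c
        simp [β]
      · intro x hx
        rw [RingHom.mem_ker, hε, show ψ x = 0 from hx, map_zero]
      · intro v
        rw [RingHom.mem_ker]
        simp [α, β, ψ, hR]
      · rw [hβ]
        refine Ideal.pow_le_pow_right (Fact.out : p.Prime).two_le (Ideal.pow_mem_pow ?_ p)
        rw [RingHom.mem_ker, hγ, hg0]
      · intro v
        rw [RingHom.mem_ker, hε, hβ, map_pow, hγ, map_pow, hd,
          zero_pow (Fact.out : p.Prime).ne_zero])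
    hd' (1 : B) (fun y hy => by
      change χ _ * 1 = 0
      rw [mul_one]
      exact (hχ y).trans hy)
  refine hσ ((hε σ).trans ?_)
  have hsub : ∀ x : B, x ∈ (RingHom.ker ε).map (Ideal.Quotient.mk I) •
      (⊤ : Submodule (MvPolynomial V T ⧸ I) B) → φ x = 0 := by
    intro x hx
    refine Submodule.smul_induction_on hx ?_ ?_
    · intro r hr b _
      obtain ⟨r, hr', rfl⟩ :=
        (Ideal.mem_map_iff_of_surjective _ Ideal.Quotient.mk_surjective).mp hr
      change φ (χ _ * b) = 0
      rw [hχ, map_mul]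
      change φ (ψ r) * _ = 0
      rw [← hε, show ε r = 0 from hr', zero_mul]
    · intro x y hx hy
      rw [map_add, hx, hy, add_zero]
  have := hsub _ h
  change φ (χ _ * 1) = 0 at this
  rw [mul_one, hχ] at this
  exact this

variable {p : ℕ} [Fact p.Prime] {A B k : Type u} [CommRing A] [CommRing B] [CharP A p]
  [Algebra A B] [Module.Flat A B] [Field k] [CharP k p] (φ : B →+* k)
  (hfrac : ∀ x : k, ∃ b c, φ c ≠ 0 ∧ φ c * x = φ b)
  (Φ : (Frob p A ⊗[A] B) →+* B)
  (hΦ : ∀ (a : A) (b : B), Φ (toFrob p a ⊗ₜ[A] b) = algebraMap A B a * b ^ p)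
  (hfd : letI : Algebra (Frob p A ⊗[A] B) B := Φ.toAlgebra
    ∃ n, FlatDimLE (Frob p A ⊗[A] B) n B)
  (lam : RingHom.ker (tautPresentation A B) →+ k)
  (hlam : ∀ (P : MvPolynomial B A) (x : RingHom.ker (tautPresentation A B)),
      lam (P • x) = φ (tautPresentation A B P) * lam x)

include hfrac hΦ hfd hlam in
theorem ne_one_of_pderiv_eq_zero (f : RingHom.ker (tautPresentation A B))
    (hf : ∀ b, φ (tautPresentation A B (pderiv b f.1)) = 0) : lam f ≠ 1 := by
  intro hf1
  obtain ⟨V, g, hg⟩ := exists_finset_rename f.1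
  obtain ⟨Λ₀, hΛ₀, hΛ₀', hΛ₀lam⟩ := exists_frobTwist_extension φ Φ hΦ lam hlam hfrac
  have hk : (p : Frob p A ⊗[A] MvPolynomial B A) = 0 := by
    rw [← map_natCast (algebraMap A (Frob p A ⊗[A] MvPolynomial B A)), CharP.cast_eq_zero,
      map_zero]
  have : Nontrivial (Frob p A ⊗[A] MvPolynomial B A) :=
    (φ.comp (Φ.comp (frobPresentation p A B).toRingHom)).domain_nontrivial
  have : CharP (Frob p A ⊗[A] MvPolynomial B A) p :=
    (CharP.charP_iff_prime_eq_zero Fact.out).mpr hk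
  let frobId : A →+* Frob p A := RingHom.id A
  let iR : MvPolynomial B A →+* Frob p A ⊗[A] MvPolynomial B A :=
    (Algebra.TensorProduct.includeRight : MvPolynomial B A →ₐ[A] _).toRingHom
  have hτ : ∀ (a : A) (P : MvPolynomial B A),
      Φ (frobPresentation p A B (toFrob p a ⊗ₜ P)) =
        algebraMap A B a * tautPresentation A B P ^ p := fun a P => by
    rw [frobPresentation_tmul, hΦ]
  have hg' : ∀ h : MvPolynomial V A, tautPresentation A B (rename Subtype.val h) =
      aeval (fun v : V => v.1) h := fun h => aeval_rename _ _ _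
  refine false_of_extension φ Φ (frobPresentation p A B).toRingHom
    (frobPresentation_surjective p) hfd Λ₀ hΛ₀ hΛ₀' (fun v : V => v.1)
    ((algebraMap (Frob p A) (Frob p A ⊗[A] MvPolynomial B A)).comp frobId)
    (iR.comp (rename (Subtype.val : V → B) : MvPolynomial V A →ₐ[A] MvPolynomial B A).toRingHom)
    ?_ ?_ ?_ g ?_ ?_ ?_ ?_
  · intro a
    have h1 : iR (rename (Subtype.val : V → B) (C a)) =
        algebraMap A (Frob p A ⊗[A] MvPolynomial B A) a := by
      rw [rename_C]
      exact (Algebra.TensorProduct.includeRight :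
        MvPolynomial B A →ₐ[A] Frob p A ⊗[A] MvPolynomial B A).commutes a
    refine h1.trans ?_
    rw [← map_pow]
    rfl
  · intro a
    refine (hτ a 1).trans ?_
    simp
  · intro v
    refine (hτ 1 (rename Subtype.val (X v))).trans ?_
    rw [hg', aeval_X]
    simp
  · change frobPresentation p A B (toFrob p 1 ⊗ₜ (rename Subtype.val g)) = 0
    rw [frobPresentation_tmul, ← hg, show tautPresentation A B f.1 = 0 from f.2,
      TensorProduct.tmul_zero]
  · change Λ₀ (1 ⊗ₜ (rename Subtype.val g)) = 1
    rw [← hg]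
    exact (hΛ₀lam f).trans (by rw [hf1, one_pow])
  · rw [← hg', ← hg]
    exact f.2
  · intro v
    rw [← hg', ← pderiv_rename Subtype.val_injective, ← hg]
    exact hf v

include hfrac hΦ hfd hlam in
theorem eq_zero_of_pderiv_eq_zero (f : RingHom.ker (tautPresentation A B))
    (hf : ∀ b, φ (tautPresentation A B (pderiv b f.1)) = 0) : lam f = 0 := by
  by_contra h0
  refine ne_one_of_pderiv_eq_zero φ hfrac Φ hΦ hfd
    ((AddMonoidHom.mulLeft (lam f)⁻¹).comp lam) (fun P x => ?_) f hf (inv_mul_cancel₀ h0)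
  change (lam f)⁻¹ * lam (P • x) = _ * ((lam f)⁻¹ * lam x)
  rw [hlam]
  ring

end Vanishing

section Lifting

open MvPolynomial

/-- A linear map between vector spaces whose kernel contains the kernel of `F` factors
through `F`. -/
theorem exists_comp_eq_of_ker_le {k U V W : Type*} [Field k] [AddCommGroup U] [AddCommGroup V]
    [AddCommGroup W] [Module k U] [Module k V] [Module k W] (F : U →ₗ[k] V) (G : U →ₗ[k] W)
    (h : LinearMap.ker F ≤ LinearMap.ker G) : ∃ E : V →ₗ[k] W, ∀ x, E (F x) = G x := by
  obtain ⟨s, hs⟩ := F.rangeRestrict.exists_rightInverse_of_surjective F.range_rangeRestrict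
  obtain ⟨t, ht⟩ := LinearMap.exists_extend s
  refine ⟨G.comp t, fun x => ?_⟩
  have h1 : t (F x) = s ⟨F x, x, rfl⟩ := LinearMap.congr_fun ht ⟨F x, x, rfl⟩
  have h2 : F (s ⟨F x, x, rfl⟩) = F x := congrArg Subtype.val (LinearMap.congr_fun hs ⟨F x, x, rfl⟩)
  have h3 : G (s ⟨F x, x, rfl⟩ - x) = 0 := h (by rw [LinearMap.mem_ker, map_sub, h2, sub_self])
  rw [LinearMap.comp_apply, h1, ← sub_eq_zero, ← map_sub, h3]

variable {A B k : Type u} [CommRing A] [CommRing B] [Algebra A B] [Field k] (φ : B →+* k)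

/-- The Jacobian of a polynomial in the tautological presentation, evaluated in `k`. -/
theorem exists_jacobian : ∃ D : MvPolynomial B A →+ (B →₀ k),
    (∀ b, D (X b) = Finsupp.single b 1) ∧ (∀ a, D (C a) = 0) ∧
    (∀ f g, D (f * g) = φ (tautPresentation A B f) • D g + φ (tautPresentation A B g) • D f) ∧
    ∀ f b, D f b = φ (tautPresentation A B (pderiv b f)) := by
  classical
  let _ : Algebra (MvPolynomial B A) k := (φ.comp (tautPresentation A B).toRingHom).toAlgebra
  let _ : Algebra A k := (φ.comp (algebraMap A B)).toAlgebra
  have : IsScalarTower A (MvPolynomial B A) k := IsScalarTower.of_algebraMap_eq fun a => by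
    change φ (algebraMap A B a) = φ (tautPresentation A B (algebraMap _ _ a))
    rw [AlgHom.commutes]
  let D := mkDerivation A (fun b : B => (Finsupp.single b 1 : B →₀ k))
  have hsmul : ∀ (f : MvPolynomial B A) (x : B →₀ k), f • x = φ (tautPresentation A B f) • x :=
    fun f x => algebraMap_smul k f x |>.symm
  have hX : ∀ b, D (X b) = Finsupp.single b 1 := fun b => mkDerivation_X _ _ _
  have hC : ∀ a, D (C a) = 0 := fun a => D.map_algebraMap a
  have hmul : ∀ f g, D (f * g) =
      φ (tautPresentation A B f) • D g + φ (tautPresentation A B g) • D f := fun f g => by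
    rw [D.leibniz, hsmul, hsmul]
  refine ⟨D.toLinearMap.toAddMonoidHom, hX, hC, hmul, fun f b => ?_⟩
  change D f b = _
  induction f using MvPolynomial.induction_on with
  | C a => simp [hC]
  | add f g hf hg => simp only [map_add, Finsupp.add_apply, hf, hg]
  | mul_X f c hf =>
    rw [hmul, hX, Derivation.leibniz, pderiv_X]
    simp [hf, Finsupp.single_apply, Pi.single_apply, apply_ite]

variable (hfrac : ∀ x : k, ∃ b c, φ c ≠ 0 ∧ φ c * x = φ b)
  (H : ∀ lam : RingHom.ker (tautPresentation A B) →+ k,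
    (∀ (P : MvPolynomial B A) (x : RingHom.ker (tautPresentation A B)),
      lam (P • x) = φ (tautPresentation A B P) * lam x) →
    ∀ f : RingHom.ker (tautPresentation A B),
      (∀ b, φ (tautPresentation A B (pderiv b f.1)) = 0) → lam f = 0)
  {M : Type*} [AddCommGroup M] [Module k M] (vI : RingHom.ker (tautPresentation A B) →+ M)
  (hvI : ∀ (P : MvPolynomial B A) (x : RingHom.ker (tautPresentation A B)),
    vI (P • x) = φ (tautPresentation A B P) • vI x)

include hfrac H hvI in
theorem exists_jacobian_factorization (D : MvPolynomial B A →+ (B →₀ k))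
    (hDmul : ∀ f g, D (f * g) =
      φ (tautPresentation A B f) • D g + φ (tautPresentation A B g) • D f)
    (hDpd : ∀ f b, D f b = φ (tautPresentation A B (pderiv b f))) :
    ∃ E : (B →₀ k) →ₗ[k] M, ∀ f : RingHom.ker (tautPresentation A B), E (D f) = vI f := by
  have hDI : ∀ (P : MvPolynomial B A) (x : RingHom.ker (tautPresentation A B)),
      D (P • x).1 = φ (tautPresentation A B P) • D x := fun P x => by
    rw [Submodule.coe_smul, smul_eq_mul, hDmul, show tautPresentation A B x.1 = 0 from x.2,
      map_zero, zero_smul, add_zero]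
  have hmul : ∀ (b : B) (x : RingHom.ker (tautPresentation A B)),
      ∃ y : RingHom.ker (tautPresentation A B), D y.1 = φ b • D x.1 ∧ vI y = φ b • vI x :=
    fun b x => by
      have hb : tautPresentation A B (X b) = b := by simp [tautPresentation]
      exact ⟨_, (hDI (X b) x).trans (by rw [hb]), (hvI (X b) x).trans (by rw [hb])⟩
  have hzero : ∀ f : RingHom.ker (tautPresentation A B), D f = 0 → vI f = 0 := fun f hf => by
    rw [← Module.forall_dual_apply_eq_zero_iff k]
    intro l
    refine H (l.toAddMonoidHom.comp vI) (fun P x => ?_) f fun b => by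
      rw [← hDpd, hf, Finsupp.zero_apply]
    change l (vI (P • x)) = _ * l (vI x)
    rw [hvI, map_smul, smul_eq_mul]
  let F := Finsupp.linearCombination k fun f : RingHom.ker (tautPresentation A B) => D f
  let G := Finsupp.linearCombination k fun f : RingHom.ker (tautPresentation A B) => vI f
  have hden : ∀ x, ∃ (c : B) (f : RingHom.ker (tautPresentation A B)), φ c ≠ 0 ∧
      φ c • F x = D f ∧ φ c • G x = vI f := fun x => by
    induction x using Finsupp.induction_linear with
    | zero => exact ⟨1, 0, by simp, by simp, by simp⟩
    | add x y hx hy =>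
      obtain ⟨c, f, hc, h1, h2⟩ := hx
      obtain ⟨c', f', hc', h1', h2'⟩ := hy
      obtain ⟨g, hg1, hg2⟩ := hmul c' f
      obtain ⟨g', hg1', hg2'⟩ := hmul c f'
      refine ⟨c * c', g + g', by rw [map_mul]; exact mul_ne_zero hc hc', ?_, ?_⟩
      · rw [Submodule.coe_add, D.map_add, hg1, hg1', ← h1, ← h1', map_add, smul_add,
          smul_smul, smul_smul, map_mul, mul_comm (φ c)]
      · rw [vI.map_add, hg2, hg2', ← h2, ← h2', map_add, smul_add,
          smul_smul, smul_smul, map_mul, mul_comm (φ c)]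
    | single f r =>
      obtain ⟨b, c, hc, h⟩ := hfrac r
      obtain ⟨g, hg1, hg2⟩ := hmul b f
      refine ⟨c, g, hc, ?_, ?_⟩
      · rw [hg1, Finsupp.linearCombination_single, smul_smul, h]
      · rw [hg2, Finsupp.linearCombination_single, smul_smul, h]
  obtain ⟨E, hE⟩ := exists_comp_eq_of_ker_le F G fun x hx => by
    obtain ⟨c, f, hc, h1, h2⟩ := hden x
    rw [show F x = 0 from hx, smul_zero] at h1
    rw [hzero f h1.symm, smul_eq_zero] at h2
    exact h2.resolve_left hc
  refine ⟨E, fun f => ?_⟩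
  simpa [F, G] using hE (Finsupp.single f 1)

omit vI hvI in
include hfrac H in
theorem exists_algHom_lift {C : Type*} [CommRing C] [Algebra A C] (M : Ideal C) (hM : M ^ 2 = ⊥)
    [Module k M] (u : B →ₐ[A] C ⧸ M)
    (hk : ∀ (b : B) (c : C) (m : M), Ideal.Quotient.mk M c = u b → φ b • m = c • m) :
    ∃ g : B →ₐ[A] C, ∀ b, Ideal.Quotient.mk M (g b) = u b := by
  have hM' : ∀ m m' : M, (m : C) * m' = 0 := fun m m' => by
    have : (m : C) * m' ∈ M ^ 2 := by rw [pow_two]; exact Ideal.mul_mem_mul m.2 m'.2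
    rwa [hM] at this
  choose c hc using fun b => Ideal.Quotient.mk_surjective (u b)
  let v : MvPolynomial B A →ₐ[A] C := aeval c
  have hv : ∀ f, Ideal.Quotient.mk M (v f) = u (tautPresentation A B f) := by
    have : (Ideal.Quotient.mkₐ A M).comp v = u.comp (tautPresentation A B) := by
      ext b
      simp [v, tautPresentation, hc]
    exact fun f => AlgHom.congr_fun this f
  have hkv : ∀ (P : MvPolynomial B A) (m : M),
      φ (tautPresentation A B P) • m = v P • m := fun P m => hk _ _ _ (hv P)
  have hvM : ∀ f : RingHom.ker (tautPresentation A B), v f.1 ∈ M := fun f => by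
    rw [← Ideal.Quotient.eq_zero_iff_mem, hv, show tautPresentation A B f.1 = 0 from f.2, map_zero]
  let vI : RingHom.ker (tautPresentation A B) →+ M :=
    { toFun := fun f => ⟨v f.1, hvM f⟩
      map_zero' := Subtype.ext (map_zero v)
      map_add' := fun f g => Subtype.ext (map_add v f.1 g.1) }
  obtain ⟨D, hDX, hDC, hDmul, hDpd⟩ := exists_jacobian (A := A) φ
  obtain ⟨E, hE⟩ := exists_jacobian_factorization φ hfrac H vI (fun P x => by
    rw [hkv]
    exact Subtype.ext (map_mul v P x.1)) D hDmul hDpd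
  let w : MvPolynomial B A →ₐ[A] C :=
    { toFun := fun f => v f - (E (D f) : C)
      map_zero' := by simp
      map_one' := by rw [← C_1, hDC, map_zero, C_1, map_one]; simp
      map_add' := fun f g => by
        simp only [map_add, Submodule.coe_add]
        ring
      map_mul' := fun f g => by
        rw [hDmul, map_add, map_smul, map_smul, hkv, hkv, map_mul, Submodule.coe_add,
          Submodule.coe_smul, Submodule.coe_smul, smul_eq_mul, smul_eq_mul]
        linear_combination (-1 : C) * hM' (E (D f)) (E (D g))
      commutes' := fun a => by
        rw [MvPolynomial.algebraMap_eq, hDC, map_zero, ← MvPolynomial.algebraMap_eq,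
          AlgHom.commutes]
        simp }
  have hw : ∀ f : MvPolynomial B A, w f = v f - (E (D f) : C) := fun f => rfl
  have hwI : ∀ f : MvPolynomial B A, tautPresentation A B f = 0 → w f = 0 := fun f hf => by
    rw [hw, show D f = D (⟨f, hf⟩ : RingHom.ker (tautPresentation A B)).1 from rfl, hE]
    exact sub_self _
  let e := Ideal.quotientKerAlgEquivOfSurjective (tautPresentation_surjective A B)
  let g : B →ₐ[A] C := (Ideal.Quotient.liftₐ (RingHom.ker (tautPresentation A B)) w hwI).comp
    e.symm.toAlgHom
  refine ⟨g, fun b => ?_⟩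
  have hb : tautPresentation A B (X b) = b := by simp [tautPresentation]
  have he : e.symm b = Ideal.Quotient.mk _ (X b) := by
    rw [AlgEquiv.symm_apply_eq]
    exact hb.symm
  have hg : g b = w (X b) := by
    change Ideal.Quotient.liftₐ _ w hwI (e.symm b) = _
    rw [he]
    rfl
  rw [hg, hw, map_sub, hv, hb, Ideal.Quotient.eq_zero_iff_mem.mpr (E (D (X b))).2, sub_zero]

end Lifting

section Localization

variable {A B : Type u} [CommRing A] [CommRing B] [Algebra A B] (q : Ideal B) [q.IsPrime]

theorem exists_algebraMap_residueField_mul_eq (x : q.ResidueField) :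
    ∃ b c : B, algebraMap B q.ResidueField c ≠ 0 ∧
      algebraMap B q.ResidueField c * x = algebraMap B q.ResidueField b := by
  obtain ⟨y, rfl⟩ := IsLocalRing.residue_surjective x
  obtain ⟨b, s, rfl⟩ := IsLocalization.exists_mk'_eq q.primeCompl y
  refine ⟨b, s, fun h => s.2 (Ideal.algebraMap_residueField_eq_zero.mp h), ?_⟩
  change IsLocalRing.residue _ (algebraMap B _ _) * _ = IsLocalRing.residue _ (algebraMap B _ _)
  rw [← map_mul, IsLocalization.mk'_spec']

theorem discretelyRegular_of_vanishing [Module.Flat A B]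
    (H : ∀ (q : Ideal B) [q.IsPrime] (lam : RingHom.ker (tautPresentation A B) →+ q.ResidueField),
      (∀ (P : MvPolynomial B A) (x : RingHom.ker (tautPresentation A B)),
        lam (P • x) = algebraMap B q.ResidueField (tautPresentation A B P) * lam x) →
      ∀ f : RingHom.ker (tautPresentation A B),
        (∀ b, algebraMap B q.ResidueField (tautPresentation A B (MvPolynomial.pderiv b f.1)) = 0) →
          lam f = 0) : DiscretelyRegular A B := by
  refine ⟨inferInstance, fun q _ => ?_⟩
  have key : ((algebraMap B (Localization.AtPrime q)).comp (algebraMap A B)).toAlgebra =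
      (inferInstance : Algebra A (Localization.AtPrime q)) :=
    Algebra.algebra_ext _ _ fun a =>
      (IsScalarTower.algebraMap_apply A B (Localization.AtPrime q) a).symm
  rw [key]
  intro C _ _ M hM u hN
  let L := Localization.AtPrime q
  let N : Ideal C := Ideal.comap (Ideal.Quotient.mk M) (Ideal.map u (Ideal.map (algebraMap B L) q))
  have hMN : M ≤ N := fun x hx => by
    rw [Ideal.mem_comap, Ideal.Quotient.eq_zero_iff_mem.mpr hx]
    exact Ideal.zero_mem _
  have hN' : Module.IsTorsionBySet C M N := by
    rintro m ⟨n, hn⟩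
    have : n * (m : C) ∈ N * M := Ideal.mul_mem_mul hn m.2
    rw [hN] at this
    exact Subtype.ext this
  let _ : Module (C ⧸ N) M := hN'.module
  let w : L →+* C ⧸ N := (Ideal.Quotient.factor hMN).comp u.toRingHom
  have hw : ∀ x ∈ IsLocalRing.maximalIdeal L, w x = 0 := fun x hx => by
    obtain ⟨c, hc⟩ := Ideal.Quotient.mk_surjective (u x)
    change Ideal.Quotient.factor hMN (u x) = 0
    rw [← hc, Ideal.Quotient.factor_mk, Ideal.Quotient.eq_zero_iff_mem, Ideal.mem_comap, hc]
    refine Ideal.mem_map_of_mem u ?_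
    rwa [Localization.AtPrime.map_eq_maximalIdeal]
  let w' : q.ResidueField →+* C ⧸ N := Ideal.Quotient.lift (IsLocalRing.maximalIdeal L) w hw
  let _ : Module q.ResidueField M := Module.compHom M w'
  have hk : ∀ (x : L) (c : C) (m : M), Ideal.Quotient.mk M c = u x →
      IsLocalRing.residue L x • m = c • m := fun x c m h => by
    change w x • m = c • m
    change Ideal.Quotient.factor hMN (u x) • m = c • m
    rw [← h, Ideal.Quotient.factor_mk]
    rfl
  let uB : B →ₐ[A] C ⧸ M :=
    { u.toRingHom.comp (algebraMap B L) with commutes' := fun a => u.commutes a }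
  obtain ⟨g, hg⟩ := exists_algHom_lift (algebraMap B q.ResidueField)
    (exists_algebraMap_residueField_mul_eq q) (H q) M hM uB fun b c m h => hk _ c m h
  have hunit : ∀ s : q.primeCompl, IsUnit (g.toRingHom s) := fun s => by
    refine (IsNilpotent.isUnit_quotient_mk_iff (I := M) ⟨2, hM⟩).mp ?_
    change IsUnit (Ideal.Quotient.mk M (g s))
    rw [hg]
    exact (IsLocalization.map_units L s).map u
  let gL : L →+* C := IsLocalization.lift hunit
  have hgL : ∀ b, gL (algebraMap B L b) = g b := fun b => IsLocalization.lift_eq hunit b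
  refine ⟨{ gL with commutes' := fun a => (hgL _).trans (g.commutes a) }, ?_⟩
  refine AlgHom.coe_ringHom_injective (IsLocalization.ringHom_ext q.primeCompl ?_)
  ext b
  change Ideal.Quotient.mk M (gL (algebraMap B L b)) = u (algebraMap B L b)
  rw [hgL, hg]
  rfl

end Localization

/-- **Radu–André–Dumitrescu theorem, non-noetherian version.**
Let `p` be a prime and `f : A → B` a flat homomorphism of commutative rings of
characteristic `p`.  Let `C = (^φA) ⊗_A B` be the base change of `B` along the Frobenius of
`A`, and let `Φ : C → B`, `Φ(a ⊗ b) = f a * b ^ p`, be the relative Frobenius, making `B` a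
`C`-algebra.  If `B` has finite flat dimension over `C`, i.e. there is `d` with
`Tor_n^C(B, M) = 0` for all `C`-modules `M` and all `n ≥ d`, then `f` is discretely
regular. -/
theorem flat_relativeFrobenius_finite_flat_dimension_discretelyRegular
    (p : ℕ) [Fact p.Prime] (A B : Type u) [CommRing A] [CommRing B]
    [CharP A p] [CharP B p] [Algebra A B] [Module.Flat A B]
    (Φ : (Frob p A ⊗[A] B) →+* B)
    (hΦ : ∀ (a : A) (b : B), Φ (toFrob p a ⊗ₜ[A] b) = algebraMap A B a * b ^ p)
    (hfd : letI : Algebra (Frob p A ⊗[A] B) B := Φ.toAlgebra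
      ∃ d : ℕ, ∀ n : ℕ, d ≤ n →
        ∀ (M : Type u) [AddCommGroup M] [Module (Frob p A ⊗[A] B) M],
          IsZero (((Tor (ModuleCat.{u} (Frob p A ⊗[A] B)) n).obj
            (ModuleCat.of _ B)).obj (ModuleCat.of _ M))) :
    DiscretelyRegular A B := by
  have hfd' : letI := Φ.toAlgebra
      ∃ n, FlatDimLE (Frob p A ⊗[A] B) n B := by
    let _ : Algebra (Frob p A ⊗[A] B) B := Φ.toAlgebra
    obtain ⟨d, hd⟩ := hfd
    exact ⟨_, (torVanishes_of_isZero_tor hd).flatDimLE⟩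
  refine discretelyRegular_of_vanishing fun q _ lam hlam f hf => ?_
  have : CharP q.ResidueField p := (CharP.charP_iff_prime_eq_zero Fact.out).mpr (by
    rw [← map_natCast (algebraMap B q.ResidueField), CharP.cast_eq_zero, map_zero])
  exact eq_zero_of_pderiv_eq_zero (algebraMap B q.ResidueField)
    (exists_algebraMap_residueField_mul_eq q) Φ hΦ hfd' lam hlam f hf
end

section
/- Let f : A → B be a flat homomorphism of commutative rings and let μ : B ⊗_A B → B be the multiplication map, making B a (B ⊗_A B)-module. If B has finite flat dimension over B ⊗_A B, i.e. there exists d such that Tor_n^{B⊗_A B}(B, M) = 0 for every (B ⊗_A B)-module M and every n ≥ d, then f is discretely regular. -/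
open TensorProduct CategoryTheory CategoryTheory.Limits

universe u v

/-- A square root of multiplication by `s` on a projective module, with entries in `J`: an
endomorphism `δ` with `δ² = s` together with a vector `e` which a functional detects. -/
structure CliffordRoot {P : Type u} [CommRing P] (J : Ideal P) (s : P) where
  V : Type u
  [addCommGroup : AddCommGroup V]
  [module : Module P V]
  [projective : Module.Projective P V]
  δ : V →ₗ[P] V
  sq : ∀ v, δ (δ v) = s • v
  functional : V →ₗ[P] P
  e : V
  functional_e : functional e = 1
  functional_δ_mem : ∀ v, functional (δ v) ∈ J
  smul_δ : ∀ c : P, (∀ m ∈ J, c * m = 0) → ∀ v, c • δ v = 0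

namespace CliffordRoot

attribute [instance] addCommGroup module projective

variable {P : Type u} [CommRing P] {J : Ideal P}

/-- The root of `0` given by the zero endomorphism. -/
def zero : CliffordRoot J (0 : P) where
  V := P
  δ := 0
  sq := by simp
  functional := LinearMap.id
  e := 1
  functional_e := rfl
  functional_δ_mem := by simp
  smul_δ := by simp

/-- The root of `s + a * b` obtained by doubling a root of `s`. -/
def addMul {s a b : P} (K : CliffordRoot J s) (ha : a ∈ J) (hb : b ∈ J) :
    CliffordRoot J (s + a * b) where
  V := K.V × K.V
  δ := LinearMap.prod (K.δ ∘ₗ LinearMap.fst P _ _ + a • LinearMap.snd P _ _)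
    (b • LinearMap.fst P _ _ - K.δ ∘ₗ LinearMap.snd P _ _)
  sq := by
    rintro ⟨v, w⟩
    ext
    · simp [K.sq, add_smul, mul_smul, smul_sub]
    · simp [K.sq, add_smul, mul_smul, smul_sub]
      module
  functional := K.functional ∘ₗ LinearMap.fst P _ _
  e := (K.e, 0)
  functional_e := K.functional_e
  functional_δ_mem := by
    rintro ⟨v, w⟩
    simpa using J.add_mem (K.functional_δ_mem v) (J.mul_mem_right _ ha)
  smul_δ := by
    rintro c hc ⟨v, w⟩
    have h := K.smul_δ c hc
    ext
    · simp [h, smul_smul, hc a ha]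
    · simp [h, smul_sub, smul_smul, hc b hb]

theorem nonempty_of_mem_sq {s : P} (hs : s ∈ J ^ 2) : Nonempty (CliffordRoot J s) := by
  rw [pow_two] at hs
  suffices h : ∀ t, Nonempty (CliffordRoot J t) → Nonempty (CliffordRoot J (t + s)) by
    simpa using h 0 ⟨zero⟩
  induction hs using Submodule.mul_induction_on' with
  | mem_mul_mem a ha b hb => exact fun t ⟨K⟩ ↦ ⟨K.addMul ha hb⟩
  | add x _ y _ hx hy => exact fun t ht ↦ by simpa [add_assoc] using hy _ (hx t ht)

end CliffordRoot

theorem LinearMap.exists_comp_eq_of_projective {P V M N : Type*} [CommRing P]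
    [AddCommGroup V] [Module P V] [Module.Projective P V] [AddCommGroup M] [Module P M]
    [AddCommGroup N] [Module P N] (f : M →ₗ[P] N) (g : V →ₗ[P] N)
    (h : ∀ v, ∃ m, f m = g v) : ∃ k : V →ₗ[P] M, ∀ v, f (k v) = g v := by
  obtain ⟨k, hk⟩ := Module.projective_lifting_property f.rangeRestrict
    (g.codRestrict (LinearMap.range f) h) f.surjective_rangeRestrict
  exact ⟨k, fun v ↦ congrArg Subtype.val (LinearMap.congr_fun hk v)⟩

/-- Any free `T`-module lifts to a free module along a surjection `P → T` with kernel `(s)`. -/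
theorem Module.Free.exists_lift_of_ker_eq_span {P : Type u} {T : Type u} [CommRing P] [CommRing T]
    [Algebra P T] {s : P} (hsurj : Function.Surjective (algebraMap P T))
    (hker : RingHom.ker (algebraMap P T) = Ideal.span {s})
    (F : Type u) [AddCommGroup F] [Module T F] [Module P F] [IsScalarTower P T F]
    [Module.Free T F] :
    ∃ (ι : Type u) (r : (ι →₀ P) →ₗ[P] F), Function.Surjective r ∧
      ∀ x, r x = 0 → ∃ y, x = s • y := by
  classical
  let b := Module.Free.chooseBasis T F
  refine ⟨_, (b.repr.symm.restrictScalars P).toLinearMap ∘ₗ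
    Finsupp.mapRange.linearMap (Algebra.linearMap P T), ?_, ?_⟩
  · exact b.repr.symm.surjective.comp (Finsupp.mapRange_surjective _ (map_zero _) hsurj)
  · intro x hx
    have hx' : Finsupp.mapRange.linearMap (Algebra.linearMap P T) x = 0 := by
      apply b.repr.symm.injective
      rw [map_zero]
      exact hx
    have h : ∀ i, ∃ c, x i = s * c := fun i ↦ by
      have hi : algebraMap P T (x i) = 0 := by simpa using DFunLike.congr_fun hx' i
      rw [← RingHom.mem_ker, hker, Ideal.mem_span_singleton] at hi
      exact hi
    choose c hc using h
    refine ⟨Finsupp.onFinset x.support (fun i ↦ if x i = 0 then 0 else c i) (by simp; tauto), ?_⟩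
    ext i
    by_cases hi : x i = 0 <;> simp [hi, ← hc]

theorem Finsupp.mem_annihilator_smul_top {P ι : Type*} [CommRing P] {s : P} {J : Ideal P}
    (hJ : ∀ x, s * x = 0 → x ∈ J) {x : ι →₀ P} (hx : s • x = 0) :
    x ∈ J • (⊤ : Submodule P (ι →₀ P)) := by
  classical
  rw [← Finsupp.sum_single x]
  refine Submodule.sum_mem _ fun i _ ↦ ?_
  have : Finsupp.single i (x i) = x i • Finsupp.single i (1 : P) := by simp
  rw [this]
  exact Submodule.smul_mem_smul (hJ _ (by simpa using DFunLike.congr_fun hx i)) trivial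

/-- The periodicity step: a map from a Clifford root to `Z` gives a map to the second syzygy
`ker π₁`, and non-vanishing modulo `J` is preserved. -/
theorem CliffordRoot.exists_map_syzygy {P T : Type u} [CommRing P] [CommRing T]
    [Algebra P T] {s : P} {J : Ideal P} (hsurj : Function.Surjective (algebraMap P T))
    (hker : RingHom.ker (algebraMap P T) = Ideal.span {s})
    (hJ : ∀ x, s * x = 0 ↔ x ∈ J) (K : CliffordRoot J s)
    (Z F₀ F₁ : Type u) [AddCommGroup Z] [Module P Z]
    [AddCommGroup F₀] [Module T F₀] [Module P F₀] [IsScalarTower P T F₀] [Module.Free T F₀]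
    [AddCommGroup F₁] [Module T F₁] [Module P F₁] [IsScalarTower P T F₁] [Module.Free T F₁]
    (π₀ : F₀ →ₗ[P] Z) (π₁ : F₁ →ₗ[P] F₀) (hπ₀ : Function.Surjective π₀)
    (hex : Function.Exact π₁ π₀) (g : K.V →ₗ[P] Z) (hg : ∀ v, g (K.δ v) = 0) :
    ∃ g₂ : K.V →ₗ[P] F₁, (∀ v, π₁ (g₂ v) = 0) ∧ (∀ v, g₂ (K.δ v) = 0) ∧
      (∀ v, g₂ v ∈ J • (⊤ : Submodule P F₁)) ∧
      (∀ v, g₂ v ∈ J • LinearMap.ker π₁ → g v ∈ J • (⊤ : Submodule P Z)) := by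
  have hsT : algebraMap P T s = 0 := by
    rw [← RingHom.mem_ker, hker]; exact Ideal.mem_span_singleton_self s
  have hs₀ (x : F₀) : s • x = 0 := by rw [← algebraMap_smul T, hsT, zero_smul]
  have hs₁ (x : F₁) : s • x = 0 := by rw [← algebraMap_smul T, hsT, zero_smul]
  have hsδ (v) : s • K.δ v = 0 := K.smul_δ s (fun m hm ↦ (hJ m).2 hm) v
  have hmap {M N : Type u} [AddCommGroup M] [AddCommGroup N] [Module P M] [Module P N]
      (f : M →ₗ[P] N) {x : M} (hx : x ∈ J • (⊤ : Submodule P M)) :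
      f x ∈ J • (⊤ : Submodule P N) := by
    have := Submodule.mem_map_of_mem (f := f) hx
    rw [Submodule.map_smul''] at this
    exact Submodule.smul_mono le_rfl le_top this
  obtain ⟨ι₀, r₀, hr₀, hr₀k⟩ := Module.Free.exists_lift_of_ker_eq_span hsurj hker F₀
  obtain ⟨ι₁, r₁, hr₁, hr₁k⟩ := Module.Free.exists_lift_of_ker_eq_span hsurj hker F₁
  obtain ⟨f₀, hf₀⟩ := LinearMap.exists_comp_eq_of_projective (π₀ ∘ₗ r₀) g
    fun v ↦ (hπ₀.comp hr₀) (g v)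
  obtain ⟨f₁, hf₁⟩ := LinearMap.exists_comp_eq_of_projective (π₁ ∘ₗ r₁) (r₀ ∘ₗ f₀ ∘ₗ K.δ)
    fun v ↦ by
      obtain ⟨y, hy⟩ := (hex (r₀ (f₀ (K.δ v)))).1 ((hf₀ _).trans (hg v))
      obtain ⟨z, rfl⟩ := hr₁ y
      exact ⟨z, hy⟩
  obtain ⟨d, hd⟩ := LinearMap.exists_comp_eq_of_projective r₀ (π₁ ∘ₗ r₁) fun v ↦ hr₀ _
  obtain ⟨h, hh⟩ := LinearMap.exists_comp_eq_of_projective (s • LinearMap.id)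
    (d ∘ₗ f₁ - f₀ ∘ₗ K.δ) fun v ↦ by
      obtain ⟨y, hy⟩ := hr₀k ((d ∘ₗ f₁ - f₀ ∘ₗ K.δ) v) (by
        have h1 := hd (f₁ v)
        have h2 := hf₁ v
        simp only [LinearMap.comp_apply] at h1 h2
        simp [h1, h2])
      exact ⟨y, by simpa using hy.symm⟩
  simp only [LinearMap.comp_apply, LinearMap.sub_apply, LinearMap.smul_apply,
    LinearMap.id_apply] at hf₀ hf₁ hd hh
  refine ⟨r₁ ∘ₗ f₁ ∘ₗ K.δ, fun v ↦ ?_, fun v ↦ ?_, fun v ↦ ?_, fun v hv ↦ ?_⟩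
  · simp [hf₁, K.sq, hs₀]
  · simp [K.sq, hs₁]
  · exact hmap r₁ (Finsupp.mem_annihilator_smul_top (fun x ↦ (hJ x).1)
      (by rw [LinearMap.comp_apply, ← map_smul, hsδ, map_zero]))
  · have key : ∀ x ∈ J • LinearMap.ker π₁, ∃ y, r₁ y = x ∧ d y = 0 := by
      intro x hx
      induction hx using Submodule.smul_induction_on' with
      | smul m hm x hx =>
        obtain ⟨y, rfl⟩ := hr₁ x
        obtain ⟨w, hw⟩ := hr₀k (d y) (by rw [hd]; exact hx)
        refine ⟨m • y, map_smul _ _ _, ?_⟩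
        rw [map_smul, hw, smul_smul, mul_comm, (hJ m).2 hm, zero_smul]
      | add x _ y _ hx hy =>
        obtain ⟨a, rfl, ha⟩ := hx
        obtain ⟨b, rfl, hb⟩ := hy
        exact ⟨a + b, map_add _ _ _, by rw [map_add, ha, hb, add_zero]⟩
    obtain ⟨y, hy, hdy⟩ := key _ hv
    obtain ⟨z, hz⟩ := hr₁k (f₁ (K.δ v) - y) (by simp [hy])
    have h1 : d (f₁ (K.δ v)) = s • d z := by
      rw [← map_smul, ← hz, map_sub, hdy, sub_zero]
    have h2 := hh (K.δ v)
    rw [← map_smul, hsδ, map_zero, K.sq, h1, map_smul, ← smul_sub] at h2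
    have h3 := hmap (π₀ ∘ₗ r₀) (Finsupp.mem_annihilator_smul_top (fun x ↦ (hJ x).1) h2.symm)
    have h4 : π₀ (r₀ (d z)) = 0 := by rw [hd]; exact hex.apply_apply_eq_zero _
    rw [LinearMap.comp_apply, map_sub, map_sub, h4, hf₀, zero_sub, Submodule.neg_mem_iff] at h3
    exact h3

section Syzygy

variable {R : Type*} [CommRing R] {Z₁ F Z : Type*} [AddCommGroup Z₁] [AddCommGroup F]
  [AddCommGroup Z] [Module R Z₁] [Module R F] [Module R Z] {i : Z₁ →ₗ[R] F} {p : F →ₗ[R] Z}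

theorem LinearMap.rTensor_lTensor_comm {M N X Y : Type*} [AddCommGroup M] [AddCommGroup N]
    [AddCommGroup X] [AddCommGroup Y] [Module R M] [Module R N] [Module R X] [Module R Y]
    (f : M →ₗ[R] N) (g : X →ₗ[R] Y) (t : M ⊗[R] X) :
    f.rTensor Y (g.lTensor M t) = g.lTensor N (f.rTensor X t) := by
  rw [← LinearMap.comp_apply, ← LinearMap.comp_apply, LinearMap.rTensor_comp_lTensor,
    LinearMap.lTensor_comp_rTensor]

/-- Dimension shifting: if `Z ⊗ X` is exact in some degree, then `Z₁ ⊗ X` is exact one degree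
lower, where `Z₁` is the kernel of a surjection from a flat module to `Z`. -/
theorem Function.Exact.lTensor_syzygy (hi : Function.Injective i) (hp : Function.Surjective p)
    (hip : Function.Exact i p) [Module.Flat R F] {X₀ X₁ X₂ X₃ : Type*}
    [AddCommGroup X₀] [AddCommGroup X₁] [AddCommGroup X₂] [AddCommGroup X₃]
    [Module R X₀] [Module R X₁] [Module R X₂] [Module R X₃] [Module.Flat R X₁]
    {a : X₁ →ₗ[R] X₀} {b : X₂ →ₗ[R] X₁} {c : X₃ →ₗ[R] X₂} (hab : Function.Exact b a)
    (hbc : b ∘ₗ c = 0) (h : Function.Exact (c.lTensor Z) (b.lTensor Z)) :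
    Function.Exact (b.lTensor Z₁) (a.lTensor Z₁) := by
  rw [LinearMap.exact_iff]
  refine le_antisymm (fun x hx ↦ ?_) ?_
  · rw [LinearMap.mem_ker] at hx
    have hF := Module.Flat.lTensor_exact F hab
    obtain ⟨y, hy⟩ := (hF (i.rTensor X₁ x)).1 (by
      rw [← LinearMap.rTensor_lTensor_comm, hx, map_zero])
    obtain ⟨w, hw⟩ := (h (p.rTensor X₂ y)).1 (by
      rw [← LinearMap.rTensor_lTensor_comm, hy]
      exact (rTensor_exact X₁ hip hp).apply_apply_eq_zero x)
    obtain ⟨w, rfl⟩ := LinearMap.rTensor_surjective X₃ hp w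
    obtain ⟨z, hz⟩ := (rTensor_exact X₂ hip hp (y - c.lTensor F w)).1 (by
      rw [map_sub, LinearMap.rTensor_lTensor_comm, hw, sub_self])
    refine ⟨z, Module.Flat.rTensor_preserves_injective_linearMap i hi ?_⟩
    have hbc' : b.lTensor F (c.lTensor F w) = 0 := by
      rw [← LinearMap.comp_apply, ← LinearMap.lTensor_comp, hbc, LinearMap.lTensor_zero,
        LinearMap.zero_apply]
    rw [LinearMap.rTensor_lTensor_comm, hz, map_sub, hbc', sub_zero, hy]
  · rintro _ ⟨y, rfl⟩
    rw [LinearMap.mem_ker, ← LinearMap.comp_apply, ← LinearMap.lTensor_comp,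
      hab.linearMap_comp_eq_zero, LinearMap.lTensor_zero, LinearMap.zero_apply]

/-- If `Z ⊗ X` is exact in degree one, where `X` is a flat resolution of `N`, then tensoring with
`N` preserves injectivity of maps with cokernel `Z`. -/
theorem LinearMap.rTensor_injective_of_exact_lTensor (hi : Function.Injective i)
    (hp : Function.Surjective p) (hip : Function.Exact i p) {X₀ X₁ X₂ N : Type*}
    [AddCommGroup X₀] [AddCommGroup X₁] [AddCommGroup X₂] [AddCommGroup N]
    [Module R X₀] [Module R X₁] [Module R X₂] [Module R N] [Module.Flat R X₀]
    {ε : X₀ →ₗ[R] N} {a : X₁ →ₗ[R] X₀} {b : X₂ →ₗ[R] X₁} (hε : Function.Surjective ε)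
    (haε : Function.Exact a ε) (hab : a ∘ₗ b = 0)
    (h : Function.Exact (b.lTensor Z) (a.lTensor Z)) :
    Function.Injective (i.rTensor N) := by
  rw [injective_iff_map_eq_zero]
  intro x hx
  obtain ⟨x, rfl⟩ := LinearMap.lTensor_surjective Z₁ hε x
  rw [LinearMap.rTensor_lTensor_comm] at hx
  obtain ⟨y, hy⟩ := (lTensor_exact F haε hε _).1 hx
  obtain ⟨w, hw⟩ := (h (p.rTensor X₁ y)).1 (by
    rw [← LinearMap.rTensor_lTensor_comm, hy]
    exact (rTensor_exact X₀ hip hp).apply_apply_eq_zero x)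
  obtain ⟨w, rfl⟩ := LinearMap.rTensor_surjective X₂ hp w
  obtain ⟨z, hz⟩ := (rTensor_exact X₁ hip hp (y - b.lTensor F w)).1 (by
    rw [map_sub, LinearMap.rTensor_lTensor_comm, hw, sub_self])
  have hbc' : a.lTensor F (b.lTensor F w) = 0 := by
    rw [← LinearMap.comp_apply, ← LinearMap.lTensor_comp, hab, LinearMap.lTensor_zero,
      LinearMap.zero_apply]
  have : a.lTensor Z₁ z = x := by
    refine Module.Flat.rTensor_preserves_injective_linearMap i hi ?_
    rw [LinearMap.rTensor_lTensor_comm, hz, map_sub, hbc', sub_zero, hy]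
  rw [← this]
  exact (lTensor_exact Z₁ haε hε).apply_apply_eq_zero z

end Syzygy

section FlatBaseChange

variable {B R : Type*} [CommRing B] [CommRing R] [Algebra B R]

/-- The kernel of a surjection between flat modules is flat. -/
theorem Module.Flat.ker_of_surjective {F Z : Type*} [AddCommGroup F] [AddCommGroup Z]
    [Module R F] [Module R Z] [Module B F] [Module B Z] [IsScalarTower B R F]
    [IsScalarTower B R Z] [Module.Flat B F] [Module.Flat B Z] (p : F →ₗ[R] Z)
    (hp : Function.Surjective p) : Module.Flat B (LinearMap.ker p) := by
  rw [Module.Flat.iff_rTensor_preserves_injective_linearMap]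
  intro N N' _ _ _ _ f hf
  let i := (LinearMap.ker p).subtype.restrictScalars B
  have h1 : Function.Injective (i.lTensor N) :=
    LinearMap.lTensor_injective_of_exact_of_flat (p.restrictScalars B) hp i
      Subtype.val_injective p.exact_subtype_ker_map N
  have h2 : Function.Injective (f.rTensor F) :=
    Module.Flat.rTensor_preserves_injective_linearMap f hf
  refine Function.Injective.of_comp (f := i.lTensor N') ?_
  rw [← LinearMap.coe_comp, LinearMap.lTensor_comp_rTensor, ← LinearMap.rTensor_comp_lTensor]
  exact h2.comp h1

theorem LinearMap.baseChange_injective_of_flat_of_isPushout {L T : Type*} [CommRing L] [CommRing T]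
    [Algebra B L] [Algebra B T] [Algebra R T] [Algebra L T] [IsScalarTower B R T]
    [IsScalarTower B L T] [Algebra.IsPushout B L R T]
    {Z₁ F Z : Type*} [AddCommGroup Z₁] [AddCommGroup F]
    [AddCommGroup Z] [Module R Z₁] [Module R F] [Module R Z] [Module B Z₁] [Module B F]
    [Module B Z] [IsScalarTower B R Z₁] [IsScalarTower B R F] [IsScalarTower B R Z]
    [Module.Flat B Z] {i : Z₁ →ₗ[R] F} {p : F →ₗ[R] Z} (hi : Function.Injective i)
    (hp : Function.Surjective p) (hip : Function.Exact i p) :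
    Function.Injective (i.baseChange T) := by
  have h1 : Function.Injective ((i.restrictScalars B).lTensor L) :=
    LinearMap.lTensor_injective_of_exact_of_flat (p.restrictScalars B) hp _ hi hip L
  have h2 (x : L ⊗[B] Z₁) : i.baseChange T ((Algebra.IsPushout.cancelBaseChange B L R T Z₁).symm x)
      = (Algebra.IsPushout.cancelBaseChange B L R T F).symm ((i.restrictScalars B).lTensor L x) := by
    induction x with
    | zero => simp
    | add x y hx hy => simp only [map_add, hx, hy]
    | tmul l z => simp
  intro x y hxy
  obtain ⟨x, rfl⟩ := (Algebra.IsPushout.cancelBaseChange B L R T Z₁).symm.surjective x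
  obtain ⟨y, rfl⟩ := (Algebra.IsPushout.cancelBaseChange B L R T Z₁).symm.surjective y
  rw [h2, h2] at hxy
  rw [h1 ((LinearEquiv.injective _) hxy)]

end FlatBaseChange

theorem Submodule.mem_smul_top_of_rTensor_injective {R P T κ : Type*} [CommRing R] [CommRing P]
    [CommRing T] [CommRing κ] [Algebra R T] [Algebra P T] [SMulCommClass R P T] [Algebra T κ]
    [Algebra R κ] [IsScalarTower R T κ] {J : Ideal P}
    (hκ : Function.Surjective (algebraMap T κ))
    (hJ : ∀ t, algebraMap T κ t = 0 ↔ ∃ m ∈ J, algebraMap P T m = t)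
    {Z F : Type*} [AddCommGroup Z] [AddCommGroup F] [Module R Z] [Module R F] (i : Z →ₗ[R] F)
    (hi : Function.Injective (i.lTensor κ)) (x : T ⊗[R] Z)
    (hx : i.lTensor T x ∈ J • (⊤ : Submodule P (T ⊗[R] F))) :
    x ∈ J • (⊤ : Submodule P (T ⊗[R] Z)) := by
  let ρ : T →ₗ[R] κ := (IsScalarTower.toAlgHom R T κ).toLinearMap
  have h1 : ∀ y ∈ J • (⊤ : Submodule P (T ⊗[R] F)), ρ.rTensor F y = 0 := by
    intro y hy
    induction hy using Submodule.smul_induction_on' with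
    | smul m hm y _ =>
      induction y with
      | zero => simp
      | add x y hx hy => rw [smul_add, map_add, hx trivial, hy trivial, add_zero]
      | tmul t f =>
        have : algebraMap T κ (m • t) = 0 := by
          rw [Algebra.smul_def, map_mul, (hJ _).2 ⟨m, hm, rfl⟩, zero_mul]
        rw [TensorProduct.smul_tmul', LinearMap.rTensor_tmul]
        change algebraMap T κ (m • t) ⊗ₜ f = 0
        rw [this, zero_tmul]
    | add x _ y _ hx hy => rw [map_add, hx, hy, add_zero]
  have h2 : ρ.rTensor Z x = 0 := hi (by
    rw [← LinearMap.rTensor_lTensor_comm, h1 _ hx, map_zero])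
  have h3 : ∀ y, (LinearMap.ker ρ).subtype.rTensor Z y ∈ J • (⊤ : Submodule P (T ⊗[R] Z)) := by
    intro y
    induction y with
    | zero => simp
    | tmul k z =>
      obtain ⟨m, hm, hmk⟩ := (hJ k).1 k.2
      have : (k : T) ⊗ₜ[R] z = m • ((1 : T) ⊗ₜ z) := by
        rw [TensorProduct.smul_tmul', Algebra.smul_def, mul_one, hmk]
      rw [LinearMap.rTensor_tmul, Submodule.subtype_apply, this]
      exact Submodule.smul_mem_smul hm trivial
    | add a b ha hb => rw [map_add]; exact add_mem ha hb
  obtain ⟨y, rfl⟩ := (rTensor_exact Z ρ.exact_subtype_ker_map hκ _).1 h2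
  exact h3 y

/-- The periodicity step for base changes of modules which are flat over `B`. -/
theorem CliffordRoot.exists_map_baseChange_syzygy {B R L T P : Type u} [CommRing B] [CommRing R]
    [CommRing L] [CommRing T] [CommRing P] [Algebra B R] [Algebra B L] [Algebra B T]
    [Algebra R T] [Algebra L T] [IsScalarTower B R T] [IsScalarTower B L T]
    [Algebra.IsPushout B L R T] [Algebra P T] [SMulCommClass R P T]
    {s : P} {J : Ideal P}
    (hsurj : Function.Surjective (algebraMap P T))
    (hker : RingHom.ker (algebraMap P T) = Ideal.span {s})
    (hJ : ∀ x, s * x = 0 ↔ x ∈ J) (K : CliffordRoot J s)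
    {Z Z₁ Z₂ F₀ F₁ : Type u} [AddCommGroup Z] [Module R Z] [Module B Z] [IsScalarTower B R Z]
    [AddCommGroup Z₁] [Module R Z₁] [Module B Z₁] [IsScalarTower B R Z₁]
    [AddCommGroup Z₂] [Module R Z₂] [Module B Z₂] [IsScalarTower B R Z₂]
    [AddCommGroup F₀] [Module R F₀] [Module B F₀] [IsScalarTower B R F₀] [Module.Free R F₀]
    [AddCommGroup F₁] [Module R F₁] [Module B F₁] [IsScalarTower B R F₁] [Module.Free R F₁]
    [Module.Flat B Z] [Module.Flat B Z₁]
    {i₁ : Z₁ →ₗ[R] F₀} {p₀ : F₀ →ₗ[R] Z} {i₂ : Z₂ →ₗ[R] F₁} {p₁ : F₁ →ₗ[R] Z₁}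
    (hi₁ : Function.Injective i₁) (hp₀ : Function.Surjective p₀) (hex₀ : Function.Exact i₁ p₀)
    (hi₂ : Function.Injective i₂) (hp₁ : Function.Surjective p₁) (hex₁ : Function.Exact i₂ p₁)
    (g : K.V →ₗ[P] T ⊗[R] Z) (hg : ∀ v, g (K.δ v) = 0) :
    ∃ g₂ : K.V →ₗ[P] T ⊗[R] Z₂,
      (∀ v, g₂ (K.δ v) = 0) ∧
      (∀ v, i₂.lTensor T (g₂ v) ∈ J • (⊤ : Submodule P (T ⊗[R] F₁))) ∧
      (∀ v, g₂ v ∈ J • (⊤ : Submodule P (T ⊗[R] Z₂)) →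
        g v ∈ J • (⊤ : Submodule P (T ⊗[R] Z))) := by
  have hj₁ : Function.Injective (i₁.baseChange T) :=
    LinearMap.baseChange_injective_of_flat_of_isPushout (B := B) (L := L) hi₁ hp₀ hex₀
  have hj₂ : Function.Injective (i₂.baseChange T) :=
    LinearMap.baseChange_injective_of_flat_of_isPushout (B := B) (L := L) hi₂ hp₁ hex₁
  let j₁ : T ⊗[R] Z₁ →ₗ[P] T ⊗[R] F₀ := (i₁.baseChange T).restrictScalars P
  let q₁ : T ⊗[R] F₁ →ₗ[P] T ⊗[R] Z₁ := (p₁.baseChange T).restrictScalars P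
  let j₂ : T ⊗[R] Z₂ →ₗ[P] T ⊗[R] F₁ := (i₂.baseChange T).restrictScalars P
  let q₀ : T ⊗[R] F₀ →ₗ[P] T ⊗[R] Z := (p₀.baseChange T).restrictScalars P
  have hq₁ : Function.Surjective q₁ := LinearMap.lTensor_surjective T hp₁
  have e₁ : Function.Exact j₂ q₁ := lTensor_exact T hex₁ hp₁
  have e₀ : Function.Exact j₁ q₀ := lTensor_exact T hex₀ hp₀
  have hex : Function.Exact (j₁ ∘ₗ q₁) q₀ := by
    rw [LinearMap.exact_iff, LinearMap.range_comp_of_range_eq_top _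
      (LinearMap.range_eq_top.2 hq₁)]
    exact (LinearMap.exact_iff.1 e₀)
  obtain ⟨g₂, h1, h2, h3, h4⟩ := K.exists_map_syzygy hsurj hker hJ (T ⊗[R] Z)
    (T ⊗[R] F₀) (T ⊗[R] F₁) q₀ (j₁ ∘ₗ q₁) (LinearMap.lTensor_surjective T hp₀) hex g hg
  have h1' (v) : ∃ z, j₂ z = g₂ v := by
    refine (e₁ (g₂ v)).1 (hj₁ ?_)
    rw [map_zero]
    exact h1 v
  obtain ⟨k, hk⟩ := LinearMap.exists_comp_eq_of_projective _ g₂ h1'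
  refine ⟨k, fun v ↦ hj₂ ?_, fun v ↦ ?_, fun v hv ↦ h4 v ?_⟩
  · rw [map_zero, ← h2 v]
    exact hk _
  · have := h3 v
    rw [← hk] at this
    exact this
  · rw [← hk]
    have := Submodule.mem_map_of_mem (f := j₂) hv
    rw [Submodule.map_smul''] at this
    refine Submodule.smul_mono le_rfl ?_ this
    rintro _ ⟨x, -, rfl⟩
    rw [LinearMap.mem_ker, LinearMap.comp_apply, e₁.apply_apply_eq_zero, map_zero]

/-- Every module over a flat `B`-algebra `R` which is flat over `B` is the quotient of a free
`R`-module by a module which is flat over `B`. -/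
theorem Module.Flat.exists_free_presentation (B R : Type u) [CommRing B] [CommRing R]
    [Algebra B R] [Module.Flat B R] (Z : Type u) [AddCommGroup Z] [Module R Z] [Module B Z]
    [IsScalarTower B R Z] [Module.Flat B Z] :
    ∃ (F Z₁ : Type u) (_ : AddCommGroup F) (_ : Module R F) (_ : Module B F)
      (_ : IsScalarTower B R F) (_ : AddCommGroup Z₁) (_ : Module R Z₁) (_ : Module B Z₁)
      (_ : IsScalarTower B R Z₁) (i : Z₁ →ₗ[R] F) (p : F →ₗ[R] Z), Module.Free R F ∧
      Module.Flat B Z₁ ∧ Function.Injective i ∧ Function.Surjective p ∧ Function.Exact i p := by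
  let p := Finsupp.linearCombination R (id : Z → Z)
  have hp : Function.Surjective p := Finsupp.linearCombination_id_surjective R Z
  have : Module.Flat B (Z →₀ R) := Module.Flat.trans B R _
  exact ⟨Z →₀ R, LinearMap.ker p, inferInstance, inferInstance, inferInstance, inferInstance,
    inferInstance, inferInstance, inferInstance, inferInstance, (LinearMap.ker p).subtype, p,
    inferInstance, Module.Flat.ker_of_surjective p hp, Subtype.val_injective, hp,
    p.exact_subtype_ker_map⟩

/-- If `Z ⊗ X` is exact in high degrees, where `X` is a flat resolution of the residue ring `κ`,
then maps from a Clifford root to the base change of `Z` vanish modulo `J`. -/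
theorem CliffordRoot.map_mem_smul_top_of_exact {B R L T P κ : Type u} [CommRing B] [CommRing R]
    [CommRing L] [CommRing T] [CommRing P] [CommRing κ] [Algebra B R] [Algebra B L] [Algebra B T]
    [Algebra R T] [Algebra L T] [IsScalarTower B R T] [IsScalarTower B L T]
    [Algebra.IsPushout B L R T] [Module.Flat B R] [Algebra P T] [SMulCommClass R P T]
    [Algebra T κ] [Algebra R κ] [IsScalarTower R T κ] {s : P} {J : Ideal P}
    (hsurj : Function.Surjective (algebraMap P T))
    (hker : RingHom.ker (algebraMap P T) = Ideal.span {s})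
    (hJ : ∀ x, s * x = 0 ↔ x ∈ J) (hκ : Function.Surjective (algebraMap T κ))
    (hJκ : ∀ t, algebraMap T κ t = 0 ↔ ∃ m ∈ J, algebraMap P T m = t)
    (K : CliffordRoot J s) {X : ℕ → Type u} [∀ n, AddCommGroup (X n)] [∀ n, Module R (X n)]
    [∀ n, Module.Flat R (X n)] (d : ∀ n, X (n + 1) →ₗ[R] X n) (ε : X 0 →ₗ[R] κ)
    (hd : ∀ n, Function.Exact (d (n + 1)) (d n)) (hdε : Function.Exact (d 0) ε)
    (hε : Function.Surjective ε) (j : ℕ) (Z : Type u) [AddCommGroup Z] [Module R Z] [Module B Z]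
    [IsScalarTower B R Z] [Module.Flat B Z]
    (hZ : ∀ n ≥ j, Function.Exact ((d (n + 2)).lTensor Z) ((d (n + 1)).lTensor Z))
    (g : K.V →ₗ[P] T ⊗[R] Z) (hg : ∀ v, g (K.δ v) = 0) :
    g K.e ∈ J • (⊤ : Submodule P (T ⊗[R] Z)) := by
  have hshift {Z F Z₁ : Type u} [AddCommGroup Z] [Module R Z] [AddCommGroup F] [Module R F]
      [AddCommGroup Z₁] [Module R Z₁] [Module.Free R F] {i : Z₁ →ₗ[R] F} {p : F →ₗ[R] Z}
      (hi : Function.Injective i) (hp : Function.Surjective p) (hip : Function.Exact i p) (n : ℕ)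
      (h : Function.Exact ((d (n + 2)).lTensor Z) ((d (n + 1)).lTensor Z)) :
      Function.Exact ((d (n + 1)).lTensor Z₁) ((d n).lTensor Z₁) :=
    Function.Exact.lTensor_syzygy hi hp hip (hd n) (hd (n + 1)).linearMap_comp_eq_zero h
  induction j generalizing Z with
  | zero =>
    obtain ⟨F₀, Z₁, _, _, _, _, _, _, _, _, i₁, p₀, _, _, hi₁, hp₀, hex₀⟩ :=
      Module.Flat.exists_free_presentation B R Z
    obtain ⟨F₁, Z₂, _, _, _, _, _, _, _, _, i₂, p₁, _, _, hi₂, hp₁, hex₁⟩ :=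
      Module.Flat.exists_free_presentation B R Z₁
    obtain ⟨g₂, -, h2, h3⟩ := K.exists_map_baseChange_syzygy (B := B) (L := L) hsurj hker hJ
      hi₁ hp₀ hex₀ hi₂ hp₁ hex₁ g hg
    refine h3 _ (Submodule.mem_smul_top_of_rTensor_injective hκ hJκ i₂ ?_ _ (h2 _))
    rw [LinearMap.lTensor_inj_iff_rTensor_inj]
    exact LinearMap.rTensor_injective_of_exact_lTensor hi₂ hp₁ hex₁ hε hdε
      (hd 0).linearMap_comp_eq_zero (hshift hi₁ hp₀ hex₀ 0 (hZ 0 le_rfl))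
  | succ j ih =>
    obtain ⟨F₀, Z₁, _, _, _, _, _, _, _, _, i₁, p₀, _, _, hi₁, hp₀, hex₀⟩ :=
      Module.Flat.exists_free_presentation B R Z
    obtain ⟨F₁, Z₂, _, _, _, _, _, _, _, _, i₂, p₁, _, _, hi₂, hp₁, hex₁⟩ :=
      Module.Flat.exists_free_presentation B R Z₁
    obtain ⟨g₂, h1, -, h3⟩ := K.exists_map_baseChange_syzygy (B := B) (L := L) hsurj hker hJ
      hi₁ hp₀ hex₀ hi₂ hp₁ hex₁ g hg
    exact h3 _ (ih _ (fun n hn ↦ hshift hi₂ hp₁ hex₁ _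
      (hshift hi₁ hp₀ hex₀ _ (hZ (n + 2) (by lia)))) g₂ h1)

/-- A module admits a projective resolution, which in the degrees where `Tor` vanishes remains
exact after tensoring. -/
theorem exists_flat_resolution_of_isZero_tor {R : Type u} [CommRing R] (Z N : Type u)
    [AddCommGroup Z] [Module R Z] [AddCommGroup N] [Module R N] (j : ℕ)
    (h : ∀ n, j ≤ n → IsZero (((Tor (ModuleCat.{u} R) n).obj (ModuleCat.of R Z)).obj
      (ModuleCat.of R N))) :
    ∃ (X : ℕ → Type u) (_ : ∀ n, AddCommGroup (X n)) (_ : ∀ n, Module R (X n))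
      (d : ∀ n, X (n + 1) →ₗ[R] X n) (ε : X 0 →ₗ[R] N), (∀ n, Module.Flat R (X n)) ∧
      Function.Surjective ε ∧ Function.Exact (d 0) ε ∧
      (∀ n, Function.Exact (d (n + 1)) (d n)) ∧
      ∀ n ≥ j, Function.Exact ((d (n + 2)).lTensor Z) ((d (n + 1)).lTensor Z) := by
  let Pr := projectiveResolution (ModuleCat.of R N)
  refine ⟨fun n ↦ Pr.complex.X n, fun _ ↦ inferInstance, fun _ ↦ inferInstance,
    fun n ↦ (Pr.complex.d (n + 1) n).hom, (Pr.π.f 0).hom, fun n ↦ ?_, ?_, ?_, fun n ↦ ?_,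
    fun n hn ↦ ?_⟩
  · have : Module.Projective R (Pr.complex.X n) :=
      (IsProjective.iff_projective _).2 (Pr.projective n)
    infer_instance
  · exact (ModuleCat.epi_iff_surjective (Pr.π.f 0)).1 inferInstance
  · exact (ShortComplex.ShortExact.moduleCat_exact_iff_function_exact _).1 Pr.exact₀
  · exact (ShortComplex.ShortExact.moduleCat_exact_iff_function_exact _).1 (Pr.exact_succ n)
  · have h1 := (h (n + 2) (by lia)).of_iso (Pr.isoLeftDerivedObj
      ((MonoidalCategory.tensoringLeft (ModuleCat.{u} R)).obj (ModuleCat.of R Z)) (n + 2)).symm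
    have h2 := (HomologicalComplex.exactAt_iff_isZero_homology _ _).2 h1
    rw [HomologicalComplex.exactAt_iff' _ (n + 3) (n + 2) (n + 1) (by simp) (by simp)] at h2
    exact (ShortComplex.ShortExact.moduleCat_exact_iff_function_exact _).1 h2

/-- The augmentation `κ ⊗ B → κ` of a `B`-algebra `κ`. -/
noncomputable def Algebra.TensorProduct.augmentation (A B κ : Type*) [CommRing A] [CommRing B]
    [CommRing κ] [Algebra A B] [Algebra B κ] [Algebra A κ] [IsScalarTower A B κ] :
    κ ⊗[A] B →ₐ[κ] κ :=
  Algebra.TensorProduct.lift (AlgHom.id κ κ) (IsScalarTower.toAlgHom A B κ)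
    fun _ _ ↦ Commute.all _ _

@[simp]
theorem Algebra.TensorProduct.augmentation_tmul (A : Type*) {B κ : Type*} [CommRing A] [CommRing B]
    [CommRing κ] [Algebra A B] [Algebra B κ] [Algebra A κ] [IsScalarTower A B κ] (k : κ) (b : B) :
    augmentation A B κ (k ⊗ₜ b) = k * algebraMap B κ b := by
  simp [augmentation]

/-- The base change `κ ⊗ B` is a pushout of `κ` and `B ⊗ B`, for a `B`-algebra `κ`. -/
theorem Algebra.TensorProduct.exists_isPushout_ringEquiv (A B κ : Type u) [CommRing A]
    [CommRing B] [CommRing κ] [Algebra A B] [Algebra B κ] [Algebra A κ] [IsScalarTower A B κ] :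
    ∃ (T : Type u) (_ : CommRing T) (_ : Algebra B T) (_ : Algebra κ T) (_ : Algebra (B ⊗[A] B) T)
      (_ : IsScalarTower B κ T) (_ : IsScalarTower B (B ⊗[A] B) T) (e : T ≃+* κ ⊗[A] B),
      Algebra.IsPushout B κ (B ⊗[A] B) T ∧ (∀ k, e (algebraMap κ T k) = k ⊗ₜ 1) ∧
      ∀ b b', e (algebraMap (B ⊗[A] B) T (b ⊗ₜ b')) = algebraMap B κ b ⊗ₜ b' := by
  let : Algebra (B ⊗[A] B) (κ ⊗[B] (B ⊗[A] B)) := Algebra.TensorProduct.rightAlgebra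
  refine ⟨κ ⊗[B] (B ⊗[A] B), inferInstance, inferInstance, inferInstance,
    Algebra.TensorProduct.rightAlgebra, inferInstance, inferInstance,
    (Algebra.TensorProduct.cancelBaseChange A B κ κ B).toRingEquiv, inferInstance,
    fun k ↦ ?_, fun b b' ↦ ?_⟩
  · exact (Algebra.TensorProduct.cancelBaseChange A B κ κ B).commutes k
  · change Algebra.TensorProduct.cancelBaseChange A B κ κ B (1 ⊗ₜ (b ⊗ₜ b')) = _
    rw [Algebra.TensorProduct.cancelBaseChange_tmul, Algebra.smul_def, mul_one]

/-- If `B` has finite flat dimension over `B ⊗ B`, there is no surjection `π : P → κ ⊗ B` with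
kernel generated by an element `s` whose annihilator `J` is the preimage of the augmentation ideal,
and such that `s ∈ J²`. -/
theorem not_mem_sq_of_isZero_tor {A B κ P : Type u} [CommRing A] [CommRing B] [Field κ]
    [CommRing P] [Algebra A B] [Module.Flat A B] [Algebra B κ] [Algebra A κ] [IsScalarTower A B κ]
    (hfd : letI : Algebra (B ⊗[A] B) B :=
        (Algebra.TensorProduct.lmul' (S := B) A).toRingHom.toAlgebra
      ∃ d : ℕ, ∀ n : ℕ, d ≤ n →
        ∀ (M : Type u) [AddCommGroup M] [Module (B ⊗[A] B) M],
          IsZero (((Tor (ModuleCat.{u} (B ⊗[A] B)) n).obj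
            (ModuleCat.of _ B)).obj (ModuleCat.of _ M)))
    (π : P →+* κ ⊗[A] B) (hπ : Function.Surjective π) {s : P}
    (hker : RingHom.ker π = Ideal.span {s})
    (hann : ∀ x, s * x = 0 ↔ Algebra.TensorProduct.augmentation A B κ (π x) = 0) :
    s ∉ RingHom.ker ((Algebra.TensorProduct.augmentation A B κ).toRingHom.comp π) ^ 2 := by
  intro hs
  let aug := Algebra.TensorProduct.augmentation A B κ
  obtain ⟨T, _, _, _, _, _, _, e, _, heκ, he⟩ :=
    Algebra.TensorProduct.exists_isPushout_ringEquiv A B κ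
  let : Algebra (B ⊗[A] B) B := (Algebra.TensorProduct.lmul' (S := B) A).toRingHom.toAlgebra
  let : Algebra (B ⊗[A] B) κ :=
    ((algebraMap B κ).comp (algebraMap (B ⊗[A] B) B)).toAlgebra
  let : Algebra T κ := (aug.toRingHom.comp e.toRingHom).toAlgebra
  let : Algebra P T := (e.symm.toRingHom.comp π).toAlgebra
  have hlmul (b b' : B) : algebraMap (B ⊗[A] B) B (b ⊗ₜ b') = b * b' := by
    simp [RingHom.algebraMap_toAlgebra]
  have hPT (x : P) : algebraMap P T x = e.symm (π x) := rfl
  have hTκ (t : T) : algebraMap T κ t = aug (e t) := rfl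
  have : IsScalarTower B (B ⊗[A] B) B := .of_algebraMap_eq fun b ↦ by
    rw [Algebra.TensorProduct.algebraMap_apply, hlmul]; simp
  have : IsScalarTower (B ⊗[A] B) B κ := .of_algebraMap_eq fun _ ↦ rfl
  have : IsScalarTower (B ⊗[A] B) T κ := .of_algebraMap_eq fun r ↦ by
    rw [hTκ, IsScalarTower.algebraMap_apply (B ⊗[A] B) B κ]
    induction r with
    | zero => simp
    | add x y hx hy => simp only [map_add, hx, hy]
    | tmul b b' => rw [hlmul, he, Algebra.TensorProduct.augmentation_tmul, map_mul]
  have : SMulCommClass (B ⊗[A] B) P T := ⟨fun r p t ↦ by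
    simp only [Algebra.smul_def, mul_left_comm]⟩
  let J := RingHom.ker (aug.toRingHom.comp π)
  obtain ⟨K⟩ := CliffordRoot.nonempty_of_mem_sq (J := J) hs
  obtain ⟨j, hj⟩ := hfd
  obtain ⟨X, _, _, d, ε, _, hε, hdε, hd, hj⟩ :=
    exists_flat_resolution_of_isZero_tor B κ j fun n hn ↦ hj n hn κ
  have hone (z : κ ⊗[A] B) : e.symm z ⊗ₜ[B ⊗[A] B] (1 : B) =
      algebraMap κ T (aug z) ⊗ₜ[B ⊗[A] B] (1 : B) := by
    induction z with
    | zero => simp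
    | add x y hx hy => rw [map_add, add_tmul, hx, hy, map_add, map_add, add_tmul]
    | tmul k b =>
      have h1 : e.symm (k ⊗ₜ b) = ((1 : B) ⊗ₜ[A] b) • algebraMap κ T k := by
        rw [RingEquiv.symm_apply_eq, Algebra.smul_def, map_mul, heκ, he]
        simp
      have h2 : ((1 : B) ⊗ₜ[A] b) • (1 : B) = algebraMap B (B ⊗[A] B) b • (1 : B) := by
        rw [Algebra.smul_def, Algebra.smul_def, Algebra.TensorProduct.algebraMap_apply, hlmul,
          hlmul]
        simp
      rw [h1, TensorProduct.smul_tmul, h2, ← TensorProduct.smul_tmul, algebraMap_smul,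
        Algebra.TensorProduct.augmentation_tmul, map_mul, ← IsScalarTower.algebraMap_apply,
        Algebra.smul_def, mul_comm]
  have hzero (m : P) (hm : m ∈ J) (x : T ⊗[B ⊗[A] B] B) : m • x = 0 := by
    induction x with
    | zero => simp
    | add x y hx hy => rw [smul_add, hx, hy, add_zero]
    | tmul t b =>
      have h2 : b = (b ⊗ₜ[A] (1 : B)) • (1 : B) := by
        rw [Algebra.smul_def, hlmul]; simp
      have h3 : aug (π m) = 0 := hm
      obtain ⟨z, hz⟩ := e.symm.surjective ((b ⊗ₜ[A] (1 : B)) • t)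
      rw [h2, ← TensorProduct.smul_tmul, TensorProduct.smul_tmul', Algebra.smul_def, ← hz, hPT,
        ← map_mul, hone, map_mul, h3, zero_mul, map_zero, zero_tmul]
  have key := K.map_mem_smul_top_of_exact (L := κ) (B := B) (κ := κ)
    (e.symm.surjective.comp hπ) (T := T)
    (by
      rw [← hker]
      ext x
      rw [RingHom.mem_ker, RingHom.mem_ker, hPT, map_eq_zero_iff _ e.symm.injective])
    hann (fun k ↦ ⟨algebraMap κ T k, by rw [hTκ, heκ]; simp [aug]⟩)
    (fun t ↦ by
      constructor
      · intro ht
        obtain ⟨m, hm⟩ := hπ (e t)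
        refine ⟨m, ?_, by rw [hPT, hm, RingEquiv.symm_apply_apply]⟩
        change aug (π m) = 0
        rw [hm]
        exact ht
      · rintro ⟨m, hm, rfl⟩
        rw [hPT, hTκ, RingEquiv.apply_symm_apply]
        exact hm)
    d ε hd hdε hε j B hj
    (K.functional.smulRight ((1 : T) ⊗ₜ[B ⊗[A] B] (1 : B)))
    (fun v ↦ by
      rw [LinearMap.smulRight_apply]
      exact hzero _ (K.functional_δ_mem v) _)
  have hbot : J • (⊤ : Submodule P (T ⊗[B ⊗[A] B] B)) = ⊥ :=
    le_bot_iff.1 (Submodule.smul_le.2 fun m hm x _ ↦ by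
      rw [hzero m hm x]; exact zero_mem _)
  rw [hbot, Submodule.mem_bot, LinearMap.smulRight_apply, K.functional_e, one_smul] at key
  have h := congrArg (Algebra.TensorProduct.productMap
    (IsScalarTower.toAlgHom (B ⊗[A] B) T κ) (IsScalarTower.toAlgHom (B ⊗[A] B) B κ)) key
  simp at h

/-- If `B` has finite flat dimension over `B ⊗ B`, then every `κ`-valued functional on the kernel
of a surjection onto `κ ⊗ B` vanishes on the square of the augmentation ideal. -/
theorem eq_zero_of_mem_sq_of_isZero_tor {A B κ P : Type u} [CommRing A] [CommRing B] [Field κ]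
    [CommRing P] [Algebra A B] [Module.Flat A B] [Algebra B κ] [Algebra A κ] [IsScalarTower A B κ]
    (hfd : letI : Algebra (B ⊗[A] B) B :=
        (Algebra.TensorProduct.lmul' (S := B) A).toRingHom.toAlgebra
      ∃ d : ℕ, ∀ n : ℕ, d ≤ n →
        ∀ (M : Type u) [AddCommGroup M] [Module (B ⊗[A] B) M],
          IsZero (((Tor (ModuleCat.{u} (B ⊗[A] B)) n).obj
            (ModuleCat.of _ B)).obj (ModuleCat.of _ M)))
    (π : P →+* κ ⊗[A] B) (hπ : Function.Surjective π) (f : RingHom.ker π →+ κ)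
    (hf : ∀ x i, f (x • i) = Algebra.TensorProduct.augmentation A B κ (π x) * f i)
    (s : RingHom.ker π)
    (hs : (s : P) ∈ RingHom.ker ((Algebra.TensorProduct.augmentation A B κ).toRingHom.comp π) ^ 2) :
    f s = 0 := by
  by_contra hfs
  let aug := Algebra.TensorProduct.augmentation A B κ
  let I : Ideal P :=
    { carrier := {x | ∃ h : x ∈ RingHom.ker π, f ⟨x, h⟩ = 0}
      zero_mem' := ⟨zero_mem _, map_zero f⟩
      add_mem' := by
        rintro x y ⟨hx, hx'⟩ ⟨hy, hy'⟩
        refine ⟨add_mem hx hy, ?_⟩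
        have := map_add f ⟨x, hx⟩ ⟨y, hy⟩
        rwa [hx', hy', add_zero] at this
      smul_mem' := by
        rintro c x ⟨hx, hx'⟩
        refine ⟨Ideal.mul_mem_left _ c hx, ?_⟩
        have := hf c ⟨x, hx⟩
        rwa [hx', mul_zero] at this }
  let π' : P ⧸ I →+* κ ⊗[A] B := Ideal.Quotient.lift I π fun x hx ↦ hx.1
  have hmk (x : P) : π' (Ideal.Quotient.mk I x) = π x := rfl
  have hπ' : Function.Surjective π' := Ideal.Quotient.lift_surjective_of_surjective _ _ hπ
  have hπs : π s = 0 := s.2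
  have hker : RingHom.ker π' = Ideal.span {Ideal.Quotient.mk I (s : P)} := by
    refine le_antisymm (fun x hx ↦ ?_) ?_
    · obtain ⟨x, rfl⟩ := Ideal.Quotient.mk_surjective x
      have hx' : x ∈ RingHom.ker π := hx
      obtain ⟨y, hy⟩ := hπ ((f ⟨x, hx'⟩ / f s) ⊗ₜ 1)
      rw [Ideal.mem_span_singleton]
      refine ⟨Ideal.Quotient.mk I y, ?_⟩
      rw [mul_comm, ← map_mul, Ideal.Quotient.eq]
      refine ⟨sub_mem hx' (Ideal.mul_mem_left _ _ s.2), ?_⟩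
      have := map_sub f ⟨x, hx'⟩ (y • s)
      rw [hf, hy, Algebra.TensorProduct.augmentation_tmul, map_one, mul_one,
        div_mul_cancel₀ _ hfs, sub_self] at this
      exact this
    · rw [Ideal.span_singleton_le_iff_mem]
      exact hπs
  refine not_mem_sq_of_isZero_tor hfd π' hπ' hker (fun x ↦ ?_) ?_
  · obtain ⟨x, rfl⟩ := Ideal.Quotient.mk_surjective x
    rw [← map_mul, Ideal.Quotient.eq_zero_iff_mem, hmk, mul_comm]
    constructor
    · rintro ⟨h, h'⟩
      have := hf x s
      exact (mul_eq_zero.1 (this.symm.trans h')).resolve_right hfs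
    · intro h
      refine ⟨Ideal.mul_mem_left _ _ s.2, ?_⟩
      have := hf x s
      rw [h, zero_mul] at this
      exact this
  · have := Ideal.mem_map_of_mem (Ideal.Quotient.mk I) hs
    rw [Ideal.map_pow] at this
    refine Ideal.pow_right_mono (Ideal.map_le_iff_le_comap.2 fun x hx ↦ ?_) 2 this
    exact hx

/-- A semilinear map on an ideal which vanishes on the square of the augmentation ideal extends to a
derivation. -/
theorem exists_extension_leibniz {κ P M : Type*} [Field κ] [CommRing P] [Algebra κ P]
    [AddCommGroup M] [Module κ M] (ε : P →ₐ[κ] κ) (I : Submodule κ P)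
    (hI : ∀ x ∈ I, ε x = 0) (ψ : I →ₗ[κ] M)
    (hψ : ∀ x : I, (x : P) ∈ RingHom.ker ε ^ 2 → ψ x = 0) :
    ∃ D : P →ₗ[κ] M, (∀ x : I, D x = ψ x) ∧ ∀ x y, D (x * y) = ε x • D y + ε y • D x := by
  let N : Submodule κ P := (RingHom.ker ε ^ 2).restrictScalars κ
  have hIN (x : I) (y : N) (hxy : (x : P) = y) : ψ x = (0 : N →ₗ[κ] M) y :=
    hψ x (by rw [hxy]; exact y.2)
  let F : P →ₗ.[κ] M := LinearPMap.sup ⟨I, ψ⟩ ⟨N, 0⟩ hIN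
  obtain ⟨G, hG⟩ := F.toFun.exists_extend
  have hGI (x : I) : G x = ψ x := by
    have h1 := (LinearPMap.left_le_sup ⟨I, ψ⟩ ⟨N, 0⟩ hIN).2 (x := x)
      (y := ⟨x, Submodule.mem_sup_left x.2⟩) rfl
    exact (LinearMap.congr_fun hG ⟨x, Submodule.mem_sup_left x.2⟩).trans h1.symm
  have hGN (x : P) (hx : x ∈ N) : G x = 0 := by
    have h1 := (LinearPMap.right_le_sup ⟨I, ψ⟩ ⟨N, 0⟩ hIN).2 (x := ⟨x, hx⟩)
      (y := ⟨x, Submodule.mem_sup_right hx⟩) rfl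
    exact (LinearMap.congr_fun hG ⟨x, Submodule.mem_sup_right hx⟩).trans h1.symm
  have hD (x : P) : (G - (LinearMap.toSpanSingleton κ M (G 1)) ∘ₗ ε.toLinearMap) x =
      G (x - algebraMap κ P (ε x)) := by
    rw [map_sub, Algebra.algebraMap_eq_smul_one, map_smul]
    rfl
  refine ⟨G - (LinearMap.toSpanSingleton κ M (G 1)) ∘ₗ ε.toLinearMap, fun x ↦ ?_, fun x y ↦ ?_⟩
  · rw [hD, hI x x.2, map_zero, sub_zero, hGI]
  · have h1 : x * y - algebraMap κ P (ε (x * y)) = (x - algebraMap κ P (ε x)) *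
        (y - algebraMap κ P (ε y)) + ε x • (y - algebraMap κ P (ε y)) +
        ε y • (x - algebraMap κ P (ε x)) := by
      rw [map_mul, map_mul, Algebra.smul_def, Algebra.smul_def]
      ring
    rw [hD, hD, hD, h1, map_add, map_add, map_smul, map_smul, hGN, zero_add]
    change _ ∈ RingHom.ker ε ^ 2
    rw [pow_two]
    exact Ideal.mul_mem_mul (by simp [RingHom.mem_ker]) (by simp [RingHom.mem_ker])

/-- If `B` has finite flat dimension over `B ⊗ B`, then `A`-algebra maps from `B` lift along
square-zero extensions whose kernel is a vector space over a field under `B`. -/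
theorem exists_algHom_lift_of_isZero_tor {A B κ : Type u} {C : Type*} [CommRing A] [CommRing B]
    [Field κ] [CommRing C] [Algebra A B] [Module.Flat A B] [Algebra B κ] [Algebra A κ]
    [IsScalarTower A B κ] [Algebra A C]
    (hfd : letI : Algebra (B ⊗[A] B) B :=
        (Algebra.TensorProduct.lmul' (S := B) A).toRingHom.toAlgebra
      ∃ d : ℕ, ∀ n : ℕ, d ≤ n →
        ∀ (M : Type u) [AddCommGroup M] [Module (B ⊗[A] B) M],
          IsZero (((Tor (ModuleCat.{u} (B ⊗[A] B)) n).obj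
            (ModuleCat.of _ B)).obj (ModuleCat.of _ M)))
    (M : Ideal C) (hM : ∀ x ∈ M, ∀ y ∈ M, x * y = 0) [Module κ M] (f : B →ₐ[A] C ⧸ M)
    (hκ : ∀ c b, Ideal.Quotient.mk M c = f b → ∀ m : M, algebraMap B κ b • m = c • m) :
    ∃ g : B →ₐ[A] C, ∀ b, Ideal.Quotient.mk M (g b) = f b := by
  let ρ : MvPolynomial B A →ₐ[A] B := MvPolynomial.aeval id
  have hρ : Function.Surjective ρ := fun b ↦ ⟨MvPolynomial.X b, MvPolynomial.aeval_X _ _⟩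
  choose c hc using fun b ↦ Ideal.Quotient.mk_surjective (f b)
  let φ : MvPolynomial B A →ₐ[A] C := MvPolynomial.aeval c
  have hφ (p : MvPolynomial B A) : Ideal.Quotient.mk M (φ p) = f (ρ p) := by
    have : (Ideal.Quotient.mkₐ A M).comp φ = f.comp ρ :=
      MvPolynomial.algHom_ext fun b ↦ by simp [φ, ρ, hc]
    exact AlgHom.congr_fun this p
  have : IsScalarTower A κ M := .of_algebraMap_smul fun a m ↦ by
    rw [IsScalarTower.algebraMap_apply A B κ, hκ (algebraMap A C a) _ (f.commutes a).symm,
      algebraMap_smul]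
  let π : κ ⊗[A] MvPolynomial B A →ₐ[κ] κ ⊗[A] B := Algebra.TensorProduct.map (AlgHom.id κ κ) ρ
  have hπ : Function.Surjective π := LinearMap.lTensor_surjective κ (g := ρ.toLinearMap) hρ
  let K := LinearMap.ker ρ.toLinearMap
  let i := K.subtype.baseChange κ
  have hi : Function.Injective i :=
    LinearMap.lTensor_injective_of_exact_of_flat ρ.toLinearMap hρ K.subtype
      Subtype.val_injective ρ.toLinearMap.exact_subtype_ker_map κ
  have hmem (x) : π x = 0 ↔ x ∈ LinearMap.range i :=
    lTensor_exact κ ρ.toLinearMap.exact_subtype_ker_map hρ x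
  have hφK (x : K) : φ x ∈ M := by
    have hx : ρ x = 0 := x.2
    rw [← Ideal.Quotient.eq_zero_iff_mem, hφ, hx, map_zero]
  let φK : K →ₗ[A] M :=
    { toFun := fun x ↦ ⟨φ x, hφK x⟩
      map_add' := fun x y ↦ Subtype.ext (map_add φ x.1 y.1)
      map_smul' := fun a x ↦ Subtype.ext (map_smul φ a x.1) }
  let ψ₀ : κ ⊗[A] K →ₗ[κ] M := φK.liftBaseChange κ
  let ψ : LinearMap.range i →ₗ[κ] M := ψ₀ ∘ₗ (LinearEquiv.ofInjective i hi).symm.toLinearMap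
  have hψ (w : κ ⊗[A] K) (h : i w ∈ LinearMap.range i) : ψ ⟨i w, h⟩ = ψ₀ w :=
    congrArg ψ₀ ((LinearEquiv.symm_apply_eq _).2 rfl)
  let ε := (Algebra.TensorProduct.augmentation A B κ).comp π
  have hmul (x : κ ⊗[A] MvPolynomial B A) (w : κ ⊗[A] K) :
      ∃ w', i w' = x * i w ∧ ψ₀ w' = ε x • ψ₀ w := by
    induction x with
    | zero => exact ⟨0, by simp⟩
    | add x y hx hy =>
      obtain ⟨a, ha, ha'⟩ := hx
      obtain ⟨b, hb, hb'⟩ := hy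
      exact ⟨a + b, by rw [map_add, ha, hb, add_mul], by rw [map_add, ha', hb', map_add, add_smul]⟩
    | tmul k p =>
      induction w with
      | zero => exact ⟨0, by simp⟩
      | add x y hx hy =>
        obtain ⟨a, ha, ha'⟩ := hx
        obtain ⟨b, hb, hb'⟩ := hy
        exact ⟨a + b, by rw [map_add, ha, hb, map_add, mul_add],
          by rw [map_add, ha', hb', map_add, smul_add]⟩
      | tmul l y =>
        have hy : p * y ∈ K := by
          have : ρ y = 0 := y.2
          change ρ (p * y) = 0
          rw [map_mul, this, mul_zero]
        refine ⟨(k * l) ⊗ₜ ⟨p * y, hy⟩, by simp [i], ?_⟩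
        have h1 : ε (k ⊗ₜ p) = k * algebraMap B κ (ρ p) := by simp [ε, π]
        have h2 : φK ⟨p * y, hy⟩ = algebraMap B κ (ρ p) • φK y := by
          rw [hκ _ _ (hφ p)]
          exact Subtype.ext (map_mul φ p y)
        rw [h1, LinearMap.liftBaseChange_tmul, LinearMap.liftBaseChange_tmul, h2, smul_smul,
          smul_smul]
        congr 1
        ring
  obtain ⟨D, hD, hDmul⟩ := exists_extension_leibniz ε (LinearMap.range i)
    (fun x hx ↦ by
      change Algebra.TensorProduct.augmentation A B κ (π x) = 0
      rw [(hmem x).2 hx, map_zero]) ψ (fun x hx ↦ by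
    refine (Module.forall_dual_apply_eq_zero_iff κ (ψ x)).1 fun l ↦ ?_
    let L : RingHom.ker π.toRingHom →+ κ :=
      { toFun := fun y ↦ l (ψ ⟨y, (hmem _).1 y.2⟩)
        map_zero' := by
          rw [← map_zero l, ← map_zero ψ]
          rfl
        map_add' := fun y z ↦ by
          rw [← map_add, ← map_add]
          rfl }
    refine eq_zero_of_mem_sq_of_isZero_tor hfd π.toRingHom hπ L (fun y z ↦ ?_)
      ⟨x, (hmem _).2 x.2⟩ hx
    obtain ⟨w, hw⟩ := (hmem _).1 z.2
    obtain ⟨w', h1, h2⟩ := hmul y w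
    have h3 : L z = l (ψ₀ w) := by
      rw [← hψ w ⟨w, rfl⟩]
      exact congrArg (fun t ↦ l (ψ t)) (Subtype.ext hw.symm)
    have h4 : L (y • z) = l (ψ₀ w') := by
      rw [← hψ w' ⟨w', rfl⟩]
      exact congrArg (fun t ↦ l (ψ t)) (Subtype.ext ((congrArg (y * ·) hw.symm).trans h1.symm))
    rw [h3, h4, h2, map_smul]
    rfl)
  have hD1 : D 1 = 0 := by simpa using hDmul 1 1
  let Δ (p : MvPolynomial B A) : C := (D (1 ⊗ₜ p) : M)
  have hΔmem (p) : Δ p ∈ M := (D (1 ⊗ₜ p)).2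
  have hΔmul (p q) : Δ (p * q) = φ p * Δ q + φ q * Δ p := by
    have h1 (r) (m : M) : ε ((1 : κ) ⊗ₜ r) • m = φ r • m := by
      rw [← hκ _ _ (hφ r)]
      simp [ε, π]
    have h2 := hDmul (1 ⊗ₜ p) (1 ⊗ₜ q)
    rw [Algebra.TensorProduct.tmul_mul_tmul, mul_one, h1, h1] at h2
    exact congrArg Subtype.val h2
  have hΔalg (a) : Δ (algebraMap A _ a) = 0 := by
    have h1 : (1 : κ) ⊗ₜ[A] algebraMap A (MvPolynomial B A) a = algebraMap A κ a • 1 := by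
      rw [algebraMap_smul, Algebra.algebraMap_eq_smul_one, tmul_smul]
      rfl
    change ((D (1 ⊗ₜ[A] algebraMap A (MvPolynomial B A) a) : M) : C) = 0
    rw [h1, map_smul, hD1, smul_zero]
    rfl
  let θ : MvPolynomial B A →ₐ[A] C :=
    { toFun := fun p ↦ φ p - Δ p
      map_one' := by
        have := hΔalg 1
        rw [map_one] at this
        rw [map_one, this, sub_zero]
      map_zero' := by simp [Δ]
      map_add' := fun p q ↦ by
        simp only [Δ, tmul_add, map_add, Submodule.coe_add]
        ring
      map_mul' := fun p q ↦ by
        have := hM _ (hΔmem p) _ (hΔmem q)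
        rw [map_mul, hΔmul]
        linear_combination -this
      commutes' := fun a ↦ by rw [hΔalg, sub_zero, AlgHom.commutes] }
  have hθ (p) : Ideal.Quotient.mk M (θ p) = f (ρ p) := by
    rw [← hφ, Ideal.Quotient.eq]
    change φ p - Δ p - φ p ∈ M
    rw [sub_sub_cancel_left]
    exact neg_mem (hΔmem p)
  have hθK (p) (hp : ρ p = 0) : θ p = 0 := by
    have h1 := (hD ⟨i (1 ⊗ₜ ⟨p, hp⟩), ⟨_, rfl⟩⟩).trans (hψ (1 ⊗ₜ ⟨p, hp⟩) ⟨_, rfl⟩)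
    rw [LinearMap.liftBaseChange_tmul, one_smul] at h1
    exact sub_eq_zero.2 (congrArg Subtype.val h1).symm
  have hker : RingHom.ker ρ.toRingHom ≤ RingHom.ker θ.toRingHom := hθK
  refine ⟨AlgHom.liftOfSurjective ρ hρ θ hker, fun b ↦ ?_⟩
  obtain ⟨p, rfl⟩ := hρ b
  rw [AlgHom.liftOfSurjective_apply, hθ]

/-- If `B` has finite flat dimension over `B ⊗ B`, then ring homomorphisms under `A` from a
localization of `B` at a prime `q` lift along square-zero extensions with kernel killed by `q`. -/
theorem exists_ringHom_lift_localization_of_isZero_tor {A B : Type u} {C : Type*} [CommRing A]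
    [CommRing B] [CommRing C] [Algebra A B] [Module.Flat A B] [Algebra A C]
    (hfd : letI : Algebra (B ⊗[A] B) B :=
        (Algebra.TensorProduct.lmul' (S := B) A).toRingHom.toAlgebra
      ∃ d : ℕ, ∀ n : ℕ, d ≤ n →
        ∀ (M : Type u) [AddCommGroup M] [Module (B ⊗[A] B) M],
          IsZero (((Tor (ModuleCat.{u} (B ⊗[A] B)) n).obj
            (ModuleCat.of _ B)).obj (ModuleCat.of _ M)))
    (q : Ideal B) [q.IsPrime] (M : Ideal C) (hM : M ^ 2 = ⊥)
    (u : Localization.AtPrime q →+* C ⧸ M)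
    (huA : ∀ a, u (algebraMap B _ (algebraMap A B a)) = Ideal.Quotient.mk M (algebraMap A C a))
    (hu : ∀ c, Ideal.Quotient.mk M c ∈
      Ideal.map u (Ideal.map (algebraMap B (Localization.AtPrime q)) q) → ∀ m ∈ M, c * m = 0) :
    ∃ g : Localization.AtPrime q →+* C,
      (∀ a, g (algebraMap B _ (algebraMap A B a)) = algebraMap A C a) ∧
        (Ideal.Quotient.mk M).comp g = u := by
  have hM' : ∀ x ∈ M, ∀ y ∈ M, x * y = 0 := fun x hx y hy ↦ by
    have := Ideal.mul_mem_mul hx hy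
    rwa [← sq, hM, Ideal.mem_bot] at this
  have htors : Module.IsTorsionBySet C M M := fun m c ↦ Subtype.ext (hM' _ c.2 _ m.2)
  let _ : Module (C ⧸ M) M := htors.module
  let _ : Module (Localization.AtPrime q) M := Module.compHom M u
  have hsmul (c : C) (s : Localization.AtPrime q) (h : Ideal.Quotient.mk M c = u s) (m : M) :
      s • m = c • m := by
    change u s • m = c • m
    rw [← h]
    exact htors.mk_smul c m
  have htors' : Module.IsTorsionBySet (Localization.AtPrime q) M
      (IsLocalRing.maximalIdeal (Localization.AtPrime q)) := fun m s ↦ by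
    obtain ⟨c, hc⟩ := Ideal.Quotient.mk_surjective (u s)
    change (s : Localization.AtPrime q) • m = 0
    rw [hsmul c s hc]
    refine Subtype.ext (hu c ?_ m m.2)
    rw [hc, Localization.AtPrime.map_eq_maximalIdeal]
    exact Ideal.mem_map_of_mem u s.2
  let _ : Module (IsLocalRing.ResidueField (Localization.AtPrime q)) M := htors'.module
  let _ : Algebra B (IsLocalRing.ResidueField (Localization.AtPrime q)) :=
    ((IsLocalRing.residue _).comp (algebraMap B (Localization.AtPrime q))).toAlgebra
  let _ : Algebra A (IsLocalRing.ResidueField (Localization.AtPrime q)) :=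
    ((algebraMap B _).comp (algebraMap A B)).toAlgebra
  have : IsScalarTower A B (IsLocalRing.ResidueField (Localization.AtPrime q)) :=
    .of_algebraMap_eq fun _ ↦ rfl
  let f : B →ₐ[A] C ⧸ M :=
    { u.comp (algebraMap B (Localization.AtPrime q)) with commutes' := huA }
  obtain ⟨g, hg⟩ := exists_algHom_lift_of_isZero_tor
    (κ := IsLocalRing.ResidueField (Localization.AtPrime q)) hfd M hM' f fun c b h m ↦
      (htors'.mk_smul (algebraMap B _ b) m).trans (hsmul c _ h m)
  have hunit (y : q.primeCompl) : IsUnit (g.toRingHom y) := by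
    refine (IsNilpotent.isUnit_quotient_mk_iff (I := M) ⟨2, hM⟩).1 ?_
    change IsUnit (Ideal.Quotient.mk M (g y))
    rw [hg]
    exact (IsLocalization.map_units (Localization.AtPrime q) y).map u
  refine ⟨IsLocalization.lift (M := q.primeCompl) hunit, fun a ↦ ?_,
    IsLocalization.ringHom_ext q.primeCompl (RingHom.ext fun b ↦ ?_)⟩
  · rw [IsLocalization.lift_eq]
    exact g.commutes a
  · rw [RingHom.comp_apply, RingHom.comp_apply, IsLocalization.lift_eq]
    exact hg b

/-- **Rodicio's theorem, non-noetherian version.** If `f : A → B` is flat and `B` has finite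
flat dimension over `B ⊗_A B` (where `B` is a `B ⊗_A B`-module via the multiplication map
`μ : B ⊗_A B → B`), then `f` is discretely regular. -/
theorem flat_finite_flat_dimension_over_tensorSelf_discretelyRegular
    (A B : Type u) [CommRing A] [CommRing B] [Algebra A B] [Module.Flat A B]
    (hfd : letI : Algebra (B ⊗[A] B) B :=
        (Algebra.TensorProduct.lmul' (S := B) A).toRingHom.toAlgebra
      ∃ d : ℕ, ∀ n : ℕ, d ≤ n →
        ∀ (M : Type u) [AddCommGroup M] [Module (B ⊗[A] B) M],
          IsZero (((Tor (ModuleCat.{u} (B ⊗[A] B)) n).obj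
            (ModuleCat.of _ B)).obj (ModuleCat.of _ M))) :
    DiscretelyRegular A B := by
  refine ⟨inferInstance, ?_⟩
  intro q _
  let _ : Algebra A (Localization.AtPrime q) :=
    ((algebraMap B (Localization.AtPrime q)).comp (algebraMap A B)).toAlgebra
  intro C _ _ M hM u hu
  obtain ⟨g, hgA, hg⟩ := exists_ringHom_lift_localization_of_isZero_tor hfd q M hM u.toRingHom
    u.commutes fun c hc m hm ↦ by
      have := Ideal.mul_mem_mul (Ideal.mem_comap.2 hc) hm
      rwa [← Ideal.mem_bot, ← hu]
  exact ⟨{ g with commutes' := hgA }, DFunLike.ext _ _ (RingHom.congr_fun hg)⟩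
end

section
/- Let A be a commutative ring and let 𝔞 be an ideal of A that is flat as an A-module. Then 𝔞 is quasi-regular; explicitly: (a) 𝔞/𝔞² is a flat A/𝔞-module; (b) Tor_n^A(A/𝔞, A/𝔞) = 0 for all n ≥ 2; and (c) the n-th exterior power ⋀ⁿ_{A/𝔞}(𝔞/𝔞²) of the A/𝔞-module 𝔞/𝔞² is zero for all n ≥ 2. -/
open CategoryTheory CategoryTheory.Limits

universe u

open TensorProduct

/-- An injection with flat cokernel stays injective after tensoring with a quotient of a flat
module. -/
theorem Module.Flat.lTensor_injective_of_exact_of_exact {R : Type*} [CommRing R]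
    {K P F N L X : Type*} [AddCommGroup K] [AddCommGroup P] [AddCommGroup F]
    [AddCommGroup N] [AddCommGroup L] [AddCommGroup X]
    [Module R K] [Module R P] [Module R F] [Module R N] [Module R L] [Module R X]
    [Module.Flat R F] [Module.Flat R L] {f : K →ₗ[R] P} {g : P →ₗ[R] F}
    (hf : Function.Injective f) (hfg : Function.Exact f g) (hg : Function.Surjective g)
    {i : N →ₗ[R] L} {p : L →ₗ[R] X}
    (hi : Function.Injective i) (hip : Function.Exact i p) (hp : Function.Surjective p) :
    Function.Injective (f.lTensor X) := by
  rw [injective_iff_map_eq_zero]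
  intro x hx
  obtain ⟨y, rfl⟩ := LinearMap.rTensor_surjective K hp x
  have h₁ : p.rTensor P (f.lTensor L y) = 0 := by
    rw [← hx, ← LinearMap.comp_apply, ← LinearMap.comp_apply, LinearMap.rTensor_comp_lTensor,
      LinearMap.lTensor_comp_rTensor]
  obtain ⟨z, hz⟩ := (_root_.rTensor_exact P hip hp _).1 h₁
  have h₂ : i.rTensor F (g.lTensor N z) = 0 := by
    rw [← LinearMap.comp_apply, LinearMap.rTensor_comp_lTensor, ← LinearMap.lTensor_comp_rTensor,
      LinearMap.comp_apply, hz]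
    exact (_root_.lTensor_exact L hfg hg).apply_apply_eq_zero y
  have h₃ : g.lTensor N z = 0 :=
    (injective_iff_map_eq_zero _).1 (rTensor_preserves_injective_linearMap i hi) _ h₂
  obtain ⟨w, rfl⟩ := (_root_.lTensor_exact N hfg hg _).1 h₃
  have h₄ : i.rTensor K w = y := by
    apply lTensor_preserves_injective_linearMap (M := L) f hf
    rw [← hz, ← LinearMap.comp_apply, ← LinearMap.comp_apply, LinearMap.rTensor_comp_lTensor,
      LinearMap.lTensor_comp_rTensor]
  rw [← h₄]
  exact (_root_.rTensor_exact K hip hp).apply_apply_eq_zero w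

/-- An injection with flat cokernel stays injective after tensoring with any module. -/
theorem Module.Flat.lTensor_injective_of_exact {R : Type*} [CommRing R]
    {K P F : Type*} [AddCommGroup K] [AddCommGroup P] [AddCommGroup F]
    [Module R K] [Module R P] [Module R F] [Module.Flat R F] {f : K →ₗ[R] P} {g : P →ₗ[R] F}
    (hf : Function.Injective f) (hfg : Function.Exact f g) (hg : Function.Surjective g)
    (X : Type*) [AddCommGroup X] [Module R X] : Function.Injective (f.lTensor X) :=
  lTensor_injective_of_exact_of_exact hf hfg hg
    (LinearMap.ker (Finsupp.linearCombination R (id : X → X))).injective_subtype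
    (LinearMap.exact_subtype_ker_map _) (Finsupp.linearCombination_id_surjective R X)

/-- The kernel of a surjection between flat modules is flat. -/
theorem Module.Flat.of_exact_of_flat {R : Type*} [CommRing R]
    {K P F : Type*} [AddCommGroup K] [AddCommGroup P] [AddCommGroup F]
    [Module R K] [Module R P] [Module R F] [Module.Flat R P] [Module.Flat R F]
    {f : K →ₗ[R] P} {g : P →ₗ[R] F}
    (hf : Function.Injective f) (hfg : Function.Exact f g) (hg : Function.Surjective g) :
    Module.Flat R K := by
  rw [Module.Flat.iff_rTensor_injectiveₛ]
  intro Q _ _ N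
  let := Module.addCommMonoidToAddCommGroup R (M := Q)
  have h : Function.Injective (N.subtype.rTensor P ∘ₗ f.lTensor N) :=
    (Module.Flat.rTensor_preserves_injective_linearMap _ N.injective_subtype).comp
      (Module.Flat.lTensor_injective_of_exact hf hfg hg N)
  rw [LinearMap.rTensor_comp_lTensor, ← LinearMap.lTensor_comp_rTensor] at h
  exact Function.Injective.of_comp h

instance Module.Flat.prod {R M P : Type*} [CommRing R] [AddCommGroup M] [AddCommGroup P]
    [Module R M] [Module R P] [Module.Flat R M] [Module.Flat R P] : Module.Flat R (M × P) := by
  rw [Module.Flat.iff_rTensor_injectiveₛ]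
  intro Q _ _ N
  have h : (TensorProduct.prodRight R R Q M P).toLinearMap ∘ₗ N.subtype.rTensor (M × P) =
      ((N.subtype.rTensor M).prodMap (N.subtype.rTensor P)) ∘ₗ
        (TensorProduct.prodRight R R N M P).toLinearMap := by
    ext <;> simp
  refine Function.Injective.of_comp (f := TensorProduct.prodRight R R Q M P) ?_
  rw [← LinearEquiv.coe_toLinearMap, ← LinearMap.coe_comp, h, LinearMap.coe_comp]
  exact (Function.Injective.prodMap
    (Module.Flat.rTensor_preserves_injective_linearMap _ N.injective_subtype)
    (Module.Flat.rTensor_preserves_injective_linearMap _ N.injective_subtype)).comp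
    (LinearEquiv.injective _)

/-- Whether the first syzygy of a module is flat does not depend on the projective module chosen
to compute it. -/
theorem Module.Flat.ker_of_projective {R : Type*} [CommRing R]
    {P P' M : Type*} [AddCommGroup P] [AddCommGroup P'] [AddCommGroup M]
    [Module R P] [Module R P'] [Module R M] [Module.Projective R P] [Module.Projective R P']
    {q : P →ₗ[R] M} {q' : P' →ₗ[R] M} (hq : Function.Surjective q) (hq' : Function.Surjective q')
    [Module.Flat R (LinearMap.ker q')] : Module.Flat R (LinearMap.ker q) := by
  obtain ⟨s, hs⟩ := Module.projective_lifting_property q q' hq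
  obtain ⟨t, ht⟩ := Module.projective_lifting_property q' q hq'
  replace hs x : q (s x) = q' x := congr($hs x)
  replace ht x : q' (t x) = q x := congr($ht x)
  refine Module.Flat.of_retract (M := LinearMap.ker q' × P)
    (((t ∘ₗ (LinearMap.ker q).subtype).codRestrict (LinearMap.ker q')
      fun x ↦ by simp [ht]).prod (LinearMap.ker q).subtype)
    (((s ∘ₗ (LinearMap.ker q').subtype).coprod (LinearMap.id - s ∘ₗ t)).codRestrict
      (LinearMap.ker q) fun x ↦ by simp [hs, ht]) ?_
  refine LinearMap.ext fun x ↦ Subtype.ext ?_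
  exact add_sub_cancel (s (t x)) (x : P)

/-- Tensoring preserves exactness at a term whose outgoing differential has flat cokernel. -/
theorem Function.Exact.lTensor_of_flat_range {R : Type*} [CommRing R]
    {P₃ P₂ P₁ P₀ : Type*} [AddCommGroup P₃] [AddCommGroup P₂] [AddCommGroup P₁] [AddCommGroup P₀]
    [Module R P₃] [Module R P₂] [Module R P₁] [Module R P₀]
    {f : P₃ →ₗ[R] P₂} {g : P₂ →ₗ[R] P₁} {h : P₁ →ₗ[R] P₀}
    (hfg : Function.Exact f g) (hgh : Function.Exact g h) [Module.Flat R (LinearMap.range h)]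
    (X : Type*) [AddCommGroup X] [Module R X] :
    Function.Exact (f.lTensor X) (g.lTensor X) := by
  have hinj : Function.Injective ((LinearMap.range g).subtype.lTensor X) := by
    refine Module.Flat.lTensor_injective_of_exact (g := h.rangeRestrict)
      (Submodule.injective_subtype _) (fun x ↦ ?_) h.surjective_rangeRestrict X
    simpa [Subtype.ext_iff] using hgh x
  have hex : Function.Exact f g.rangeRestrict := fun x ↦ by
    simpa [Subtype.ext_iff] using hfg x
  have := (lTensor_exact X hex g.surjective_rangeRestrict)
  intro x
  rw [← this x, ← map_eq_zero_iff _ hinj, ← LinearMap.comp_apply, ← LinearMap.lTensor_comp]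
  rfl

/-- If the first syzygy of `M` is flat, then `Torₙ(X, M)` vanishes for `n ≥ 2`. -/
theorem Module.Flat.isZero_Tor_of_flat_ker {R : Type u} [CommRing R] (X M : ModuleCat.{u} R)
    {P : Type*} [AddCommGroup P] [Module R P] [Module.Projective R P] {q : P →ₗ[R] M}
    (hq : Function.Surjective q) [Module.Flat R (LinearMap.ker q)] (n : ℕ) :
    IsZero (((Tor (ModuleCat.{u} R) (n + 2)).obj X).obj M) := by
  let Q := projectiveResolution M
  have hproj (i : ℕ) : Module.Projective R (Q.complex.X i) :=
    (IsProjective.iff_projective _).2 (Q.projective i)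
  have hex (i : ℕ) : Function.Exact (Q.complex.d (i + 2) (i + 1)).hom
      (Q.complex.d (i + 1) i).hom :=
    (ShortComplex.ShortExact.moduleCat_exact_iff_function_exact _).1 (Q.exact_succ i)
  have hflat (i : ℕ) : Module.Flat R (LinearMap.range (Q.complex.d (i + 1) i).hom) := by
    induction i with
    | zero =>
      let π : Q.complex.X 0 →ₗ[R] M := (Q.π.f 0).hom
      have hex₀ : Function.Exact (Q.complex.d 1 0).hom π :=
        (ShortComplex.ShortExact.moduleCat_exact_iff_function_exact _).1 Q.exact₀
      have hsurj : Function.Surjective π :=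
        (ModuleCat.epi_iff_surjective _).1 inferInstance
      rw [← hex₀.linearMap_ker_eq]
      exact Module.Flat.ker_of_projective (q' := q) hsurj hq
    | succ i ih =>
      refine Module.Flat.of_exact_of_flat (g := (Q.complex.d (i + 1) i).hom.rangeRestrict)
        (Submodule.injective_subtype _) (fun x ↦ ?_) (LinearMap.surjective_rangeRestrict _)
      simpa [Subtype.ext_iff] using hex i x
  refine IsZero.of_iso ?_ (Q.isoLeftDerivedObj _ (n + 2))
  rw [HomologicalComplex.homologyFunctor_obj, ← HomologicalComplex.exactAt_iff_isZero_homology,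
    HomologicalComplex.exactAt_iff' _ (n + 3) (n + 2) (n + 1) (by simp) (by simp),
    ShortComplex.ShortExact.moduleCat_exact_iff_function_exact]
  exact (hex (n + 1)).lTensor_of_flat_range (hex n) X

/-- Two elements of a flat ideal are combinations of common generators whose matrix of
coefficients has vanishing `2 × 2` minors. -/
theorem Ideal.exists_combination_of_flat {A : Type*} [CommRing A] (I : Ideal A) [Module.Flat A I]
    (x y : I) : ∃ (k : ℕ) (w : Fin k → I) (u v : Fin k → A),
      x = ∑ i, u i • w i ∧ y = ∑ i, v i • w i ∧ ∀ i j, u i * v j = u j * v i := by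
  let φ : (Fin 2 → A) →ₗ[A] I := Fintype.linearCombination A ![x, y]
  have hφ : φ ![(y : A), -(x : A)] = 0 := by
    simp only [φ, Fintype.linearCombination_apply, Fin.sum_univ_two]
    ext
    simp [mul_comm]
  obtain ⟨k, a, z, hφz, ha⟩ := Module.Flat.exists_factorization_of_apply_eq_zero_of_free hφ
  let e := a ![1, 0]
  let f := a ![0, 1]
  have hx : z e = x := by
    have := congr($hφz ![1, 0])
    simpa [φ, Fintype.linearCombination_apply] using this.symm
  have hy : z f = y := by
    have := congr($hφz ![0, 1])
    simpa [φ, Fintype.linearCombination_apply] using this.symm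
  have hef : (y : A) • e - (x : A) • f = 0 := by
    rw [← map_smul, ← map_smul, ← map_sub, ← ha]
    congr 1
    ext i
    fin_cases i <;> simp
  let ψ : (Fin k →₀ A) →ₗ[A] (Fin k →₀ A) :=
    Finsupp.linearCombination A fun j ↦ e j • f - f j • e
  have hzψ : z ∘ₗ ψ = 0 := by
    ext j : 2
    have := congr($hef j)
    ext
    simpa [ψ, hx, hy, mul_comm] using this
  obtain ⟨l, b, w, hzw, hb⟩ := Module.Flat.exists_factorization_of_comp_eq_zero_of_free hzψ
  have hrep (c : Fin l →₀ A) : w c = ∑ i, c i • w (Finsupp.single i 1) := by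
    conv_lhs => rw [← c.univ_sum_single]
    simp only [map_sum, ← map_smul, Finsupp.smul_single, smul_eq_mul, mul_one]
  refine ⟨l, fun i ↦ w (Finsupp.single i 1), b e, b f, ?_, ?_, fun i j ↦ ?_⟩
  · rw [← hrep, ← hx, hzw]; rfl
  · rw [← hrep, ← hy, hzw]; rfl
  · have h : b f j • e = b e j • f := by
      ext m
      have := congr($hb (Finsupp.single m 1) j)
      simp only [ψ, LinearMap.comp_apply, Finsupp.linearCombination_single, one_smul, map_sub,
        map_smul, Finsupp.sub_apply, Finsupp.smul_apply, smul_eq_mul, LinearMap.zero_apply,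
        Finsupp.zero_apply, sub_eq_zero] at this ⊢
      rw [mul_comm, this, mul_comm]
    simpa [mul_comm] using congr(b $h i)

/-- Every alternating bilinear expression in elements of a flat ideal vanishes. -/
theorem Ideal.map₂_eq_zero_of_flat {A : Type*} [CommRing A] (I : Ideal A) [Module.Flat A I]
    {N : Type*} [AddCommGroup N] [Module A N] (B : I →ₗ[A] I →ₗ[A] N) (hB : B.IsAlt) :
    B = 0 := by
  ext x y
  obtain ⟨k, w, u, v, rfl, rfl, huv⟩ := I.exists_combination_of_flat x y
  rw [LinearMap.zero_apply, LinearMap.zero_apply]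
  simp only [map_sum, map_smul, LinearMap.sum_apply, LinearMap.smul_apply, Finset.smul_sum,
    ← mul_smul]
  rw [← Finset.sum_product']
  refine Finset.sum_involution (fun p _ ↦ Prod.swap p) (fun p _ ↦ ?_) (fun p _ hp h ↦ hp ?_)
    (fun _ _ ↦ by simp) (fun _ _ ↦ by simp)
  · rw [← hB.neg (w p.1) (w p.2)]
    simp [mul_comm, huv p.1 p.2]
  · have : p.2 = p.1 := congr($h |>.1)
    rw [this, hB.self_eq_zero, smul_zero]

theorem Ideal.ι_mul_ι_cotangent_eq_zero_of_flat {A : Type*} [CommRing A] (I : Ideal A)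
    [Module.Flat A I] (x y : I.Cotangent) :
    ExteriorAlgebra.ι (A ⧸ I) x * ExteriorAlgebra.ι (A ⧸ I) y = 0 := by
  obtain ⟨x, rfl⟩ := I.toCotangent_surjective x
  obtain ⟨y, rfl⟩ := I.toCotangent_surjective y
  let f : I →ₗ[A] ExteriorAlgebra (A ⧸ I) I.Cotangent :=
    (ExteriorAlgebra.ι (A ⧸ I)).restrictScalars A ∘ₗ I.toCotangent
  exact congr($(I.map₂_eq_zero_of_flat ((LinearMap.mul A _).compl₁₂ f f)
    fun x ↦ ExteriorAlgebra.ι_sq_zero _) x y)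

theorem exteriorPower.subsingleton_of_ι_mul_ι_eq_zero {R M : Type*} [CommRing R] [AddCommGroup M]
    [Module R M] (h : ∀ x y : M, ExteriorAlgebra.ι R x * ExteriorAlgebra.ι R y = 0) (n : ℕ) :
    Subsingleton (⋀[R]^(n + 2) M) := by
  rw [Submodule.subsingleton_iff_eq_bot, ← ExteriorAlgebra.ιMulti_span_fixedDegree,
    Submodule.span_eq_bot]
  rintro _ ⟨v, rfl⟩
  simp [ExteriorAlgebra.ιMulti_apply, ← mul_assoc, h]

theorem Ideal.flat_cotangent {A : Type*} [CommRing A] (I : Ideal A) [Module.Flat A I] :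
    Module.Flat (A ⧸ I) I.Cotangent := by
  let e : (A ⧸ I) ⊗[A] I ≃ₗ[A] I.Cotangent := TensorProduct.quotTensorEquivQuotSMul I I
  exact Module.Flat.of_linearEquiv
    (e.extendScalarsOfSurjective (S := A ⧸ I) Ideal.Quotient.mk_surjective).symm

/-- **Flat ideals are quasi-regular.** If `𝔞` is an ideal of a commutative ring `A` that is
flat as an `A`-module, then: (a) the conormal module `𝔞/𝔞²` is a flat `A/𝔞`-module;
(b) `Tor_n^A(A/𝔞, A/𝔞) = 0` for all `n ≥ 2`; and (c) the `n`-th exterior power of the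
`A/𝔞`-module `𝔞/𝔞²` vanishes for all `n ≥ 2`. -/
theorem flat_ideal_quasiRegular (A : Type u) [CommRing A] (𝔞 : Ideal A)
    (hflat : Module.Flat A 𝔞) :
    Module.Flat (A ⧸ 𝔞) 𝔞.Cotangent ∧
    (∀ n : ℕ, 2 ≤ n →
      IsZero (((Tor (ModuleCat.{u} A) n).obj
        (ModuleCat.of A (A ⧸ 𝔞))).obj (ModuleCat.of A (A ⧸ 𝔞)))) ∧
    (∀ n : ℕ, 2 ≤ n → Subsingleton (⋀[A ⧸ 𝔞]^n 𝔞.Cotangent)) := by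
  refine ⟨𝔞.flat_cotangent, fun n hn ↦ ?_, fun n hn ↦ ?_⟩
  · obtain ⟨n, rfl⟩ := Nat.exists_eq_add_of_le' hn
    have : Module.Flat A (LinearMap.ker 𝔞.mkQ) := by rwa [Submodule.ker_mkQ]
    exact Module.Flat.isZero_Tor_of_flat_ker _ (ModuleCat.of A (A ⧸ 𝔞)) 𝔞.mkQ_surjective n
  · obtain ⟨n, rfl⟩ := Nat.exists_eq_add_of_le' hn
    exact exteriorPower.subsingleton_of_ι_mul_ι_eq_zero 𝔞.ι_mul_ι_cotangent_eq_zero_of_flat n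
end

section
/- Let A be a valuation ring and let 𝔞 be any ideal of A. Then 𝔞 is flat as an A-module and 𝔞 is quasi-regular; explicitly: 𝔞/𝔞² is a flat A/𝔞-module, Tor_n^A(A/𝔞, A/𝔞) = 0 for all n ≥ 2, and the n-th exterior power ⋀ⁿ_{A/𝔞}(𝔞/𝔞²) of the A/𝔞-module 𝔞/𝔞² is zero for all n ≥ 2. -/
open CategoryTheory CategoryTheory.Limits

universe u

open TensorProduct

namespace Module.Flat

/-- A module over a valuation ring is flat as soon as it is torsion-free. -/
theorem of_isTorsionFree_of_valuationRing {A M : Type*} [CommRing A] [IsDomain A]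
    [ValuationRing A] [AddCommGroup M] [Module A M] [Module.IsTorsionFree A M] :
    Module.Flat A M := by
  rw [flat_iff_torsion_eq_bot_of_isBezout, ← Submodule.isTorsionFree_iff_torsion_eq_bot]
  infer_instance

section

variable {R : Type*} [CommRing R] {N M Q : Type*} [AddCommGroup N] [AddCommGroup M]
  [AddCommGroup Q] [Module R N] [Module R M] [Module R Q]

/-- A short exact sequence with flat cokernel stays injective on the left after tensoring with
a module that has a given flat presentation. -/
theorem lTensor_injective_of_exact_of_flat_presentation {K F X : Type*} [AddCommGroup K]
    [AddCommGroup F] [AddCommGroup X] [Module R K] [Module R F] [Module R X] [Module.Flat R F]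
    [Module.Flat R Q] {i : K →ₗ[R] F} {p : F →ₗ[R] X} (hi : Function.Injective i)
    (hip : Function.Exact i p) (hp : Function.Surjective p) {f : N →ₗ[R] M} {g : M →ₗ[R] Q}
    (hf : Function.Injective f) (hfg : Function.Exact f g) (hg : Function.Surjective g) :
    Function.Injective (f.lTensor X) := by
  rw [injective_iff_map_eq_zero]
  intro z hz
  obtain ⟨w, rfl⟩ := LinearMap.rTensor_surjective N hp z
  obtain ⟨v, hv⟩ := (_root_.rTensor_exact M hip hp (f.lTensor F w)).mp <| by
    rw [← hz, ← LinearMap.comp_apply, ← LinearMap.comp_apply, LinearMap.rTensor_comp_lTensor,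
      LinearMap.lTensor_comp_rTensor]
  obtain ⟨t, rfl⟩ := (_root_.lTensor_exact K hfg hg v).mp <| by
    apply rTensor_preserves_injective_linearMap (M := Q) i hi
    rw [map_zero, ← LinearMap.comp_apply, LinearMap.rTensor_comp_lTensor,
      ← LinearMap.lTensor_comp_rTensor, LinearMap.comp_apply, hv]
    exact (_root_.lTensor_exact F hfg hg).apply_apply_eq_zero w
  have hw : i.rTensor N t = w := by
    apply lTensor_preserves_injective_linearMap (M := F) f hf
    rw [← hv, ← LinearMap.comp_apply, ← LinearMap.comp_apply, LinearMap.rTensor_comp_lTensor,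
      LinearMap.lTensor_comp_rTensor]
  rw [← hw]
  exact (_root_.rTensor_exact N hip hp).apply_apply_eq_zero t

/-- A short exact sequence with flat cokernel stays injective on the left after tensoring with
any module. -/
theorem lTensor_injective_of_exact_of_flat [Module.Flat R Q] {f : N →ₗ[R] M} {g : M →ₗ[R] Q}
    (hf : Function.Injective f) (hfg : Function.Exact f g) (hg : Function.Surjective g)
    (X : Type*) [AddCommGroup X] [Module R X] :
    Function.Injective (f.lTensor X) :=
  lTensor_injective_of_exact_of_flat_presentation (Submodule.subtype_injective _)
    (LinearMap.exact_subtype_ker_map _) (Finsupp.linearCombination_id_surjective R X) hf hfg hg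

/-- Exactness is preserved by tensoring with any module when the sequence continues to the right
with flat image. -/
theorem lTensor_exact_of_flat_range {L P : Type*} [AddCommGroup L] [AddCommGroup P] [Module R L]
    [Module R P] {d : L →ₗ[R] N} {f : N →ₗ[R] M} {g : M →ₗ[R] P} [Module.Flat R (LinearMap.range g)]
    (hdf : Function.Exact d f) (hfg : Function.Exact f g) (X : Type*) [AddCommGroup X]
    [Module R X] :
    Function.Exact (d.lTensor X) (f.lTensor X) := by
  have hd : Function.Exact d f.rangeRestrict := fun x ↦ by
    rw [← hdf x, ← Subtype.coe_inj]; rfl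
  have hinj : Function.Injective ((LinearMap.range f).subtype.lTensor X) :=
    lTensor_injective_of_exact_of_flat (g := g.rangeRestrict) (Submodule.subtype_injective _)
      (fun x ↦ by
        rw [← Subtype.coe_inj]
        exact (hfg x).trans (by simp))
      g.surjective_rangeRestrict X
  have hcomp : f.lTensor X =
      (LinearMap.range f).subtype.lTensor X ∘ₗ f.rangeRestrict.lTensor X := by
    rw [← LinearMap.lTensor_comp, LinearMap.subtype_comp_codRestrict]
  intro x
  rw [hcomp, LinearMap.comp_apply, map_eq_zero_iff _ hinj]
  exact _root_.lTensor_exact X hd f.surjective_rangeRestrict x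

end

end Module.Flat

/-- If every two elements of an ideal are comparable for divisibility, the higher exterior powers
of the conormal module vanish. -/
theorem Ideal.subsingleton_exteriorPower_cotangent {A : Type*} [CommRing A] [PreValuationRing A]
    (I : Ideal A) {n : ℕ} (hn : 2 ≤ n) : Subsingleton (⋀[A ⧸ I]^n I.Cotangent) := by
  have hne : (⟨0, by omega⟩ : Fin n) ≠ ⟨1, by omega⟩ := by simp
  have key : ∀ (v : Fin n → I.Cotangent) (i j : Fin n), i ≠ j → ∀ c : A, v j = c • v i →
      exteriorPower.ιMulti (A ⧸ I) n v = 0 := by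
    intro v i j hij c hc
    have hv : v = Function.update v j ((Ideal.Quotient.mk I c) • v i) := by
      rw [eq_comm, Function.update_eq_self_iff, hc]
      exact algebraMap_smul (A ⧸ I) c (v i)
    rw [hv, AlternatingMap.map_update_smul, AlternatingMap.map_update_self _ _ hij.symm, smul_zero]
  rw [← Submodule.subsingleton_iff (A ⧸ I), ← subsingleton_iff_bot_eq_top, eq_comm,
    ← exteriorPower.ιMulti_span, Submodule.span_eq_bot]
  rintro _ ⟨v, rfl⟩
  obtain ⟨x, hx⟩ := I.toCotangent_surjective (v ⟨0, by omega⟩)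
  obtain ⟨y, hy⟩ := I.toCotangent_surjective (v ⟨1, by omega⟩)
  obtain ⟨c, h | h⟩ := PreValuationRing.cond (x : A) (y : A)
  · refine key v _ _ hne c ?_
    rw [← hx, ← hy, ← map_smul]
    congr 1
    exact Subtype.ext (by rw [← h, mul_comm]; rfl)
  · refine key v _ _ hne.symm c ?_
    rw [← hx, ← hy, ← map_smul]
    congr 1
    exact Subtype.ext (by rw [← h, mul_comm]; rfl)

/-- Over a valuation ring, `Tor` vanishes in degrees at least two. -/
theorem ValuationRing.isZero_Tor {A : Type u} [CommRing A] [IsDomain A] [ValuationRing A]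
    (X Y : ModuleCat.{u} A) {n : ℕ} (hn : 2 ≤ n) :
    IsZero (((Tor (ModuleCat.{u} A) n).obj X).obj Y) := by
  obtain ⟨k, rfl⟩ := Nat.exists_eq_add_of_le' hn
  let P := projectiveResolution Y
  refine IsZero.of_iso ?_
    (P.isoLeftDerivedObj ((MonoidalCategory.tensoringLeft (ModuleCat.{u} A)).obj X) (k + 2))
  have hP : ∀ n, Module.Flat A (P.complex.X n) := fun n ↦ by
    have := (IsProjective.iff_projective (P.complex.X n)).mpr (P.projective n)
    infer_instance
  have h₁ := (ShortComplex.ShortExact.moduleCat_exact_iff_function_exact _).mp (P.exact_succ (k + 1))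
  have h₂ := (ShortComplex.ShortExact.moduleCat_exact_iff_function_exact _).mp (P.exact_succ k)
  have : Module.Flat A (LinearMap.range (P.complex.d (k + 1) k).hom) :=
    .of_isTorsionFree_of_valuationRing
  have h := Module.Flat.lTensor_exact_of_flat_range h₁ h₂ X
  rw [HomologicalComplex.homologyFunctor_obj, ← HomologicalComplex.exactAt_iff_isZero_homology,
    HomologicalComplex.exactAt_iff' _ (k + 3) (k + 2) (k + 1) (by simp) (by simp),
    ShortComplex.ShortExact.moduleCat_exact_iff_function_exact]
  exact h

/-- **Every ideal of a valuation ring is flat and quasi-regular.** If `A` is a valuation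
ring and `𝔞` is any ideal of `A`, then `𝔞` is flat as an `A`-module, the conormal module
`𝔞/𝔞²` is a flat `A/𝔞`-module, `Tor_n^A(A/𝔞, A/𝔞) = 0` for all `n ≥ 2`, and the `n`-th
exterior power of the `A/𝔞`-module `𝔞/𝔞²` vanishes for all `n ≥ 2`. -/
theorem valuationRing_ideal_flat_and_quasiRegular
    (A : Type u) [CommRing A] [IsDomain A] [ValuationRing A] (𝔞 : Ideal A) :
    Module.Flat A 𝔞 ∧
    Module.Flat (A ⧸ 𝔞) 𝔞.Cotangent ∧
    (∀ n : ℕ, 2 ≤ n →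
      IsZero (((Tor (ModuleCat.{u} A) n).obj
        (ModuleCat.of A (A ⧸ 𝔞))).obj (ModuleCat.of A (A ⧸ 𝔞)))) ∧
    (∀ n : ℕ, 2 ≤ n → Subsingleton (⋀[A ⧸ 𝔞]^n 𝔞.Cotangent)) := by
  have : Module.Flat A 𝔞 := .of_isTorsionFree_of_valuationRing
  exact ⟨this, 𝔞.flat_cotangent, fun _ hn ↦ ValuationRing.isZero_Tor _ _ hn,
    fun _ hn ↦ 𝔞.subsingleton_exteriorPower_cotangent hn⟩
end

section
/- Let f : A → B be a ring homomorphism of commutative rings, 𝔞 an ideal of A, and 𝔟 an ideal of B with f(𝔞) ⊆ 𝔟. The following are equivalent: (i) B is formally smooth over (A, 𝔞-adic topology) for the ideal 𝔟 with the 𝔟-adic topology; (i') B is formally smooth over (A, discrete topology) for the ideal 𝔟 with the 𝔟-adic topology; (ii) (Grothendieck's formal smoothness for the 𝔟-adic topology) for every commutative A-algebra C, every ideal M of C with M² = 0, and every A-algebra homomorphism u : B → C/M such that u(𝔟^t) = 0 for some t ≥ 1, there exists an A-algebra homomorphism g : B → C with p ∘ g = u, where p : C → C/M is the projection. -/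
universe u v

/-- `B` is *formally smooth* over `(A, 𝔄)` for the ideal `b` with the `𝔅`-topology, where
`𝔄 = (𝔄 n)` and `𝔅 = (𝔅 n)` are filtrations by ideals (indexed so that `𝔄 n`, `𝔅 n`
correspond to the `(n+1)`-st terms `𝔞_{n+1}`, `𝔟_{n+1}`): for every `A`-algebra `C` killed
by some `𝔄 r`, every square-zero ideal `M` of `C`, and every `A`-algebra map `u : B → C/M`
killing some `𝔅 t` and such that the preimage in `C` of the ideal generated by `u(b)`
kills `M`, there is an `A`-algebra lift `g : B → C` of `u`. -/
def IsFormallySmoothFor (A : Type u) (B : Type v) [CommRing A] [CommRing B] [Algebra A B]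
    (𝔄 : ℕ → Ideal A) (b : Ideal B) (𝔅 : ℕ → Ideal B) : Prop :=
  ∀ (C : Type (max u v)) [CommRing C] [Algebra A C],
    (∃ r, Ideal.map (algebraMap A C) (𝔄 r) = ⊥) →
    ∀ (M : Ideal C), M ^ 2 = ⊥ →
      ∀ u : B →ₐ[A] C ⧸ M,
        (∃ t, Ideal.map u (𝔅 t) = ⊥) →
        (Ideal.comap (Ideal.Quotient.mk M) (Ideal.map u b)) * M = ⊥ →
        ∃ g : B →ₐ[A] C, (Ideal.Quotient.mkₐ A M).comp g = u

namespace IsFormallySmoothFor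

/-- Lifting along an arbitrary surjection of `A`-algebras. -/
theorem exists_lift_of_surjective {A : Type u} {B : Type v} [CommRing A] [CommRing B]
    [Algebra A B] {𝔄 : ℕ → Ideal A} {b : Ideal B} {𝔅 : ℕ → Ideal B}
    (h : IsFormallySmoothFor A B 𝔄 b 𝔅) {C D : Type (max u v)} [CommRing C] [Algebra A C]
    [CommRing D] [Algebra A D] (π : C →ₐ[A] D) (hπ : Function.Surjective π)
    (h𝔄 : ∃ r, Ideal.map (algebraMap A C) (𝔄 r) = ⊥) (hker : RingHom.ker π ^ 2 = ⊥)
    (u : B →ₐ[A] D) (h𝔅 : ∃ t, Ideal.map u (𝔅 t) = ⊥)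
    (hb : Ideal.comap π (Ideal.map u b) * RingHom.ker π = ⊥) :
    ∃ g : B →ₐ[A] C, π.comp g = u := by
  let e := Ideal.quotientKerAlgEquivOfSurjective hπ
  have he (c : C) : e (Ideal.Quotient.mk _ c) = π c := rfl
  have hmap (I : Ideal B) :
      Ideal.map ((e.symm : D →ₐ[A] C ⧸ RingHom.ker π).comp u) I = Ideal.comap e (Ideal.map u I) := by
    rw [← Ideal.map_mapₐ]
    exact Ideal.map_symm e.toRingEquiv
  have hu𝔅 : ∃ t, Ideal.map ((e.symm : D →ₐ[A] C ⧸ RingHom.ker π).comp u) (𝔅 t) = ⊥ := by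
    obtain ⟨t, ht⟩ := h𝔅
    refine ⟨t, ?_⟩
    rw [hmap, ht]
    exact (RingHom.ker_eq_bot_iff_eq_zero e).2 fun x hx => by simpa using hx
  have hub : Ideal.comap (Ideal.Quotient.mk (RingHom.ker π))
      (Ideal.map ((e.symm : D →ₐ[A] C ⧸ RingHom.ker π).comp u) b) * RingHom.ker π = ⊥ := by
    rw [hmap]
    exact hb
  obtain ⟨g, hg⟩ := h C h𝔄 (RingHom.ker π) hker _ hu𝔅 hub
  refine ⟨g, AlgHom.ext fun x => ?_⟩
  have hx := congrArg e (DFunLike.congr_fun hg x)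
  simpa [he] using hx

/-- Grothendieck's lifting property follows from the refined one: a lift along a square-zero
ideal `M` is built successively modulo `I ^ k * M`, where `I` is the preimage of the ideal
generated by the image of `𝔟`. -/
theorem exists_lift_of_adic {A : Type u} {B : Type v} [CommRing A] [CommRing B]
    [Algebra A B] {𝔞 : Ideal A} {𝔟 : Ideal B} (hab : Ideal.map (algebraMap A B) 𝔞 ≤ 𝔟)
    (h : IsFormallySmoothFor A B (fun n => 𝔞 ^ (n + 1)) 𝔟 (fun n => 𝔟 ^ (n + 1)))
    {C : Type (max u v)} [CommRing C] [Algebra A C] (M : Ideal C) (hM : M ^ 2 = ⊥)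
    (u : B →ₐ[A] C ⧸ M) {t : ℕ} (ht : Ideal.map u (𝔟 ^ t) = ⊥) :
    ∃ g : B →ₐ[A] C, (Ideal.Quotient.mkₐ A M).comp g = u := by
  set I : Ideal C := Ideal.comap (Ideal.Quotient.mk M) (Ideal.map u 𝔟) with hI
  have hIt : I ^ t ≤ M := by
    rw [← Ideal.mk_ker (I := M), ← Ideal.map_eq_bot_iff_le_ker, Ideal.map_pow, hI,
      Ideal.map_comap_of_surjective _ Ideal.Quotient.mk_surjective, ← Ideal.map_pow, ht]
  have hItM : I ^ t * M = ⊥ := by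
    rw [eq_bot_iff, ← hM, pow_two]
    exact Ideal.mul_mono_left hIt
  have hIn : I ^ (2 * t + 1) = ⊥ := by
    rw [eq_bot_iff, ← hM]
    calc I ^ (2 * t + 1) ≤ I ^ (t * 2) := Ideal.pow_le_pow_right (by lia)
      _ = (I ^ t) ^ 2 := pow_mul _ _ _
      _ ≤ M ^ 2 := Ideal.pow_right_mono hIt 2
  have h𝔞I : Ideal.map (algebraMap A C) 𝔞 ≤ I := by
    rw [Ideal.map_le_iff_le_comap]
    intro a ha
    have : algebraMap A (C ⧸ M) a ∈ Ideal.map u 𝔟 := by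
      rw [← u.commutes]
      exact Ideal.mem_map_of_mem u (hab (Ideal.mem_map_of_mem _ ha))
    exact this
  have hle (k : ℕ) : I ^ k * M ≤ M := Ideal.mul_le_right
  have hmem {k : ℕ} {g : B →ₐ[A] C ⧸ (I ^ k * M)}
      (hg : (Ideal.Quotient.factorₐ A (hle k)).comp g = u) {c : C}
      (hc : Ideal.Quotient.mk (I ^ k * M) c ∈ Ideal.map g 𝔟) : c ∈ I := by
    have h1 := Ideal.mem_map_of_mem (Ideal.Quotient.factorₐ A (hle k)) hc
    rw [Ideal.map_mapₐ, hg] at h1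
    exact h1
  have hlift (k : ℕ) : ∃ g : B →ₐ[A] C ⧸ (I ^ k * M),
      (Ideal.Quotient.factorₐ A (hle k)).comp g = u := by
    induction k with
    | zero =>
      have hM0 : M ≤ I ^ 0 * M := by simp
      refine ⟨(Ideal.Quotient.factorₐ A hM0).comp u, ?_⟩
      rw [← AlgHom.comp_assoc, Ideal.Quotient.factorₐ_comp]
      ext x
      obtain ⟨c, hc⟩ := Ideal.Quotient.mk_surjective (u x)
      simp [← hc]
    | succ k ih =>
      obtain ⟨g, hg⟩ := ih
      have hk : I ^ (k + 1) * M ≤ I ^ k * M :=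
        Ideal.mul_mono_left (Ideal.pow_le_pow_right k.le_succ)
      have hker : RingHom.ker (Ideal.Quotient.factorₐ A hk) =
          Ideal.map (Ideal.Quotient.mk (I ^ (k + 1) * M)) (I ^ k * M) :=
        Ideal.Quotient.factor_ker hk
      have hgI : Ideal.map g 𝔟 ≤ Ideal.map (Ideal.Quotient.mk (I ^ k * M)) I := by
        intro x hx
        obtain ⟨c, rfl⟩ := Ideal.Quotient.mk_surjective x
        exact Ideal.mem_map_of_mem _ (hmem hg hx)
      have hcI : Ideal.comap (Ideal.Quotient.factorₐ A hk) (Ideal.map g 𝔟) ≤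
          Ideal.map (Ideal.Quotient.mk (I ^ (k + 1) * M)) I := by
        intro x hx
        obtain ⟨c, rfl⟩ := Ideal.Quotient.mk_surjective x
        exact Ideal.mem_map_of_mem _ (hmem hg hx)
      have h𝔞 : Ideal.map (algebraMap A (C ⧸ (I ^ (k + 1) * M))) (𝔞 ^ (2 * t + 1)) = ⊥ := by
        rw [eq_bot_iff, IsScalarTower.algebraMap_eq A C, ← Ideal.map_map, Ideal.map_pow]
        refine (Ideal.map_mono (Ideal.pow_right_mono h𝔞I _)).trans ?_
        rw [hIn, Ideal.map_bot]
      have hsq : RingHom.ker (Ideal.Quotient.factorₐ A hk) ^ 2 = ⊥ := by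
        rw [hker, ← Ideal.map_pow, eq_bot_iff]
        refine (Ideal.map_mono (Ideal.pow_right_mono (hle k) 2)).trans ?_
        rw [hM, Ideal.map_bot]
      have hg𝔟 : Ideal.map g (𝔟 ^ (2 * t + 1)) = ⊥ := by
        rw [eq_bot_iff, Ideal.map_pow]
        refine (Ideal.pow_right_mono hgI _).trans ?_
        rw [← Ideal.map_pow, hIn, Ideal.map_bot]
      have hann : Ideal.comap (Ideal.Quotient.factorₐ A hk) (Ideal.map g 𝔟) *
          RingHom.ker (Ideal.Quotient.factorₐ A hk) = ⊥ := by
        rw [eq_bot_iff, hker]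
        refine (Ideal.mul_mono_left hcI).trans ?_
        rw [← Ideal.map_mul, ← mul_assoc, ← pow_succ', Ideal.map_quotient_self]
      obtain ⟨g', hg'⟩ := h.exists_lift_of_surjective (Ideal.Quotient.factorₐ A hk)
        (Ideal.Quotient.factor_surjective hk) ⟨2 * t, h𝔞⟩ hsq g ⟨2 * t, hg𝔟⟩ hann
      refine ⟨g', ?_⟩
      rw [← hg, ← hg', ← AlgHom.comp_assoc, Ideal.Quotient.factorₐ_comp]
  obtain ⟨g, hg⟩ := hlift t
  have hbij : Function.Bijective (Ideal.Quotient.mkₐ A (I ^ t * M)) := by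
    refine ⟨?_, Ideal.Quotient.mk_surjective⟩
    rw [RingHom.injective_iff_ker_eq_bot, ← hItM]
    exact Ideal.mk_ker
  let e := AlgEquiv.ofBijective _ hbij
  refine ⟨(e.symm : _ →ₐ[A] C).comp g, AlgHom.ext fun x => ?_⟩
  obtain ⟨c, hc⟩ := e.surjective (g x)
  have hs : e.symm (g x) = c := by rw [← hc, e.symm_apply_apply]
  calc Ideal.Quotient.mk M (e.symm (g x))
      = Ideal.Quotient.factorₐ A (hle t) (e c) := by rw [hs]; rfl
    _ = u x := by rw [hc, ← hg]; rfl

end IsFormallySmoothFor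

/-- For adic topologies, the refined notion of formal smoothness coincides with
Grothendieck's:  given `f : A → B`, an ideal `𝔞` of `A` and an ideal `𝔟` of `B` with
`f(𝔞) ⊆ 𝔟`, the following are equivalent: (i) `B` is formally smooth over
`(A, 𝔞`-adic`)` for the ideal `𝔟` with the `𝔟`-adic topology; (i') the same with the
discrete topology on `A`; (ii) Grothendieck's formal smoothness of `B` over `A` for the
`𝔟`-adic topology. -/
theorem isFormallySmoothFor_adic_iff
    (A : Type u) (B : Type v) [CommRing A] [CommRing B] [Algebra A B]
    (𝔞 : Ideal A) (𝔟 : Ideal B) (hab : Ideal.map (algebraMap A B) 𝔞 ≤ 𝔟) :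
    (IsFormallySmoothFor A B (fun n => 𝔞 ^ (n + 1)) 𝔟 (fun n => 𝔟 ^ (n + 1)) ↔
      IsFormallySmoothFor A B (fun _ => (⊥ : Ideal A)) 𝔟 (fun n => 𝔟 ^ (n + 1))) ∧
    (IsFormallySmoothFor A B (fun n => 𝔞 ^ (n + 1)) 𝔟 (fun n => 𝔟 ^ (n + 1)) ↔
      (∀ (C : Type (max u v)) [CommRing C] [Algebra A C] (M : Ideal C), M ^ 2 = ⊥ →
        ∀ u : B →ₐ[A] C ⧸ M, (∃ t, 1 ≤ t ∧ Ideal.map u (𝔟 ^ t) = ⊥) →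
          ∃ g : B →ₐ[A] C, (Ideal.Quotient.mkₐ A M).comp g = u)) := by
  have hlift h (C : Type (max u v)) [CommRing C] [Algebra A C] :=
    IsFormallySmoothFor.exists_lift_of_adic (C := C) hab h
  refine ⟨⟨fun h C _ _ _ M hM v hv _ => ?_, fun h C _ _ _ M hM v hv hvM => ?_⟩,
    fun h C _ _ M hM v ⟨t, _, ht⟩ => hlift h C M hM v ht,
    fun h C _ _ _ M hM v ⟨t, ht⟩ _ => h C M hM v ⟨t + 1, by lia, ht⟩⟩
  · obtain ⟨t, ht⟩ := hv
    exact hlift h C M hM v ht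
  · exact h C ⟨0, Ideal.map_bot⟩ M hM v hv hvM
end
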